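/- arXiv:2211.17069 — 3 statements merged into one kernel-verified Lean document; each statement's English description precedes it below -/
import Mathlib

section
/- Let K, L ⊆ ℝ^n be convex bodies with M(K,L) = |K ∩ (−L)|. Then the limiting convolution body C₁(K,L) = lim_{θ→1⁻} (K +_θ L)/(1 − θ) satisfies |C₁(K,L)|^(1/n) ≥ (1/n)·binom(2n,n)^(1/n)·|K|^(1/n)|L|^(1/n)/M(K,L)^(1/n), with equality if and only if K = −L is a simplex. -/
open MeasureTheory Set Pointwise

variable {n : ℕ}

/-- The generalized covariogram `z ↦ |K ∩ (z - L)|`. -/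
noncomputable def covar (K L : Set (EuclideanSpace ℝ (Fin n)))
    (z : EuclideanSpace ℝ (Fin n)) : ℝ :=
  (volume {x | x ∈ K ∧ z - x ∈ L}).toReal

/-- `M(K,L) = max_z |K ∩ (z - L)|`. -/
noncomputable def Mmax (K L : Set (EuclideanSpace ℝ (Fin n))) : ℝ :=
  ⨆ z, covar K L z

/-- The θ-convolution body. -/
noncomputable def thetaConv (K L : Set (EuclideanSpace ℝ (Fin n))) (θ : ℝ) :
    Set (EuclideanSpace ℝ (Fin n)) :=
  {z ∈ K + L | θ * Mmax K L ≤ covar K L z}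

/-- A convex body: compact, convex, with nonempty interior. -/
def IsConvexBody (K : Set (EuclideanSpace ℝ (Fin n))) : Prop :=
  IsCompact K ∧ Convex ℝ K ∧ (interior K).Nonempty
/-- An n-dimensional simplex: the convex hull of n+1 affinely independent points. -/
def IsSimplexBody (K : Set (EuclideanSpace ℝ (Fin n))) : Prop :=
  ∃ v : Fin (n + 1) → EuclideanSpace ℝ (Fin n),
    AffineIndependent ℝ v ∧ K = convexHull ℝ (Set.range v)

section LcbPart1

theorem lcb_bm1_compact {a b : ℝ} (ha : 0 < a) (hb : 0 < b) {A B C : Set ℝ}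
    (hA : IsCompact A) (hB : IsCompact B) (hA0 : A.Nonempty) (hB0 : B.Nonempty)
    (h : ∀ x ∈ A, ∀ y ∈ B, a * x + b * y ∈ C) :
    ENNReal.ofReal a * volume A + ENNReal.ofReal b * volume B ≤ volume C := by
  obtain ⟨α, hα, hα'⟩ := hA.exists_isGreatest hA0
  obtain ⟨β, hβ, hβ'⟩ := hB.exists_isLeast hB0
  set m := a * α + b * β with hm
  have h1 : ENNReal.ofReal a * volume A ≤ volume (C ∩ Iic m) := by
    have : volume ((fun x => x + b * β) '' (a • A)) = ENNReal.ofReal a * volume A := by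
      rw [Set.image_add_right, measure_preimage_add_right, Measure.addHaar_smul]
      simp [abs_of_pos ha]
    rw [← this]
    apply measure_mono
    rintro _ ⟨_, ⟨x, hx, rfl⟩, rfl⟩
    refine ⟨h x hx β hβ, ?_⟩
    have := hα' hx
    simp only [smul_eq_mul, mem_Iic, hm]
    nlinarith
  have h2 : ENNReal.ofReal b * volume B ≤ volume (C \ Iio m) := by
    have : volume ((fun x => x + a * α) '' (b • B)) = ENNReal.ofReal b * volume B := by
      rw [Set.image_add_right, measure_preimage_add_right, Measure.addHaar_smul]
      simp [abs_of_pos hb]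
    rw [← this]
    apply measure_mono
    rintro _ ⟨_, ⟨x, hx, rfl⟩, rfl⟩
    refine ⟨?_, ?_⟩
    · have := h α hα x hx
      simpa [add_comm] using this
    have := hβ' hx
    simp only [smul_eq_mul, mem_Iio, hm, not_lt]
    nlinarith
  have h3 : volume (C ∩ Iic m) = volume (C ∩ Iio m) := by
    apply measure_congr
    exact (Filter.EventuallyEq.refl _ C).inter Iio_ae_eq_Iic.symm
  rw [← measure_inter_add_sdiff C (measurableSet_Iio (a := m)), ← h3]
  exact add_le_add h1 h2

theorem lcb_bm1 {a b : ℝ} (ha : 0 < a) (hb : 0 < b) {A B C : Set ℝ}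
    (hA : MeasurableSet A) (hB : MeasurableSet B) (hA0 : A.Nonempty) (hB0 : B.Nonempty)
    (h : ∀ x ∈ A, ∀ y ∈ B, a * x + b * y ∈ C) :
    ENNReal.ofReal a * volume A + ENNReal.ofReal b * volume B ≤ volume C := by
  obtain ⟨x0, hx0⟩ := hA0
  obtain ⟨y0, hy0⟩ := hB0
  rw [hA.measure_eq_iSup_isCompact, hB.measure_eq_iSup_isCompact]
  simp only [ENNReal.mul_iSup, iSup_and']
  refine ENNReal.biSup_add_biSup_le' ⟨∅, by simp⟩ ⟨∅, by simp⟩ ?_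
  rintro A' ⟨hA', hA''⟩ B' ⟨hB', hB''⟩
  refine le_trans (add_le_add ?_ ?_) (lcb_bm1_compact ha hb (A := insert x0 A')
    (B := insert y0 B') (hA''.insert _) (hB''.insert _) ⟨x0, by simp⟩ ⟨y0, by simp⟩ ?_)
  · gcongr; simp
  · gcongr; simp
  · intro x hx y hy
    exact h x (insert_subset hx0 hA' hx) y (insert_subset hy0 hB' hy)

theorem lcb_pl1_real {a b : ℝ} (ha : 0 < a) (hb : 0 < b) (hab : a + b = 1) {f g h : ℝ → ℝ}
    (hf : Measurable f) (hg : Measurable g) (hh : Measurable h)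
    (hf0 : ∀ x, 0 ≤ f x) (hg0 : ∀ x, 0 ≤ g x) (hh0 : ∀ x, 0 ≤ h x)
    (hf1 : ∀ x, f x ≤ 1) (hg1 : ∀ x, g x ≤ 1)
    (hfs : ∀ t < 1, ∃ x, t < f x) (hgs : ∀ t < 1, ∃ x, t < g x)
    (H : ∀ x y, f x ^ a * g y ^ b ≤ h (a * x + b * y)) :
    ENNReal.ofReal a * (∫⁻ x, ENNReal.ofReal (f x)) + ENNReal.ofReal b * (∫⁻ x, ENNReal.ofReal (g x))
      ≤ ∫⁻ x, ENNReal.ofReal (h x) := by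
  rw [lintegral_eq_lintegral_meas_lt _ (Filter.Eventually.of_forall hf0) hf.aemeasurable,
    lintegral_eq_lintegral_meas_lt _ (Filter.Eventually.of_forall hg0) hg.aemeasurable,
    lintegral_eq_lintegral_meas_lt _ (Filter.Eventually.of_forall hh0) hh.aemeasurable]
  have hmf : Measurable (fun t : ℝ => volume {x | t < f x}) :=
    Antitone.measurable (fun s t hst => measure_mono (fun x hx => lt_of_le_of_lt hst hx))
  have hmg : Measurable (fun t : ℝ => volume {x | t < g x}) :=
    Antitone.measurable (fun s t hst => measure_mono (fun x hx => lt_of_le_of_lt hst hx))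
  rw [← lintegral_const_mul _ hmf, ← lintegral_const_mul _ hmg, ← lintegral_add_left (hmf.const_mul _)]
  apply lintegral_mono_ae
  filter_upwards [ae_restrict_mem measurableSet_Ioi] with t ht
  by_cases h1 : t < 1
  · apply lcb_bm1 ha hb (measurableSet_lt measurable_const hf) (measurableSet_lt measurable_const hg)
      (hfs t h1) (hgs t h1)
    intro x hx y hy
    refine lt_of_lt_of_le ?_ (H x y)
    have ht : 0 < t := ht
    calc t = t ^ a * t ^ b := by rw [← Real.rpow_add ht, hab, Real.rpow_one]
      _ < f x ^ a * g y ^ b := by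
        have e1 : t ^ a < f x ^ a := Real.rpow_lt_rpow ht.le hx ha
        have e2 : t ^ b < g y ^ b := Real.rpow_lt_rpow ht.le hy hb
        have e3 : 0 < t ^ a := Real.rpow_pos_of_pos ht _
        have e4 : 0 < t ^ b := Real.rpow_pos_of_pos ht _
        exact mul_lt_mul'' e1 e2 e3.le e4.le
  · have e1 : {x | t < f x} = ∅ := by
      ext x; simp only [mem_ofPred_eq, mem_empty_iff_false, iff_false, not_lt]; linarith [hf1 x]
    have e2 : {x | t < g x} = ∅ := by
      ext x; simp only [mem_ofPred_eq, mem_empty_iff_false, iff_false, not_lt]; linarith [hg1 x]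
    simp [e1, e2]

theorem lcb_amgm {a b : ℝ} (ha : 0 < a) (hb : 0 < b) (hab : a + b = 1) (x y : ENNReal) :
    x ^ a * y ^ b ≤ ENNReal.ofReal a * x + ENNReal.ofReal b * y := by
  by_cases hx : x = ⊤
  · subst hx; simp [ENNReal.mul_top, ha]
  by_cases hy : y = ⊤
  · subst hy; simp [ENNReal.mul_top, hb]
  lift x to NNReal using hx
  lift y to NNReal using hy
  rw [← ENNReal.coe_rpow_of_nonneg _ ha.le, ← ENNReal.coe_rpow_of_nonneg _ hb.le]
  have := NNReal.geom_mean_le_arith_mean2_weighted ⟨a, ha.le⟩ ⟨b, hb.le⟩ x y (by ext; exact hab)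
  rw [ENNReal.ofReal_eq_coe_nnreal ha.le, ENNReal.ofReal_eq_coe_nnreal hb.le]
  exact_mod_cast this

/-- Prékopa–Leindler property. -/
def LcbPL (E : Type) [MeasureSpace E] [AddCommGroup E] [Module ℝ E] : Prop :=
  ∀ a b : ℝ, 0 < a → 0 < b → a + b = 1 → ∀ f g h : E → ENNReal,
    Measurable f → Measurable g → Measurable h →
    (∀ x y, f x ^ a * g y ^ b ≤ h (a • x + b • y)) →
    (∫⁻ x, f x) ^ a * (∫⁻ x, g x) ^ b ≤ ∫⁻ x, h x

theorem lcb_sup_aux (f : ℝ → ENNReal) (hF0 : (⨆ x, f x) ≠ 0) (hFt : (⨆ x, f x) ≠ ⊤) :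
    ∀ t < (1 : ℝ), ∃ x, t < (f x / (⨆ x, f x)).toReal := by
  intro t ht
  have : ENNReal.ofReal (max t 0) * (⨆ x, f x) < (⨆ x, f x) := by
    calc ENNReal.ofReal (max t 0) * (⨆ x, f x) < 1 * (⨆ x, f x) := by
          apply ENNReal.mul_lt_mul_left hF0 hFt
          simpa using ht
      _ = (⨆ x, f x) := one_mul _
  obtain ⟨x, hx⟩ := lt_iSup_iff.1 this
  refine ⟨x, lt_of_le_of_lt (le_max_left t 0) ?_⟩
  rw [← ENNReal.ofReal_lt_iff_lt_toReal (le_max_right _ _)]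
  · rwa [ENNReal.lt_div_iff_mul_lt (Or.inl hF0) (Or.inl hFt)]
  · exact ne_top_of_le_ne_top ENNReal.one_ne_top (ENNReal.div_le_of_le_mul (by simpa using le_iSup f x))

theorem lcb_pl1_bdd {a b : ℝ} (ha : 0 < a) (hb : 0 < b) (hab : a + b = 1) {f g h : ℝ → ENNReal}
    (hf : Measurable f) (hg : Measurable g) (hh : Measurable h)
    (hfb : (⨆ x, f x) ≠ ⊤) (hgb : (⨆ x, g x) ≠ ⊤)
    (H : ∀ x y, f x ^ a * g y ^ b ≤ h (a * x + b * y)) :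
    (∫⁻ x, f x) ^ a * (∫⁻ x, g x) ^ b ≤ ∫⁻ x, h x := by
  set F := ⨆ x, f x with hF
  set G := ⨆ x, g x with hG
  by_cases hF0 : F = 0
  · have : ∀ x, f x = 0 := fun x => le_antisymm (hF0 ▸ le_iSup f x) (zero_le)
    simp [this, ha]
  by_cases hG0 : G = 0
  · have : ∀ x, g x = 0 := fun x => le_antisymm (hG0 ▸ le_iSup g x) (zero_le)
    simp [this, hb]
  set c := F ^ a * G ^ b with hc
  have hFa0 : F ^ a ≠ 0 := by simp [hF0, ha.le, hfb]
  have hGb0 : G ^ b ≠ 0 := by simp [hG0, hb.le, hgb]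
  have hFat : F ^ a ≠ ⊤ := by simp [ha.le, hfb]
  have hGbt : G ^ b ≠ ⊤ := by simp [hb.le, hgb]
  have hc0 : c ≠ 0 := mul_ne_zero hFa0 hGb0
  have hct : c ≠ ⊤ := ENNReal.mul_ne_top hFat hGbt
  have hfF : ∀ x, f x / F ≤ 1 := fun x => ENNReal.div_le_of_le_mul (by simpa using le_iSup f x)
  have hgG : ∀ x, g x / G ≤ 1 := fun x => ENNReal.div_le_of_le_mul (by simpa using le_iSup g x)
  have hft : ∀ x, f x / F ≠ ⊤ := fun x => ne_top_of_le_ne_top ENNReal.one_ne_top (hfF x)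
  have hgt : ∀ x, g x / G ≠ ⊤ := fun x => ne_top_of_le_ne_top ENNReal.one_ne_top (hgG x)
  have key := lcb_pl1_real ha hb hab (f := fun x => (f x / F).toReal) (g := fun x => (g x / G).toReal)
    (h := fun x => (min 1 (h x / c)).toReal)
    (hf.div_const _).ennreal_toReal (hg.div_const _).ennreal_toReal
    (measurable_const.min (hh.div_const _)).ennreal_toReal
    (fun x => ENNReal.toReal_nonneg) (fun x => ENNReal.toReal_nonneg) (fun x => ENNReal.toReal_nonneg)
    (fun x => ENNReal.toReal_le_of_le_ofReal zero_le_one (by simpa using hfF x))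
    (fun x => ENNReal.toReal_le_of_le_ofReal zero_le_one (by simpa using hgG x)) ?_ ?_ ?_
  · have e1 : ∀ x, ENNReal.ofReal ((f x / F).toReal) = f x / F := fun x => ENNReal.ofReal_toReal (hft x)
    have e2 : ∀ x, ENNReal.ofReal ((g x / G).toReal) = g x / G := fun x => ENNReal.ofReal_toReal (hgt x)
    have e3 : ∀ x, ENNReal.ofReal ((min 1 (h x / c)).toReal) ≤ h x / c := fun x =>
      ENNReal.ofReal_toReal_le.trans (min_le_right _ _)
    simp only [e1, e2] at key
    have key2 := (lcb_amgm ha hb hab _ _).trans (key.trans (lintegral_mono e3))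
    simp only [div_eq_mul_inv] at key2
    rw [lintegral_mul_const _ hf, lintegral_mul_const _ hg, lintegral_mul_const _ hh,
      ENNReal.mul_rpow_of_nonneg _ _ ha.le, ENNReal.mul_rpow_of_nonneg _ _ hb.le,
      ENNReal.inv_rpow, ENNReal.inv_rpow] at key2
    have e4 : (∫⁻ x, f x) ^ a * (F ^ a)⁻¹ * ((∫⁻ x, g x) ^ b * (G ^ b)⁻¹) =
        (∫⁻ x, f x) ^ a * (∫⁻ x, g x) ^ b * c⁻¹ := by
      rw [hc, ENNReal.mul_inv (Or.inl hFa0) (Or.inl hFat)]; ring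
    rw [e4] at key2
    have := mul_le_mul_left key2 c
    rwa [mul_assoc, mul_assoc _ c⁻¹ c, ENNReal.inv_mul_cancel hc0 hct, mul_one, mul_one] at this
  · exact lcb_sup_aux f hF0 hfb
  · exact lcb_sup_aux g hG0 hgb
  · intro x y
    rw [ENNReal.toReal_rpow, ENNReal.toReal_rpow, ← ENNReal.toReal_mul]
    apply ENNReal.toReal_mono (ne_top_of_le_ne_top ENNReal.one_ne_top (min_le_left _ _))
    have e5 : (f x / F) ^ a * (g y / G) ^ b = f x ^ a * g y ^ b / c := by
      rw [ENNReal.div_rpow_of_nonneg _ _ ha.le, ENNReal.div_rpow_of_nonneg _ _ hb.le, hc]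
      simp only [div_eq_mul_inv]
      rw [ENNReal.mul_inv (Or.inl hFa0) (Or.inl hFat)]; ring
    apply le_min
    · calc (f x / F) ^ a * (g y / G) ^ b ≤ 1 ^ a * 1 ^ b := by
            gcongr
            · exact hfF x
            · exact hgG y
        _ = 1 := by simp
    · rw [e5]
      gcongr
      exact H x y

theorem lcb_pl1 : LcbPL ℝ := by
  intro a b ha hb hab f g h hf hg hh H
  have mono : ∀ f : ℝ → ENNReal, Monotone (fun (k : ℕ) x => min (f x) (k : ENNReal)) := by
    intro f i j hij x
    exact min_le_min_left _ (by exact_mod_cast hij)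
  have sup : ∀ f : ℝ → ENNReal, Measurable f →
      ∫⁻ x, f x = ⨆ k : ℕ, ∫⁻ x, min (f x) (k : ENNReal) := by
    intro f hf
    rw [← lintegral_iSup (fun k => hf.min measurable_const) (mono f)]
    congr 1
    ext x
    apply le_antisymm
    · by_cases hx : f x = ⊤
      · rw [hx]
        simp [ENNReal.iSup_natCast]
      · obtain ⟨k, hk⟩ := ENNReal.exists_nat_gt hx
        exact le_iSup_of_le k (le_min le_rfl hk.le)
    · exact iSup_le fun k => min_le_left _ _
  have bdd : ∀ (f : ℝ → ENNReal) (k : ℕ), (⨆ x, min (f x) (k : ENNReal)) ≠ ⊤ := fun f k =>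
    ne_top_of_le_ne_top (ENNReal.natCast_ne_top k) (iSup_le fun x => min_le_right _ _)
  have tend : ∀ f : ℝ → ENNReal, Measurable f →
      Filter.Tendsto (fun k : ℕ => ∫⁻ x, min (f x) (k : ENNReal)) Filter.atTop (nhds (∫⁻ x, f x)) := by
    intro f hf
    rw [sup f hf]
    exact tendsto_atTop_iSup (fun i j hij => lintegral_mono (mono f hij))
  have step : ∀ k l : ℕ, (∫⁻ x, min (f x) (k : ENNReal)) ^ a * (∫⁻ x, min (g x) (l : ENNReal)) ^ b
      ≤ ∫⁻ x, h x := by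
    intro k l
    refine lcb_pl1_bdd ha hb hab (hf.min measurable_const) (hg.min measurable_const) hh
      (bdd f k) (bdd g l) ?_
    intro x y
    refine le_trans ?_ (H x y)
    gcongr
    · exact min_le_left _ _
    · exact min_le_left _ _
  have pw : ∀ (f : ℝ → ENNReal), Measurable f → ∀ c : ℝ, 0 < c →
      (∫⁻ x, f x) ^ c = ⨆ k : ℕ, (∫⁻ x, min (f x) (k : ENNReal)) ^ c := by
    intro f hf c hc
    apply tendsto_nhds_unique ((ENNReal.continuous_rpow_const.tendsto _).comp (tend f hf))
    exact tendsto_atTop_iSup (fun i j hij =>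
      ENNReal.rpow_le_rpow (lintegral_mono (mono f hij)) hc.le)
  rw [pw f hf a ha, pw g hg b hb, ENNReal.iSup_mul]
  refine iSup_le fun k => ?_
  rw [ENNReal.mul_iSup]
  exact iSup_le fun l => step k l

theorem lcb_pl_prod {E F : Type} [MeasureSpace E] [AddCommGroup E] [Module ℝ E]
    [MeasureSpace F] [AddCommGroup F] [Module ℝ F] [SFinite (volume : Measure F)]
    (hE : LcbPL E) (hF : LcbPL F) : LcbPL (E × F) := by
  intro a b ha hb hab f g h hf hg hh H
  rw [Measure.volume_eq_prod, lintegral_prod _ hf.aemeasurable, lintegral_prod _ hg.aemeasurable,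
    lintegral_prod _ hh.aemeasurable]
  refine hE a b ha hb hab _ _ _ hf.lintegral_prod_right' hg.lintegral_prod_right'
    hh.lintegral_prod_right' ?_
  intro x y
  refine hF a b ha hb hab _ _ _ (hf.comp measurable_prodMk_left) (hg.comp measurable_prodMk_left)
    (hh.comp measurable_prodMk_left) ?_
  intro u v
  exact H (x, u) (y, v)

theorem lcb_pl_equiv {E F : Type} [MeasureSpace E] [AddCommGroup E] [Module ℝ E]
    [MeasureSpace F] [AddCommGroup F] [Module ℝ F] (e : E ≃ᵐ F) (he : MeasurePreserving e)
    (hlin : ∀ (a b : ℝ) (x y : E), e (a • x + b • y) = a • e x + b • e y) (hE : LcbPL E) :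
    LcbPL F := by
  intro a b ha hb hab f g h hf hg hh H
  rw [he.lintegral_map_equiv f e, he.lintegral_map_equiv g e, he.lintegral_map_equiv h e]
  refine hE a b ha hb hab _ _ _ (hf.comp e.measurable) (hg.comp e.measurable)
    (hh.comp e.measurable) ?_
  intro x y
  rw [hlin]
  exact H _ _

theorem lcb_pl_pi (n : ℕ) : LcbPL (Fin n → ℝ) := by
  induction n with
  | zero =>
    intro a b ha hb hab f g h hf hg hh H
    have : (volume : Measure (Fin 0 → ℝ)) = Measure.dirac default := by
      rw [volume_pi, Measure.pi_of_empty _ default]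
    rw [this, lintegral_dirac' _ hf, lintegral_dirac' _ hg, lintegral_dirac' _ hh]
    convert H default default
  | succ n ih =>
    refine lcb_pl_equiv (MeasurableEquiv.piFinSuccAbove (fun _ => ℝ) 0).symm
      ((volume_preserving_piFinSuccAbove (fun _ : Fin (n+1) => ℝ) 0).symm _) ?_ (lcb_pl_prod lcb_pl1 ih)
    intro a b x y
    ext i
    refine Fin.cases ?_ ?_ i <;> simp

theorem lcb_pl_euclidean (n : ℕ) : LcbPL (EuclideanSpace ℝ (Fin n)) := by
  refine lcb_pl_equiv (MeasurableEquiv.toLp 2 (Fin n → ℝ))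
    (PiLp.volume_preserving_toLp (Fin n)) ?_ (lcb_pl_pi n)
  intro a b x y
  rfl

end LcbPart1

section LcbPart2

theorem lcb_vol_smul (r : ℝ) (s : Set (EuclideanSpace ℝ (Fin n))) :
    volume (r • s) = ENNReal.ofReal (|r| ^ n) * volume s := by
  rw [Measure.addHaar_smul]; simp [abs_pow]

theorem lcb_bm {A B C : Set (EuclideanSpace ℝ (Fin n))} (hA : MeasurableSet A) (hB : MeasurableSet B)
    (hC : MeasurableSet C) {a b l : ℝ} (ha : 0 < a) (hb : 0 < b) (hl0 : 0 < l) (hl1 : l < 1)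
    (hvA : volume A = ENNReal.ofReal (a ^ n)) (hvB : volume B = ENNReal.ofReal (b ^ n))
    (h : ∀ x ∈ A, ∀ y ∈ B, (1 - l) • x + l • y ∈ C) :
    ENNReal.ofReal (((1 - l) * a + l * b) ^ n) ≤ volume C := by
  set s := (1 - l) * a + l * b with hs
  have h1l : 0 < 1 - l := by linarith
  have hs0 : 0 < s := by positivity
  have key := lcb_pl_euclidean n ((1 - l) * a / s) (l * b / s) (by positivity) (by positivity)
    (by rw [← add_div, ← hs, div_self hs0.ne']) ((a⁻¹ • A).indicator 1) ((b⁻¹ • B).indicator 1)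
    ((s⁻¹ • C).indicator 1)
    (measurable_one.indicator (hA.const_smul₀ _)) (measurable_one.indicator (hB.const_smul₀ _))
    (measurable_one.indicator (hC.const_smul₀ _)) ?_
  · rw [lintegral_indicator_one (hA.const_smul₀ _), lintegral_indicator_one (hB.const_smul₀ _),
      lintegral_indicator_one (hC.const_smul₀ _), lcb_vol_smul, lcb_vol_smul, lcb_vol_smul, hvA, hvB,
      ← ENNReal.ofReal_mul (by positivity), ← ENNReal.ofReal_mul (by positivity),
      abs_of_pos (inv_pos.2 ha), abs_of_pos (inv_pos.2 hb), abs_of_pos (inv_pos.2 hs0),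
      ← mul_pow, ← mul_pow, inv_mul_cancel₀ ha.ne', inv_mul_cancel₀ hb.ne'] at key
    simp only [one_pow, ENNReal.ofReal_one, ENNReal.one_rpow, mul_one] at key
    calc ENNReal.ofReal (s ^ n) = ENNReal.ofReal (s ^ n) * 1 := by simp
      _ ≤ ENNReal.ofReal (s ^ n) * (ENNReal.ofReal (s⁻¹ ^ n) * volume C) := by gcongr
      _ = volume C := by
        rw [← mul_assoc, ← ENNReal.ofReal_mul (by positivity), ← mul_pow, mul_inv_cancel₀ hs0.ne']
        simp
  · intro x y
    by_cases hx : x ∈ a⁻¹ • A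
    · by_cases hy : y ∈ b⁻¹ • B
      · have : ((1 - l) * a / s) • x + (l * b / s) • y ∈ s⁻¹ • C := by
          obtain ⟨x', hx', rfl⟩ := hx
          obtain ⟨y', hy', rfl⟩ := hy
          refine ⟨_, h x' hx' y' hy', ?_⟩
          simp only [smul_add, smul_smul]
          congr 2 <;> field_simp
        simp [hx, hy, this]
      · rw [indicator_of_notMem hy, ENNReal.zero_rpow_of_pos (by positivity), mul_zero]
        exact zero_le
    · rw [indicator_of_notMem hx, ENNReal.zero_rpow_of_pos (by positivity), zero_mul]
      exact zero_le

/-- The slice. -/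
def lcbS (K L : Set (EuclideanSpace ℝ (Fin n))) (z : EuclideanSpace ℝ (Fin n)) :
    Set (EuclideanSpace ℝ (Fin n)) := {x | x ∈ K ∧ z - x ∈ L}

variable {K L : Set (EuclideanSpace ℝ (Fin n))}

theorem lcbS_compact (hK : IsCompact K) (hL : IsCompact L) (z) : IsCompact (lcbS K L z) := by
  have : lcbS K L z = K ∩ (fun x => z - x) ⁻¹' L := rfl
  rw [this]
  exact hK.inter_right (hL.isClosed.preimage (by fun_prop))

theorem lcbS_combo (hK : Convex ℝ K) (hL : Convex ℝ L) {z0 z1 x0 x1 : EuclideanSpace ℝ (Fin n)}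
    {l : ℝ} (hl0 : 0 ≤ l) (hl1 : l ≤ 1) (h0 : x0 ∈ lcbS K L z0) (h1 : x1 ∈ lcbS K L z1) :
    (1 - l) • x0 + l • x1 ∈ lcbS K L ((1 - l) • z0 + l • z1) := by
  refine ⟨hK h0.1 h1.1 (by linarith) hl0 (by ring), ?_⟩
  have := hL h0.2 h1.2 (show 0 ≤ 1 - l by linarith) hl0 (by ring)
  convert this using 1
  module

theorem lcbS_convex (hK : Convex ℝ K) (hL : Convex ℝ L) (z) : Convex ℝ (lcbS K L z) := by
  rw [convex_iff_forall_pos]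
  intro x hx y hy a b ha hb hab
  have := lcbS_combo hK hL hb.le (by linarith) hx hy
  obtain rfl : a = 1 - b := by linarith
  have e : (1 - b) • z + b • z = z := by module
  rwa [e] at this

theorem lcb_vol_S (hK : IsCompact K) (hL : IsCompact L) (z) :
    volume (lcbS K L z) = ENNReal.ofReal (covar K L z) :=
  (ENNReal.ofReal_toReal (lcbS_compact hK hL z).measure_lt_top.ne).symm

theorem lcb_covar_nonneg (z) : 0 ≤ covar K L z := ENNReal.toReal_nonneg

theorem lcb_covar_concave (hK : IsCompact K) (hL : IsCompact L) (hKc : Convex ℝ K)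
    (hLc : Convex ℝ L) {z0 z1} {a b l : ℝ} (ha : 0 < a) (hb : 0 < b) (hl0 : 0 < l) (hl1 : l < 1)
    (h0 : covar K L z0 = a ^ n) (h1 : covar K L z1 = b ^ n) :
    ((1 - l) * a + l * b) ^ n ≤ covar K L ((1 - l) • z0 + l • z1) := by
  have := lcb_bm (lcbS_compact hK hL z0).measurableSet (lcbS_compact hK hL z1).measurableSet
    (lcbS_compact hK hL ((1 - l) • z0 + l • z1)).measurableSet ha hb hl0 hl1
    (by rw [lcb_vol_S hK hL, h0]) (by rw [lcb_vol_S hK hL, h1])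
    (fun x hx y hy => lcbS_combo hKc hLc hl0.le hl1.le hx hy)
  rw [lcb_vol_S hK hL] at this
  exact (ENNReal.ofReal_le_ofReal_iff (lcb_covar_nonneg _)).1 this

theorem lcb_covar_eq_integral (hK : IsCompact K) (hL : IsCompact L) (z) :
    covar K L z = ∫ x, K.indicator 1 x * L.indicator (1 : EuclideanSpace ℝ (Fin n) → ℝ) (z - x) := by
  have : (fun x => K.indicator 1 x * L.indicator (1 : EuclideanSpace ℝ (Fin n) → ℝ) (z - x)) = (lcbS K L z).indicator 1 := by
    ext x
    by_cases h1 : x ∈ K <;> by_cases h2 : z - x ∈ L <;> simp [h1, h2, lcbS]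
  rw [this, integral_indicator_one (lcbS_compact hK hL z).measurableSet]
  rfl

theorem lcb_covar_continuous (hK : IsCompact K) (hL : IsCompact L) (hLc : Convex ℝ L) :
    Continuous (covar K L) := by
  have e : covar K L = fun z => ∫ x, K.indicator 1 x * L.indicator (1 : EuclideanSpace ℝ (Fin n) → ℝ) (z - x) :=
    funext (lcb_covar_eq_integral hK hL)
  rw [e, continuous_iff_continuousAt]
  intro z
  apply continuousAt_of_dominated (bound := K.indicator 1)
  · refine Filter.Eventually.of_forall fun w => ?_
    refine (Measurable.mul ?_ ?_).aestronglyMeasurable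
    · exact measurable_one.indicator hK.measurableSet
    · exact (measurable_one.indicator hL.measurableSet).comp (by fun_prop)
  · refine Filter.Eventually.of_forall fun w => Filter.Eventually.of_forall fun x => ?_
    by_cases h1 : x ∈ K <;> by_cases h2 : w - x ∈ L <;> simp [h1, h2]
  · exact (integrable_indicator_iff hK.measurableSet).2 (integrableOn_const hK.measure_lt_top.ne)
  · have h0 : volume ((fun x => z - x) ⁻¹' frontier L) = 0 := by
      rw [(Measure.measurePreserving_sub_left volume z).measure_preimage
        isClosed_frontier.measurableSet.nullMeasurableSet]
      exact hLc.addHaar_frontier _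
    filter_upwards [measure_eq_zero_iff_ae_notMem.1 h0] with x hx
    apply ContinuousAt.mul continuousAt_const
    have h3 : ContinuousAt (L.indicator (1 : EuclideanSpace ℝ (Fin n) → ℝ)) (z - x) :=
      continuousOn_const.continuousAt_indicator hx
    exact ContinuousAt.comp (f := fun w => w - x) h3 (by fun_prop)

theorem lcb_lintegral_covar (hK : IsCompact K) (hL : IsCompact L) (hLc : Convex ℝ L) :
    ∫⁻ z, ENNReal.ofReal (covar K L z) = volume K * volume L := by
  have e : ∀ z, ENNReal.ofReal (covar K L z) =
      ∫⁻ x, K.indicator 1 x * L.indicator (1 : EuclideanSpace ℝ (Fin n) → ENNReal) (z - x) := by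
    intro z
    have : (fun x => K.indicator 1 x * L.indicator (1 : EuclideanSpace ℝ (Fin n) → ENNReal) (z - x)) =
        (lcbS K L z).indicator 1 := by
      ext x
      by_cases h1 : x ∈ K <;> by_cases h2 : z - x ∈ L <;> simp [h1, h2, lcbS]
    rw [this, lintegral_indicator_one (lcbS_compact hK hL z).measurableSet, lcb_vol_S hK hL]
  simp_rw [e]
  have hmK : Measurable (K.indicator (1 : EuclideanSpace ℝ (Fin n) → ENNReal)) := measurable_one.indicator hK.measurableSet
  have hmL : Measurable (L.indicator (1 : EuclideanSpace ℝ (Fin n) → ENNReal)) := measurable_one.indicator hL.measurableSet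
  rw [lintegral_lintegral_swap]
  · have : ∀ x, ∫⁻ z, K.indicator 1 x * L.indicator (1 : EuclideanSpace ℝ (Fin n) → ENNReal) (z - x) =
        K.indicator 1 x * volume L := by
      intro x
      have hms : Measurable fun z => L.indicator (1 : EuclideanSpace ℝ (Fin n) → ENNReal) (z - x) :=
        hmL.comp (measurable_id.sub_const x)
      rw [lintegral_const_mul _ hms,
        lintegral_sub_right_eq_self (fun z => L.indicator (1 : EuclideanSpace ℝ (Fin n) → ENNReal) z) x,
        lintegral_indicator_one hL.measurableSet]
    simp_rw [this]
    rw [lintegral_mul_const _ hmK, lintegral_indicator_one hK.measurableSet]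
  · apply Measurable.aemeasurable
    exact (hmK.comp measurable_snd).mul (hmL.comp (measurable_fst.sub measurable_snd))

theorem lcb_layer (hK : IsCompact K) (hL : IsCompact L) (hLc : Convex ℝ L) :
    ∫⁻ t in Ioi (0 : ℝ), volume {z | t ≤ covar K L z} = volume K * volume L := by
  rw [← lcb_lintegral_covar hK hL hLc]
  exact (lintegral_eq_lintegral_meas_le _ (Filter.Eventually.of_forall lcb_covar_nonneg)
    (lcb_covar_continuous hK hL hLc).measurable.aemeasurable).symm

theorem lcb_covar_le_Mmax (hK : IsCompact K) (z) : covar K L z ≤ Mmax K L := by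
  refine le_ciSup (f := covar K L) ⟨(volume K).toReal, ?_⟩ z
  rintro _ ⟨z, rfl⟩
  exact ENNReal.toReal_mono hK.measure_lt_top.ne (measure_mono fun x hx => hx.1)

theorem lcb_Mmax_pos (hK : IsConvexBody K) (hL : IsConvexBody L) : 0 < Mmax K L := by
  obtain ⟨x, hx⟩ := hK.2.2
  obtain ⟨y, hy⟩ := hL.2.2
  refine lt_of_lt_of_le ?_ (lcb_covar_le_Mmax hK.1 (x + y))
  rw [← ENNReal.ofReal_pos, ← lcb_vol_S hK.1 hL.1]
  have ho : IsOpen (interior K ∩ (fun w => x + y - w) ⁻¹' interior L) :=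
    isOpen_interior.inter (isOpen_interior.preimage (by fun_prop))
  refine lt_of_lt_of_le (ho.measure_pos volume ⟨x, hx, by simpa using hy⟩) (measure_mono ?_)
  exact fun w hw => ⟨interior_subset hw.1, interior_subset hw.2⟩

theorem lcb_mem_add_of_pos {z} (h : 0 < covar K L z) : ∃ x ∈ K, z - x ∈ L := by
  by_contra hne
  push Not at hne
  have : {x | x ∈ K ∧ z - x ∈ L} = ∅ := by
    ext x; simp only [mem_ofPred_eq, mem_empty_iff_false, iff_false, not_and]; exact hne x
  unfold covar at h
  rw [this] at h
  simp at h

theorem lcb_thetaConv_eq (hM : 0 < Mmax K L) {t : ℝ} (ht : 0 < t) :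
    thetaConv K L t = {z | t * Mmax K L ≤ covar K L z} := by
  ext z
  refine ⟨fun h => h.2, fun h => ⟨?_, h⟩⟩
  obtain ⟨x, hx, hy⟩ := lcb_mem_add_of_pos (lt_of_lt_of_le (mul_pos ht hM) h)
  exact ⟨x, hx, z - x, hy, by simp⟩

/-- A closed subset of full measure is everything. -/
theorem lcb_full {P Q : Set (EuclideanSpace ℝ (Fin n))} (hP : IsClosed P) (hPQ : P ⊆ Q)
    (hQc : Convex ℝ Q) (hQi : (interior Q).Nonempty) (hfin : volume Q ≠ ⊤)
    (h : volume Q ≤ volume P) : Q ⊆ P := by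
  have h0 : volume (Q \ P) = 0 := by
    rw [measure_sdiff hPQ hP.measurableSet.nullMeasurableSet
      (ne_top_of_le_ne_top hfin (measure_mono hPQ))]
    exact tsub_eq_zero_of_le h
  have h1 : interior Q \ P = ∅ := by
    have ho : IsOpen (interior Q \ P) := isOpen_interior.sdiff hP
    rw [← ho.measure_eq_zero_iff volume]
    exact measure_mono_null (sdiff_subset_sdiff_left interior_subset) h0
  have h2 : interior Q ⊆ P := sdiff_eq_empty.1 h1
  calc Q ⊆ closure Q := subset_closure
    _ = closure (interior Q) := (hQc.closure_interior_eq_closure_of_nonempty_interior hQi).symm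
    _ ⊆ P := closure_minimal h2 hP

end LcbPart2

section LcbPart3

theorem lcb_beta_step (p q : ℕ) : (p + 1 : ℝ) * ∫ s in (0:ℝ)..1, s ^ p * (1 - s) ^ (q + 1) =
    (q + 1 : ℝ) * ∫ s in (0:ℝ)..1, s ^ (p + 1) * (1 - s) ^ q := by
  have h : ∀ s ∈ uIcc (0:ℝ) 1, HasDerivAt (fun s : ℝ => s ^ (p + 1) * (1 - s) ^ (q + 1))
      ((p + 1 : ℝ) * (s ^ p * (1 - s) ^ (q + 1)) - (q + 1 : ℝ) * (s ^ (p + 1) * (1 - s) ^ q)) s := by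
    intro s _
    have h1 : HasDerivAt (fun s : ℝ => s ^ (p + 1)) (((p + 1 : ℕ) : ℝ) * s ^ p) s := by
      simpa using hasDerivAt_pow (p + 1) s
    have h2 : HasDerivAt (fun s : ℝ => (1 - s) ^ (q + 1)) (((q + 1 : ℕ) : ℝ) * (1 - s) ^ q * (-1)) s := by
      simpa using ((hasDerivAt_id s).const_sub 1).fun_pow (q + 1)
    refine (h1.mul h2).congr_deriv ?_
    push_cast; ring
  have := intervalIntegral.integral_eq_sub_of_hasDerivAt h
    (Continuous.intervalIntegrable (by fun_prop) _ _)
  rw [intervalIntegral.integral_sub (Continuous.intervalIntegrable (by fun_prop) _ _)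
    (Continuous.intervalIntegrable (by fun_prop) _ _), intervalIntegral.integral_const_mul,
    intervalIntegral.integral_const_mul] at this
  simp at this
  linarith

theorem lcb_beta_nat (q : ℕ) : ∀ p : ℕ, ∫ s in (0:ℝ)..1, s ^ p * (1 - s) ^ q =
    (p.factorial : ℝ) * q.factorial / (p + q + 1).factorial := by
  induction q with
  | zero =>
    intro p
    simp [Nat.factorial_succ, integral_pow]
    field_simp
  | succ q ih =>
    intro p
    have := lcb_beta_step p q
    rw [ih (p + 1)] at this
    have hp : (p + 1 : ℝ) ≠ 0 := by positivity
    rw [← mul_right_inj' hp, this]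
    have e : p + 1 + q + 1 = p + (q + 1) + 1 := by ring
    rw [e, Nat.factorial_succ p, Nat.factorial_succ q]
    push_cast
    field_simp

theorem lcb_beta_one (hn : 0 < n) : ∫ t in (0:ℝ)..1, (1 - t ^ ((1:ℝ)/n)) ^ n =
    1 / (Nat.choose (2 * n) n : ℝ) := by
  have hn0 : (n : ℝ) ≠ 0 := by positivity
  have hc : Continuous (fun t : ℝ => (1 - t ^ ((1:ℝ)/n)) ^ n) := by
    have := Real.continuous_rpow_const (q := (1:ℝ)/n) (by positivity)
    fun_prop
  have h := intervalIntegral.integral_comp_mul_deriv (a := (0:ℝ)) (b := 1) (f := fun s : ℝ => s ^ n)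
    (f' := fun s : ℝ => n * s ^ (n - 1)) (g := fun t : ℝ => (1 - t ^ ((1:ℝ)/n)) ^ n)
    (fun s _ => hasDerivAt_pow n s) (by fun_prop) hc
  simp only [one_pow, zero_pow hn.ne'] at h
  rw [← h]
  have h2 : ∫ s in (0:ℝ)..1, ((fun t : ℝ => (1 - t ^ ((1:ℝ)/n)) ^ n) ∘ fun s : ℝ => s ^ n) s *
      (n * s ^ (n - 1)) = ∫ s in (0:ℝ)..1, n * (s ^ (n - 1) * (1 - s) ^ n) := by
    apply intervalIntegral.integral_congr
    intro s hs
    rw [uIcc_of_le zero_le_one] at hs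
    simp only [Function.comp]
    rw [← Real.rpow_natCast s n, ← Real.rpow_mul hs.1, mul_one_div_cancel hn0, Real.rpow_one]
    ring
  rw [h2, intervalIntegral.integral_const_mul, lcb_beta_nat]
  obtain ⟨m, rfl⟩ : ∃ m, n = m + 1 := ⟨n - 1, by omega⟩
  rw [Nat.choose_eq_factorial_div_factorial (by omega), Nat.cast_div]
  · have e : 2 * (m + 1) - (m + 1) = m + 1 := by omega
    have e2 : m + 1 - 1 + (m + 1) + 1 = 2 * (m + 1) := by omega
    rw [e, e2, Nat.factorial_succ m, show m + 1 - 1 = m by omega]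
    push_cast
    field_simp
  · exact Nat.factorial_mul_factorial_dvd_factorial (by omega)
  · positivity

theorem lcb_beta (hn : 0 < n) {M : ℝ} (hM : 0 < M) :
    ∫⁻ t in Ioo 0 M, ENNReal.ofReal ((1 - (t / M) ^ ((1:ℝ)/n)) ^ n) =
      ENNReal.ofReal (M / (Nat.choose (2 * n) n : ℝ)) := by
  have hc : Continuous (fun t : ℝ => (1 - (t / M) ^ ((1:ℝ)/n)) ^ n) := by
    have := Real.continuous_rpow_const (q := (1:ℝ)/n) (by positivity)
    have h2 : Continuous (fun t : ℝ => (t / M) ^ ((1:ℝ)/n)) := this.comp (by fun_prop)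
    fun_prop
  rw [← ofReal_integral_eq_lintegral_ofReal]
  · congr 1
    rw [← integral_Ioc_eq_integral_Ioo, ← intervalIntegral.integral_of_le hM.le]
    have := intervalIntegral.integral_comp_div (a := 0) (b := M)
      (fun t : ℝ => (1 - t ^ ((1:ℝ)/n)) ^ n) hM.ne'
    rw [this, zero_div, div_self hM.ne', lcb_beta_one hn, smul_eq_mul, mul_one_div]
  · exact (hc.integrableOn_Icc (a := 0) (b := M)).mono_set Ioo_subset_Icc_self
  · filter_upwards [ae_restrict_mem measurableSet_Ioo] with t ht
    apply pow_nonneg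
    rw [sub_nonneg]
    apply Real.rpow_le_one (div_nonneg ht.1.le hM.le) _ (by positivity)
    rw [div_le_one hM]; exact ht.2.le

variable {K L : Set (EuclideanSpace ℝ (Fin n))}

theorem lcb_layer' (hK : IsCompact K) (hL : IsCompact L) (hLc : Convex ℝ L)
    (hM : 0 < Mmax K L) :
    ∫⁻ t in Ioo (0 : ℝ) (Mmax K L), volume {z | t ≤ covar K L z} = volume K * volume L := by
  rw [← lcb_layer hK hL hLc, setLIntegral_congr Ioo_ae_eq_Ioc]
  rw [← Ioc_union_Ioi_eq_Ioi hM.le, lintegral_union measurableSet_Ioi]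
  · have : ∫⁻ t in Ioi (Mmax K L), volume {z | t ≤ covar K L z} = 0 := by
      rw [setLIntegral_congr_fun (g := fun _ => 0) measurableSet_Ioi]
      · simp
      · intro t ht
        have : {z | t ≤ covar K L z} = ∅ := by
          ext z
          simp only [mem_ofPred_eq, mem_empty_iff_false, iff_false, not_le]
          exact lt_of_le_of_lt (lcb_covar_le_Mmax hK z) ht
        simp [this]
    rw [this, add_zero]
  · rw [Set.disjoint_left]
    intro t h1 h2
    exact absurd h1.2 (not_le.2 h2)

theorem lcb_tendsto_ratio (hn : 0 < n) :
    Filter.Tendsto (fun t : ℝ => (1 - t ^ ((1:ℝ)/n)) / (1 - t)) (nhdsWithin 1 (Iio 1))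
      (nhds ((1:ℝ)/n)) := by
  have h := (Real.hasDerivAt_rpow_const (x := 1) (p := (1:ℝ)/n) (Or.inl one_ne_zero))
  rw [hasDerivAt_iff_tendsto_slope] at h
  have h2 := h.mono_left (nhdsWithin_mono (1:ℝ) (s := Iio 1) (t := {1}ᶜ) (fun x hx => ne_of_lt hx))
  simp only [Real.one_rpow, mul_one] at h2
  refine h2.congr fun t => ?_
  rw [slope_def_field, Real.one_rpow, ← neg_sub 1 t, ← neg_sub 1 (t ^ _), neg_div_neg_eq]

theorem lcb_haus_a {S : ℝ → Set (EuclideanSpace ℝ (Fin n))} {C : Set (EuclideanSpace ℝ (Fin n))}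
    {l : Filter ℝ} [l.NeBot] (hC : IsClosed C)
    (h : Filter.Tendsto (fun t => Metric.hausdorffEDist (S t) C) l (nhds 0))
    {x : ℝ → EuclideanSpace ℝ (Fin n)} {y} (hx : ∀ᶠ t in l, x t ∈ S t)
    (hy : Filter.Tendsto x l (nhds y)) : y ∈ C := by
  rw [Metric.mem_iff_infEDist_zero_of_closed hC]
  have h1 : Filter.Tendsto (fun t => Metric.infEDist (x t) C) l (nhds (Metric.infEDist y C)) :=
    (Metric.continuous_infEDist.tendsto y).comp hy
  have h2 : Filter.Tendsto (fun t => Metric.infEDist (x t) C) l (nhds 0) := by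
    refine tendsto_of_tendsto_of_tendsto_of_le_of_le' tendsto_const_nhds h
      (Filter.Eventually.of_forall fun t => zero_le) ?_
    filter_upwards [hx] with t ht
    exact Metric.infEDist_le_hausdorffEDist_of_mem ht
  exact tendsto_nhds_unique h1 h2

theorem lcb_haus_b {S : ℝ → Set (EuclideanSpace ℝ (Fin n))} {C : Set (EuclideanSpace ℝ (Fin n))}
    {l : Filter ℝ}
    (h : Filter.Tendsto (fun t => Metric.hausdorffEDist (S t) C) l (nhds 0))
    {c} (hc : c ∈ C) {U : Set (EuclideanSpace ℝ (Fin n))} (hU : U ∈ nhds c) :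
    ∀ᶠ t in l, ∃ x ∈ S t, x ∈ U := by
  obtain ⟨e, he, hball⟩ := EMetric.mem_nhds_iff.1 hU
  filter_upwards [h.eventually (gt_mem_nhds he)] with t ht
  rw [Metric.hausdorffEDist_comm] at ht
  obtain ⟨y, hy, hd⟩ := Metric.exists_edist_lt_of_hausdorffEDist_lt hc ht
  exact ⟨y, hy, hball (by simpa [edist_comm] using hd)⟩

theorem lcb_incl (hn : 0 < n) (hK : IsConvexBody K) (hL : IsConvexBody L)
    (hM : Mmax K L = covar K L 0) {C : Set (EuclideanSpace ℝ (Fin n))} (hC : IsClosed C)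
    (hlim : Filter.Tendsto (fun t : ℝ => Metric.hausdorffEDist ((1 - t)⁻¹ • thetaConv K L t) C)
      (nhdsWithin 1 (Iio 1)) (nhds 0)) {t : ℝ} (ht0 : 0 < t) (ht1 : t < Mmax K L)
    {z} (hz : t ≤ covar K L z) :
    z ∈ (1 - (t / Mmax K L) ^ ((1:ℝ)/n)) • ((n : ℝ) • C) := by
  have hM0 := lcb_Mmax_pos hK hL
  set M := Mmax K L with hMdef
  have hn0 : (n : ℝ) ≠ 0 := by positivity
  have hn1 : (0:ℝ) < 1 / n := by positivity
  set s := (t / M) ^ ((1:ℝ)/n) with hs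
  have hs0 : 0 < s := Real.rpow_pos_of_pos (by positivity) _
  have hs1 : s < 1 := Real.rpow_lt_one (by positivity) (by rw [div_lt_one hM0]; exact ht1) hn1
  have rt : ∀ x : ℝ, 0 ≤ x → (x ^ ((1:ℝ)/n)) ^ n = x := by
    intro x hx
    rw [← Real.rpow_natCast, ← Real.rpow_mul hx, one_div_mul_cancel hn0, Real.rpow_one]
  set a := M ^ ((1:ℝ)/n) with ha
  set b := (covar K L z) ^ ((1:ℝ)/n) with hb
  have ha0 : 0 < a := Real.rpow_pos_of_pos hM0 _
  have hb0 : 0 < b := Real.rpow_pos_of_pos (by linarith) _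
  have hab : s * a ≤ b := by
    rw [hs, ha, ← Real.mul_rpow (by positivity) hM0.le, div_mul_cancel₀ _ hM0.ne']
    exact Real.rpow_le_rpow ht0.le hz hn1.le
  have h1s : 0 < 1 - s := by linarith
  have hmem : ((1:ℝ)/n * (1 - s)⁻¹) • z ∈ C := by
    refine lcb_haus_a hC hlim
      (x := fun θ => ((1 - θ ^ ((1:ℝ)/n)) / (1 - θ) * (1 - s)⁻¹) • z) ?_ ?_
    · have hc : Filter.Tendsto (fun θ : ℝ => θ ^ ((1:ℝ)/n)) (nhdsWithin 1 (Iio 1)) (nhds 1) := by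
        have := (Real.continuous_rpow_const hn1.le).tendsto (1:ℝ)
        rw [Real.one_rpow] at this
        exact this.mono_left nhdsWithin_le_nhds
      filter_upwards [hc.eventually (lt_mem_nhds hs1), self_mem_nhdsWithin,
        mem_nhdsWithin_of_mem_nhds (lt_mem_nhds (zero_lt_one))] with θ h1 h2 h3
      have h2 : θ < 1 := h2
      have h4 : θ ^ ((1:ℝ)/n) < 1 := Real.rpow_lt_one h3.le h2 hn1
      set s' := θ ^ ((1:ℝ)/n) with hs'
      set l := (1 - s') / (1 - s) with hl
      have hl0 : 0 < l := div_pos (by linarith) h1s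
      have hl1 : l < 1 := by rw [hl, div_lt_one h1s]; linarith
      refine ⟨l • z, ?_, ?_⟩
      · rw [lcb_thetaConv_eq hM0 h3]
        have := lcb_covar_concave hK.1 hL.1 hK.2.1 hL.2.1 ha0 hb0 hl0 hl1 (z0 := 0) (z1 := z)
          (by rw [← hM, rt _ hM0.le]) (by rw [rt _ (lcb_covar_nonneg z)])
        rw [smul_zero, zero_add] at this
        refine le_trans ?_ this
        calc θ * Mmax K L = (s' * a) ^ n := by rw [mul_pow, rt _ h3.le, rt _ hM0.le]
          _ ≤ _ := by
            apply pow_le_pow_left₀ (by positivity)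
            have e : s' * a = (1 - l) * a + l * (s * a) := by
              rw [hl]; field_simp; ring
            rw [e]
            gcongr
      · simp only [smul_smul]
        congr 1
        rw [hl]
        field_simp
    · exact ((lcb_tendsto_ratio hn).mul_const _).smul_const z
  refine ⟨(n : ℝ) • (((1:ℝ)/n * (1 - s)⁻¹) • z), smul_mem_smul_set hmem, ?_⟩
  simp only [smul_smul]
  convert one_smul ℝ z using 2
  field_simp

theorem lcb_le (hn : 0 < n) (hK : IsConvexBody K) (hL : IsConvexBody L)
    (hM : Mmax K L = covar K L 0) {C : Set (EuclideanSpace ℝ (Fin n))} (hC : IsClosed C)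
    (hlim : Filter.Tendsto (fun t : ℝ => Metric.hausdorffEDist ((1 - t)⁻¹ • thetaConv K L t) C)
      (nhdsWithin 1 (Iio 1)) (nhds 0)) {t : ℝ} (ht : t ∈ Ioo 0 (Mmax K L)) :
    volume {z | t ≤ covar K L z} ≤
      ENNReal.ofReal ((1 - (t / Mmax K L) ^ ((1:ℝ)/n)) ^ n) * volume ((n : ℝ) • C) := by
  have hM0 := lcb_Mmax_pos hK hL
  have hn1 : (0:ℝ) < 1 / n := by positivity
  have hs1 : (t / Mmax K L) ^ ((1:ℝ)/n) < 1 :=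
    Real.rpow_lt_one (div_nonneg ht.1.le hM0.le) (by rw [div_lt_one hM0]; exact ht.2) hn1
  have := measure_mono (μ := volume) (fun z hz => lcb_incl hn hK hL hM hC hlim ht.1 ht.2 hz :
    {z | t ≤ covar K L z} ⊆ _)
  rwa [lcb_vol_smul, abs_of_pos (by linarith)] at this

theorem lcb_ineq (hn : 0 < n) (hK : IsConvexBody K) (hL : IsConvexBody L)
    (hM : Mmax K L = covar K L 0) {C : Set (EuclideanSpace ℝ (Fin n))} (hC : IsClosed C)
    (hlim : Filter.Tendsto (fun t : ℝ => Metric.hausdorffEDist ((1 - t)⁻¹ • thetaConv K L t) C)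
      (nhdsWithin 1 (Iio 1)) (nhds 0)) :
    volume K * volume L ≤
      ENNReal.ofReal (Mmax K L / (Nat.choose (2 * n) n : ℝ)) * volume ((n : ℝ) • C) := by
  rw [← lcb_layer' hK.1 hL.1 hL.2.1 (lcb_Mmax_pos hK hL), ← lcb_beta hn (lcb_Mmax_pos hK hL), ← lintegral_mul_const]
  · apply lintegral_mono_ae
    filter_upwards [ae_restrict_mem measurableSet_Ioo] with t ht
    exact lcb_le hn hK hL hM hC hlim ht
  · fun_prop

end LcbPart3

section LcbPart4

variable {K L : Set (EuclideanSpace ℝ (Fin n))}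

theorem lcb_dense (hn : 0 < n) (hK : IsConvexBody K) (hL : IsConvexBody L)
    (hM : Mmax K L = covar K L 0) {C : Set (EuclideanSpace ℝ (Fin n))} (hC : IsConvexBody C)
    (hlim : Filter.Tendsto (fun t : ℝ => Metric.hausdorffEDist ((1 - t)⁻¹ • thetaConv K L t) C)
      (nhdsWithin 1 (Iio 1)) (nhds 0))
    (hE : ENNReal.ofReal (Mmax K L / (Nat.choose (2 * n) n : ℝ)) * volume ((n : ℝ) • C) ≤
      volume K * volume L) {u v : ℝ} (hu : 0 ≤ u) (huv : u < v) (hv : v ≤ Mmax K L) :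
    ∃ t, u < t ∧ t < v ∧
      (1 - (t / Mmax K L) ^ ((1:ℝ)/n)) • ((n : ℝ) • C) ⊆ {z | t ≤ covar K L z} := by
  have hM0 := lcb_Mmax_pos hK hL
  have hn1 : (0:ℝ) < 1 / n := by positivity
  have hn0 : (n : ℝ) ≠ 0 := by positivity
  have hnC : IsCompact ((n : ℝ) • C) := hC.1.smul _
  have hae : (fun t => volume {z | t ≤ covar K L z}) =ᵐ[volume.restrict (Ioo 0 (Mmax K L))]
      fun t => ENNReal.ofReal ((1 - (t / Mmax K L) ^ ((1:ℝ)/n)) ^ n) * volume ((n : ℝ) • C) := by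
    apply ae_eq_of_ae_le_of_lintegral_le
    · filter_upwards [ae_restrict_mem measurableSet_Ioo] with t ht
      exact lcb_le hn hK hL hM hC.1.isClosed hlim ht
    · rw [lcb_layer' hK.1 hL.1 hL.2.1 hM0]
      exact ENNReal.mul_ne_top hK.1.measure_lt_top.ne hL.1.measure_lt_top.ne
    · apply Measurable.aemeasurable; fun_prop
    · rw [lcb_layer' hK.1 hL.1 hL.2.1 hM0, lintegral_mul_const _ (by fun_prop), lcb_beta hn hM0]
      exact hE
  rw [Filter.EventuallyEq, ae_restrict_iff' measurableSet_Ioo] at hae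
  obtain ⟨t, ht, htu, htv⟩ := (Measure.dense_of_ae hae).exists_between huv
  refine ⟨t, htu, htv, ?_⟩
  have ht0 : t ∈ Ioo 0 (Mmax K L) := ⟨by linarith, by linarith⟩
  have ht' := ht ht0
  have hs1 : (t / Mmax K L) ^ ((1:ℝ)/n) < 1 :=
    Real.rpow_lt_one (div_nonneg ht0.1.le hM0.le) (by rw [div_lt_one hM0]; exact ht0.2) hn1
  set r := 1 - (t / Mmax K L) ^ ((1:ℝ)/n) with hr
  have hr0 : 0 < r := by linarith
  apply lcb_full
  · exact isClosed_le continuous_const (lcb_covar_continuous hK.1 hL.1 hL.2.1)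
  · intro z hz
    exact lcb_incl hn hK hL hM hC.1.isClosed hlim ht0.1 ht0.2 hz
  · exact (hC.2.1.smul _).smul _
  · rw [interior_smul₀ hr0.ne', interior_smul₀ hn0]
    exact (hC.2.2.smul_set).smul_set
  · exact (hnC.smul r).measure_lt_top.ne
  · rw [ht', lcb_vol_smul, abs_of_pos hr0]

theorem lcb_upper (hn : 0 < n) (hK : IsConvexBody K) (hL : IsConvexBody L)
    (hM : Mmax K L = covar K L 0) {C : Set (EuclideanSpace ℝ (Fin n))} (hC : IsConvexBody C)
    (hlim : Filter.Tendsto (fun t : ℝ => Metric.hausdorffEDist ((1 - t)⁻¹ • thetaConv K L t) C)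
      (nhdsWithin 1 (Iio 1)) (nhds 0))
    (hE : ENNReal.ofReal (Mmax K L / (Nat.choose (2 * n) n : ℝ)) * volume ((n : ℝ) • C) ≤
      volume K * volume L) {z} (hz : covar K L z = 0) {l : ℝ} (hl0 : 0 < l) (hl1 : l < 1) :
    covar K L (l • z) ≤ (1 - l) ^ n * Mmax K L := by
  have hM0 := lcb_Mmax_pos hK hL
  have hn1 : (0:ℝ) < 1 / n := by positivity
  have hn0 : (n : ℝ) ≠ 0 := by positivity
  have h1l : 0 < 1 - l := by linarith
  set M := Mmax K L with hMd
  set A := (n : ℝ) • C with hA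
  have hAc : Convex ℝ A := hC.2.1.smul _
  have rt : ∀ x : ℝ, 0 ≤ x → (x ^ n) ^ ((1:ℝ)/n) = x := by
    intro x hx
    rw [← Real.rpow_natCast, ← Real.rpow_mul hx, mul_one_div_cancel hn0, Real.rpow_one]
  have hA0 : (0 : EuclideanSpace ℝ (Fin n)) ∈ A := by
    have := lcb_incl hn hK hL hM hC.1.isClosed hlim (t := M / 2) (z := 0) (by positivity)
      (by rw [← hMd]; linarith) (by rw [← hM]; linarith)
    have hs1 : (M / 2 / M) ^ ((1:ℝ)/n) < 1 :=
      Real.rpow_lt_one (by positivity) (by rw [div_lt_one hM0]; linarith) hn1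
    obtain ⟨w, hw, hw'⟩ := this
    have : w = 0 := by
      rcases smul_eq_zero.1 hw' with h | h
      · rw [← hMd] at h; linarith
      · exact h
    rwa [this] at hw
  by_contra hlt
  push Not at hlt
  obtain ⟨t, ht1, ht2, -⟩ := lcb_dense hn hK hL hM hC hlim hE (u := (1 - l) ^ n * M)
    (v := covar K L (l • z)) (by positivity) hlt (lcb_covar_le_Mmax hK.1 _)
  have ht0 : 0 < t := lt_trans (by positivity) ht1
  have htM : t < M := lt_of_lt_of_le ht2 (lcb_covar_le_Mmax hK.1 _)
  have hmem := lcb_incl hn hK hL hM hC.1.isClosed hlim ht0 htM ht2.le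
  rw [← hMd, ← hA] at hmem
  have hr : 1 - (t / M) ^ ((1:ℝ)/n) < l := by
    have : 1 - l < (t / M) ^ ((1:ℝ)/n) := by
      rw [← rt (1 - l) h1l.le]
      apply Real.rpow_lt_rpow (by positivity) _ hn1
      rw [lt_div_iff₀ hM0]; exact ht1
    linarith
  have hs1 : (t / M) ^ ((1:ℝ)/n) < 1 :=
      Real.rpow_lt_one (by positivity) (by rw [div_lt_one hM0]; exact htM) hn1
  set r := 1 - (t / M) ^ ((1:ℝ)/n) with hrd
  have hr0 : 0 < r := by linarith
  obtain ⟨w, hw, hw'⟩ := hmem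
  simp only at hw'
  have hrl : r / l < 1 := (div_lt_one hl0).2 hr
  -- `z = (r/l) w`
  have hzw : z = (r / l) • w := by
    rw [div_eq_inv_mul, mul_smul, hw', smul_smul, inv_mul_cancel₀ hl0.ne', one_smul]
  have h1r : 0 < 1 - r / l := by linarith
  obtain ⟨t', ht1', ht2', hsub⟩ := lcb_dense hn hK hL hM hC hlim hE (u := 0)
    (v := (1 - r / l) ^ n * M) le_rfl (by positivity) (by
      have : (1 - r / l) ^ n ≤ 1 := pow_le_one₀ h1r.le (by have := div_pos hr0 hl0; linarith)
      nlinarith)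
  have hr' : r / l < 1 - (t' / M) ^ ((1:ℝ)/n) := by
    have : (t' / M) ^ ((1:ℝ)/n) < 1 - r / l := by
      rw [← rt (1 - r / l) h1r.le]
      apply Real.rpow_lt_rpow (by positivity) _ hn1
      rw [div_lt_iff₀ hM0]; exact ht2'
    linarith
  rw [← hMd, ← hA] at hsub
  set r' := 1 - (t' / M) ^ ((1:ℝ)/n) with hrd'
  have hq : 0 < r / l := div_pos hr0 hl0
  have hr'0 : 0 < r' := by linarith
  have : t' ≤ covar K L z := by
    apply hsub
    refine ⟨(r / l / r') • w, ?_, ?_⟩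
    · exact hAc.smul_mem_of_zero_mem hA0 hw ⟨by positivity, by rw [div_le_one hr'0]; exact hr'.le⟩
    · simp only [smul_smul]
      rw [mul_div_cancel₀ _ hr'0.ne', hzw]
  linarith

theorem lcb_star (hn : 0 < n) (hK : IsConvexBody K) (hL : IsConvexBody L)
    (hM : Mmax K L = covar K L 0) {C : Set (EuclideanSpace ℝ (Fin n))} (hC : IsConvexBody C)
    (hlim : Filter.Tendsto (fun t : ℝ => Metric.hausdorffEDist ((1 - t)⁻¹ • thetaConv K L t) C)
      (nhdsWithin 1 (Iio 1)) (nhds 0))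
    (hE : ENNReal.ofReal (Mmax K L / (Nat.choose (2 * n) n : ℝ)) * volume ((n : ℝ) • C) ≤
      volume K * volume L) {p y} (hp : p ∈ K) (hy : y ∈ L) (hz : covar K L (p + y) = 0)
    {l : ℝ} (hl0 : 0 < l) (hl1 : l < 1) {x} (hx : x ∈ K) (hx' : l • (p + y) - x ∈ L) :
    ∃ d ∈ K, -d ∈ L ∧ x = (1 - l) • d + l • p := by
  have hM0 := lcb_Mmax_pos hK hL
  have h1l : 0 < 1 - l := by linarith
  set D := lcbS K L 0 with hD
  have hDc : IsCompact D := lcbS_compact hK.1 hL.1 0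
  have hDv : volume D = ENNReal.ofReal (Mmax K L) := by rw [hD, lcb_vol_S hK.1 hL.1, hM]
  set P := (fun w => w + l • p) '' ((1 - l) • D) with hP
  have hPc : IsCompact P := (hDc.smul _).image (by fun_prop)
  have hPv : volume P = ENNReal.ofReal ((1 - l) ^ n * Mmax K L) := by
    rw [hP, Set.image_add_right, measure_preimage_add_right, lcb_vol_smul, hDv, abs_of_pos h1l,
      ENNReal.ofReal_mul (by positivity)]
  have hPQ : P ⊆ lcbS K L (l • (p + y)) := by
    rintro _ ⟨_, ⟨d, hd, rfl⟩, rfl⟩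
    have h1 : p ∈ lcbS K L (p + y) := ⟨hp, by simpa using hy⟩
    have := lcbS_combo hK.2.1 hL.2.1 hl0.le hl1.le hd h1
    rwa [smul_zero, zero_add] at this
  have hQc := lcbS_convex hK.2.1 hL.2.1 (l • (p + y))
  have hsub : lcbS K L (l • (p + y)) ⊆ P := by
    apply lcb_full hPc.isClosed hPQ hQc
    · by_contra hne
      rw [not_nonempty_iff_eq_empty] at hne
      have h0 := hQc.addHaar_frontier volume
      rw [frontier, hne, sdiff_empty] at h0
      have := measure_mono_null (hPQ.trans subset_closure) h0
      rw [hPv, ENNReal.ofReal_eq_zero] at this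
      have : 0 < (1 - l) ^ n * Mmax K L := by positivity
      linarith
    · exact (lcbS_compact hK.1 hL.1 _).measure_lt_top.ne
    · rw [hPv, lcb_vol_S hK.1 hL.1]
      exact ENNReal.ofReal_le_ofReal (lcb_upper hn hK hL hM hC hlim hE hz hl0 hl1)
  obtain ⟨_, ⟨d, hd, rfl⟩, hdx⟩ := hsub ⟨hx, hx'⟩
  exact ⟨d, hd.1, by simpa using hd.2, hdx.symm⟩

end LcbPart4

section LcbPart5

variable {K L : Set (EuclideanSpace ℝ (Fin n))}

theorem lcb_geom_sub {K N : Set (EuclideanSpace ℝ (Fin n))} (hK : IsConvexBody K)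
    (hN : IsConvexBody N) {Z : EuclideanSpace ℝ (Fin n) → Prop}
    (hne : (interior K ∩ N).Nonempty)
    (H1 : ∀ p ∈ K, ∀ q ∈ N, Z (p - q) → ∀ ε : ℝ, 0 < ε → ε < 1 → ∀ x,
      p + ε • (x - p) ∈ K → q + ε • (x - q) ∈ N → x ∈ N)
    (Hf : ∀ f : EuclideanSpace ℝ (Fin n) →L[ℝ] ℝ, f ≠ 0 → ∀ k ∈ K, ∀ q ∈ N,
      (∀ x ∈ K, f x ≤ f k) → (∀ y ∈ N, f q ≤ f y) → Z (k - q)) : K ⊆ N := by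
  have hsuff : interior K ⊆ N := by
    by_contra hcon
    have hne2 : (interior K ∩ Nᶜ).Nonempty := by
      obtain ⟨x, hx, hx'⟩ := not_subset.1 hcon
      exact ⟨x, hx, hx'⟩
    obtain ⟨q, hqK, hqN⟩ : (interior K ∩ frontier N).Nonempty := by
      by_contra hemp
      have hin : ∀ x ∈ interior K, x ∈ N → x ∈ interior N := by
        intro x hx hxN
        by_contra hxi
        exact hemp ⟨x, hx, subset_closure hxN, hxi⟩
      obtain ⟨y, hy⟩ := hne
      obtain ⟨w, hw1, hw2, hw3⟩ := hK.2.1.interior.isPreconnected (interior N) Nᶜ isOpen_interior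
        hN.1.isClosed.isOpen_compl
        (fun x hx => by
          by_cases h : x ∈ N
          · exact Or.inl (hin x hx h)
          · exact Or.inr h) ⟨y, hy.1, hin y hy.1 hy.2⟩ hne2
      exact hw3 (interior_subset hw2)
    have hqN' : q ∈ N := hN.1.isClosed.frontier_subset hqN
    obtain ⟨f, hf⟩ := geometric_hahn_banach_open_point hN.2.1.interior isOpen_interior hqN.2
    obtain ⟨m, hm⟩ := hN.2.2
    have hfm := hf m hm
    have hf0 : f ≠ 0 := by
      rintro rfl; simp at hfm
    have hfN : ∀ y ∈ N, f y ≤ f q := by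
      intro y hy
      have : closure (interior N) ⊆ {y | f y ≤ f q} :=
        closure_minimal (fun a ha => (hf a ha).le) (isClosed_le f.continuous continuous_const)
      rw [hN.2.1.closure_interior_eq_closure_of_nonempty_interior ⟨m, hm⟩] at this
      exact this (subset_closure hy)
    obtain ⟨q', hq', hq'm⟩ := hN.1.exists_isMinOn ⟨q, hqN'⟩ f.continuous.continuousOn
    obtain ⟨k, hk, hkm⟩ := hK.1.exists_isMaxOn ⟨q, interior_subset hqK⟩ f.continuous.continuousOn
    have hlt : f q' < f q := lt_of_le_of_lt (hq'm (interior_subset hm)) hfm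
    have hZ := Hf f hf0 k hk q' hq' (fun x hx => hkm hx) (fun y hy => hq'm hy)
    have hev : ∀ᶠ e : ℝ in nhds 0, q - e • (q' - q) ∈ K := by
      have hc : Continuous fun e : ℝ => q - e • (q' - q) := by fun_prop
      have : Filter.Tendsto (fun e : ℝ => q - e • (q' - q)) (nhds 0) (nhds q) := by
        simpa using hc.tendsto 0
      filter_upwards [this (isOpen_interior.mem_nhds hqK)] with e he
      exact interior_subset he
    obtain ⟨e, heK, he0⟩ := ((hev.filter_mono nhdsWithin_le_nhds).and
      (self_mem_nhdsWithin : Ioi (0:ℝ) ∈ nhdsWithin 0 (Ioi 0))).exists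
    have he0 : 0 < e := he0
    have hx := H1 k hk q' hq' hZ (1 / (1 + e)) (by positivity)
      (by rw [div_lt_one (by positivity)]; linarith) (q - e • (q' - q)) (by
        have := hK.2.1.add_smul_sub_mem hk heK (t := 1 / (1 + e))
          ⟨by positivity, by rw [div_le_one (by positivity)]; linarith⟩
        exact this) (by
        have : q' + (1 / (1 + e)) • (q - e • (q' - q) - q') = q := by
          have : q - e • (q' - q) - q' = (1 + e) • (q - q') := by module
          rw [this, smul_smul, one_div, inv_mul_cancel₀ (by positivity)]; module
        rwa [this])
    have := hfN _ hx
    simp only [map_sub, map_smul, smul_eq_mul] at this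
    nlinarith
  have h := closure_minimal hsuff hN.1.isClosed
  rw [hK.2.1.closure_interior_eq_closure_of_nonempty_interior hK.2.2] at h
  exact subset_closure.trans h

theorem lcb_Hf (hK : IsCompact K) (hL : IsCompact L) (hLc : Convex ℝ L)
    (f : EuclideanSpace ℝ (Fin n) →L[ℝ] ℝ) (hf : f ≠ 0) {k q} 
    (hk' : ∀ x ∈ K, f x ≤ f k) (hq' : ∀ y ∈ -L, f q ≤ f y) : covar K L (k - q) = 0 := by
  by_contra hne
  have hpos : 0 < covar K L (k - q) := lt_of_le_of_ne (lcb_covar_nonneg _) (Ne.symm hne)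
  obtain ⟨w, hw⟩ : ∃ w, 0 < f w := by
    by_contra hcon
    push Not at hcon
    apply hf
    ext w
    have h1 := hcon w
    have h2 := hcon (-w)
    simp only [map_neg] at h2
    simp; linarith
  have hev : ∀ᶠ e : ℝ in nhds 0, 0 < covar K L (k - q + e • w) := by
    have hc : Continuous fun e : ℝ => covar K L (k - q + e • w) :=
      (lcb_covar_continuous hK hL hLc).comp (by fun_prop)
    have : Filter.Tendsto (fun e : ℝ => covar K L (k - q + e • w)) (nhds 0)
        (nhds (covar K L (k - q))) := by
      simpa using hc.tendsto 0
    exact this.eventually (lt_mem_nhds hpos)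
  obtain ⟨e, heK, he0⟩ := ((hev.filter_mono nhdsWithin_le_nhds).and
      (self_mem_nhdsWithin : Ioi (0:ℝ) ∈ nhdsWithin 0 (Ioi 0))).exists
  have he0 : 0 < e := he0
  obtain ⟨x, hx, hx'⟩ := lcb_mem_add_of_pos heK
  have h1 := hk' x hx
  have h2 := hq' (-(k - q + e • w - x)) (by simpa using hx')
  simp only [map_neg, map_sub, map_add, map_smul, smul_eq_mul] at h2
  nlinarith

theorem lcb_H1 (hn : 0 < n) (hK : IsConvexBody K) (hL : IsConvexBody L)
    (hM : Mmax K L = covar K L 0) {C : Set (EuclideanSpace ℝ (Fin n))} (hC : IsConvexBody C)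
    (hlim : Filter.Tendsto (fun t : ℝ => Metric.hausdorffEDist ((1 - t)⁻¹ • thetaConv K L t) C)
      (nhdsWithin 1 (Iio 1)) (nhds 0))
    (hE : ENNReal.ofReal (Mmax K L / (Nat.choose (2 * n) n : ℝ)) * volume ((n : ℝ) • C) ≤
      volume K * volume L) : ∀ p ∈ K, ∀ q ∈ -L, covar K L (p - q) = 0 → ∀ ε : ℝ, 0 < ε → ε < 1 → 
      ∀ x, p + ε • (x - p) ∈ K → q + ε • (x - q) ∈ -L → x ∈ K ∧ x ∈ -L := by
  intro p hp q hq hz e he0 he1 x hx hx'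
  obtain ⟨d, hd, hd', hxd⟩ := lcb_star hn hK hL hM hC hlim hE hp (y := -q) hq
    (by rwa [← sub_eq_add_neg]) (l := 1 - e) (by linarith) (by linarith) hx (by
      have h2 : -(q + e • (x - q)) ∈ L := hx'
      convert h2 using 1
      module)
  have : x = d := by
    have h : e • (x - d) = 0 := by
      have : e • (x - d) = (p + e • (x - p)) - ((1 - (1 - e)) • d + (1 - e) • p) := by module
      rw [this, ← hxd, sub_self]
    rcases smul_eq_zero.1 h with h | h
    · linarith
    · exact sub_eq_zero.1 h
  subst this
  exact ⟨hd, hd'⟩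

theorem lcb_neg_body (hL : IsConvexBody L) : IsConvexBody (-L) := by
  refine ⟨hL.1.neg, hL.2.1.neg, ?_⟩
  obtain ⟨x, hx⟩ := hL.2.2
  refine ⟨-x, ?_⟩
  have : interior (-L) = -interior L := by
    have := (Homeomorph.neg (EuclideanSpace ℝ (Fin n))).preimage_interior L
    exact this.symm
  rw [this]; simpa using hx

theorem lcb_D_interior (hK : IsConvexBody K) (hL : IsConvexBody L)
    (hM : Mmax K L = covar K L 0) : (interior (lcbS K L 0)).Nonempty := by
  have hM0 := lcb_Mmax_pos hK hL
  have hQc := lcbS_convex hK.2.1 hL.2.1 0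
  by_contra hne
  rw [not_nonempty_iff_eq_empty] at hne
  have h0 := hQc.addHaar_frontier volume
  rw [frontier, hne, sdiff_empty] at h0
  have := measure_mono_null subset_closure h0
  rw [lcb_vol_S hK.1 hL.1, ENNReal.ofReal_eq_zero] at this
  linarith

theorem lcb_eq_neg (hn : 0 < n) (hK : IsConvexBody K) (hL : IsConvexBody L)
    (hM : Mmax K L = covar K L 0) {C : Set (EuclideanSpace ℝ (Fin n))} (hC : IsConvexBody C)
    (hlim : Filter.Tendsto (fun t : ℝ => Metric.hausdorffEDist ((1 - t)⁻¹ • thetaConv K L t) C)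
      (nhdsWithin 1 (Iio 1)) (nhds 0))
    (hE : ENNReal.ofReal (Mmax K L / (Nat.choose (2 * n) n : ℝ)) * volume ((n : ℝ) • C) ≤
      volume K * volume L) : K = -L := by
  have H1 := lcb_H1 hn hK hL hM hC hlim hE
  have hN := lcb_neg_body hL
  obtain ⟨d, hd⟩ := lcb_D_interior hK hL hM
  have hdK : d ∈ interior K := interior_mono (fun x hx => hx.1) hd
  have hdN : d ∈ interior (-L) := interior_mono (fun x hx => by simpa using hx.2) hd
  apply subset_antisymm
  · exact lcb_geom_sub hK hN (Z := fun z => covar K L z = 0) ⟨d, hdK, interior_subset hdN⟩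
      (fun p hp q hq hz e h0 h1 x hx hx' => (H1 p hp q hq hz e h0 h1 x hx hx').2)
      (fun f hf k hk q hq h1 h2 => lcb_Hf hK.1 hL.1 hL.2.1 f hf h1 h2)
  · refine lcb_geom_sub hN hK (Z := fun z => covar K L (-z) = 0) ⟨d, hdN, interior_subset hdK⟩
      (fun p hp q hq hz e h0 h1 x hx hx' => (H1 q hq p hp (by simpa using hz) e h0 h1 x hx' hx).1)
      (fun f hf k hk q hq h1 h2 => ?_)
    have := lcb_Hf hK.1 hL.1 hL.2.1 (-f) (neg_ne_zero.2 hf) (k := q) (q := k)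
      (fun x hx => by simpa using h2 x hx) (fun x hx => by simpa using h1 x hx)
    simpa using this

end LcbPart5

section LcbPart6

variable {K L : Set (EuclideanSpace ℝ (Fin n))}

/-- Points of `K` which cannot be written as a proper combination involving `e`. -/
def lcbG (K : Set (EuclideanSpace ℝ (Fin n))) (e : EuclideanSpace ℝ (Fin n)) :
    Set (EuclideanSpace ℝ (Fin n)) :=
  {g | g ∈ K ∧ ∀ a : ℝ, 0 < a → a ≤ 1 → ∀ g' ∈ K, g ≠ a • e + (1 - a) • g'}

theorem lcb_G_zero (hK : IsConvexBody K) {Z : EuclideanSpace ℝ (Fin n) → Prop}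
    (HS : ∀ p ∈ K, ∀ q ∈ K, Z (p - q) → ∀ l : ℝ, 0 < l → l < 1 → ∀ x ∈ K, x - l • (p - q) ∈ K →
      ∃ d ∈ K, x = (1 - l) • d + l • p)
    (HC : IsClosed {z | Z z}) (HB : ∀ z, ¬ Z z → ∃ x ∈ K, ∃ y ∈ K, z = x - y)
    {e g} (he : e ∈ K.extremePoints ℝ) (hg : g ∈ lcbG K e) : Z (e - g) := by
  by_contra hZ
  have hv : e - g ≠ 0 := by
    intro h
    apply hg.2 1 one_pos le_rfl g hg.1
    rw [sub_eq_zero.1 h]; module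
  set v := e - g with hvd
  have hKK : IsCompact (K - K) := by
    rw [sub_eq_add_neg]; exact hK.1.add hK.1.neg
  set S := {t : ℝ | 1 ≤ t ∧ Z (t • v)} with hS
  have hSc : IsClosed S := by
    have : S = Ici 1 ∩ (fun t : ℝ => t • v) ⁻¹' {z | Z z} := rfl
    rw [this]
    exact isClosed_Ici.inter (HC.preimage (by fun_prop))
  have hSn : S.Nonempty := by
    obtain ⟨R, hR⟩ := hKK.isBounded.exists_norm_le
    have hvp : 0 < ‖v‖ := norm_pos_iff.2 hv
    refine ⟨max 1 ((|R| + 1) / ‖v‖), le_max_left _ _, ?_⟩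
    by_contra hcon
    obtain ⟨x, hx, y, hy, hxy⟩ := HB _ hcon
    have h1 := hR _ (Set.sub_mem_sub hx hy)
    rw [← hxy, norm_smul, Real.norm_of_nonneg (by positivity)] at h1
    have h2 : (|R| + 1) / ‖v‖ * ‖v‖ ≤ max 1 ((|R| + 1) / ‖v‖) * ‖v‖ :=
      mul_le_mul_of_nonneg_right (le_max_right _ _) hvp.le
    rw [div_mul_cancel₀ _ hvp.ne'] at h2
    have := le_abs_self R
    linarith
  have hSb : BddBelow S := ⟨1, fun t ht => ht.1⟩
  have ht0 := hSc.csInf_mem hSn hSb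
  set t0 := sInf S with ht0d
  have h1t : 1 < t0 := by
    refine lt_of_le_of_ne ht0.1 fun h => hZ ?_
    have := ht0.2
    rwa [← h, one_smul] at this
  have hmem : t0 • v ∈ K - K := by
    have hcl : IsClosed ((fun t : ℝ => t • v) ⁻¹' (K - K)) := hKK.isClosed.preimage (by fun_prop)
    have hsub : Ico 1 t0 ⊆ (fun t : ℝ => t • v) ⁻¹' (K - K) := by
      intro t ht
      have : ¬ Z (t • v) := fun h => not_le.2 ht.2 (csInf_le hSb ⟨ht.1, h⟩)
      obtain ⟨x, hx, y, hy, hxy⟩ := HB _ this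
      exact ⟨x, hx, y, hy, hxy.symm⟩
    have := closure_minimal hsub hcl
    rw [closure_Ico h1t.ne] at this
    exact this ⟨h1t.le, le_rfl⟩
  obtain ⟨p, hp, q, hq, hpq⟩ := hmem
  simp only at hpq
  have ht00 : 0 < t0 := by linarith
  have hs0 : 0 < t0⁻¹ := by positivity
  have hs1 : t0⁻¹ < 1 := inv_lt_one_of_one_lt₀ h1t
  have hsv : t0⁻¹ • (p - q) = v := by rw [hpq, smul_smul, inv_mul_cancel₀ ht00.ne', one_smul]
  obtain ⟨d, hd, hed⟩ := HS p hp q hq (by rw [hpq]; exact ht0.2) t0⁻¹ hs0 hs1 e he.1 (by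
    rw [hsv, hvd]; simpa using hg.1)
  have hpe : p = e := by
    have := (mem_extremePoints.1 he).2 d hd p hp ⟨1 - t0⁻¹, t0⁻¹, by linarith, hs0, by ring, hed.symm⟩
    exact this.2
  subst hpe
  apply hg.2 (1 - t0⁻¹) (by linarith) (by linarith) q hq
  have : g = p - t0⁻¹ • (p - q) := by rw [hsv, hvd]; simp
  rw [this]; module

theorem lcb_G_convex (hK : IsConvexBody K) {Z : EuclideanSpace ℝ (Fin n) → Prop}
    (H1 : ∀ p ∈ K, ∀ q ∈ K, Z (p - q) → ∀ ε : ℝ, 0 < ε → ε < 1 → ∀ x,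
      p + ε • (x - p) ∈ K → q + ε • (x - q) ∈ K → x ∈ K)
    (HP : ∀ x ∈ K, ∀ y ∈ K, ∀ s : ℝ, 0 < s → s < 1 → ¬ Z (s • (x - y)))
    {e} (he : e ∈ K) (hZ : ∀ g ∈ lcbG K e, Z (e - g)) : Convex ℝ (lcbG K e) := by
  rw [convex_iff_forall_pos]
  intro g1 hg1 g2 hg2 s t hs ht hst
  refine ⟨hK.2.1 hg1.1 hg2.1 hs.le ht.le hst, ?_⟩
  intro a ha0 ha1 g' hg' hg
  set m := 1 + a / t with hm
  have hat : 0 < a / t := by positivity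
  have hm1 : 1 < m := by linarith
  have hm0 : 0 < m := by linarith
  have hD : 0 < 1 + m + m * (s / t) := by positivity
  set ε := (1 + m + m * (s / t))⁻¹ with hε
  have hε0 : 0 < ε := by positivity
  have hst0 : 0 < m * (s / t) := by positivity
  have hε1 : ε < 1 := inv_lt_one_of_one_lt₀ (by linarith)
  have hεD : ε * (1 + m + m * (s / t)) = 1 := inv_mul_cancel₀ hD.ne'
  have hg2' : g2 = (a / t) • e + ((1 - a) / t) • g' - (s / t) • g1 := by
    have : t • g2 = a • e + (1 - a) • g' - s • g1 := by rw [← hg]; module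
    have h2 : g2 = t⁻¹ • (t • g2) := by rw [smul_smul, inv_mul_cancel₀ ht.ne', one_smul]
    rw [h2, this]
    simp only [div_eq_inv_mul]
    module
  have hx : e + m • (g2 - e) ∈ K := by
    apply H1 e he g1 hg1.1 (hZ g1 hg1) ε hε0 hε1
    · have := hK.2.1.add_smul_sub_mem he hg2.1 (t := ε * m) ⟨by positivity, by nlinarith⟩
      convert this using 1
      module
    · have hc1 : 0 ≤ 1 - ε - ε * m * (s / t) := by nlinarith
      have hc2 : 0 ≤ ε * m * ((1 - a) / t) := by
        have : 0 ≤ (1 - a) / t := div_nonneg (by linarith) ht.le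
        positivity
      have hc3 : 0 ≤ ε * (a / t) ^ 2 := by positivity
      have hat' : (1 - a) / t = 1 + s / t - a / t := by
        field_simp; linarith
      have hsum : 1 - ε - ε * m * (s / t) + (ε * m * ((1 - a) / t) + ε * (a / t) ^ 2) = 1 := by
        rw [hat', hm]; ring
      have hmem : (1 - ε - ε * m * (s / t)) • g1 + (ε * m * ((1 - a) / t)) • g' +
          (ε * (a / t) ^ 2) • e ∈ K := by
        have := hK.2.1.sum_mem (t := Finset.univ) (w := ![1 - ε - ε * m * (s / t),
          ε * m * ((1 - a) / t), ε * (a / t) ^ 2]) (z := ![g1, g', e]) (by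
            intro i _; fin_cases i <;> simp [hc1, hc2, hc3]) (by
            rw [Fin.sum_univ_three]; simp; linarith) (by
            intro i _; fin_cases i <;> simp [hg1.1, hg', he])
        rw [Fin.sum_univ_three] at this
        simpa using this
      convert hmem using 1
      rw [hg2', hm]
      module
  refine HP e he _ hx m⁻¹ (by positivity) (inv_lt_one_of_one_lt₀ hm1) ?_
  have : m⁻¹ • (e - (e + m • (g2 - e))) = e - g2 := by
    have : e - (e + m • (g2 - e)) = m • (e - g2) := by module
    rw [this, smul_smul, inv_mul_cancel₀ hm0.ne', one_smul]
  rw [this]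
  exact hZ g2 hg2

theorem lcb_hull_star (hK : Convex ℝ K) {S : Set (EuclideanSpace ℝ (Fin n))} (hS : S ⊆ K) {y}
    (hy : y ∈ convexHull ℝ S) :
    ∃ e ∈ S, ∃ a : ℝ, 0 < a ∧ a ≤ 1 ∧ ∃ k ∈ K, y = a • e + (1 - a) • k := by
  set T := {y | y ∈ K ∧ ∃ e ∈ S, ∃ a : ℝ, 0 < a ∧ a ≤ 1 ∧ ∃ k ∈ K, y = a • e + (1 - a) • k} with hT
  have hTc : Convex ℝ T := by
    rw [convex_iff_forall_pos]
    rintro y1 ⟨hy1, e, he, a, ha0, ha1, k, hk, hyk⟩ y2 ⟨hy2, -⟩ s t hs ht hst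
    refine ⟨hK hy1 hy2 hs.le ht.le hst, e, he, s * a, by positivity, by nlinarith, ?_⟩
    have hpos : 0 < 1 - s * a := by nlinarith
    refine ⟨(s * (1 - a) / (1 - s * a)) • k + (t / (1 - s * a)) • y2, ?_, ?_⟩
    · apply hK hk hy2 (div_nonneg (mul_nonneg hs.le (by linarith)) hpos.le) (by positivity)
      rw [← add_div, div_eq_one_iff_eq hpos.ne']; linarith
    · rw [smul_add, smul_smul, smul_smul, mul_div_cancel₀ _ hpos.ne', mul_div_cancel₀ _ hpos.ne', hyk]
      module
  have : convexHull ℝ S ⊆ T := convexHull_min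
    (fun e he => ⟨hS he, e, he, 1, one_pos, le_rfl, e, hS he, by module⟩) hTc
  exact (this hy).2

theorem lcb_simplex (hK : IsConvexBody K) 
    (hG : ∀ e ∈ K.extremePoints ℝ, Convex ℝ (lcbG K e)) : IsSimplexBody K := by
  have hoth : ∀ e ∈ K.extremePoints ℝ, ∀ f ∈ K.extremePoints ℝ, f ≠ e → f ∈ lcbG K e := by
    intro e he f hf hfe
    refine ⟨hf.1, fun a ha0 ha1 g hg h => ?_⟩
    rcases ha1.lt_or_eq with h1 | h1
    · exact hfe ((mem_extremePoints.1 hf).2 e he.1 g hg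
        ⟨a, 1 - a, ha0, by linarith, by ring, h.symm⟩).1.symm
    · subst h1; apply hfe; rw [h]; module
  have hind : AffineIndependent ℝ ((↑) : K.extremePoints ℝ → EuclideanSpace ℝ (Fin n)) := by
    by_contra hcon
    obtain ⟨I, y, hy1, hy2⟩ := Convex.radon_partition hcon
    obtain ⟨_, ⟨e, heI, rfl⟩, a, ha0, ha1, k, hk, hyk⟩ := lcb_hull_star hK.2.1
      (by rintro _ ⟨e, _, rfl⟩; exact e.2.1) hy1
    have hsub : convexHull ℝ ((↑) '' Iᶜ : Set (EuclideanSpace ℝ (Fin n))) ⊆ lcbG K e := by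
      apply convexHull_min _ (hG e e.2)
      rintro _ ⟨f, hf, rfl⟩
      refine hoth e e.2 f f.2 fun h => hf ?_
      rwa [Subtype.ext h]
    exact (hsub hy2).2 a ha0 ha1 k hk hyk
  have hfin : (K.extremePoints ℝ).Finite := finite_set_of_fin_dim_affineIndependent ℝ hind
  have hKh : K = convexHull ℝ (K.extremePoints ℝ) := by
    have := closure_convexHull_extremePoints hK.1 hK.2.1
    rw [(hfin.isCompact_convexHull ℝ).isClosed.closure_eq] at this
    exact this.symm
  have : Fintype (K.extremePoints ℝ) := hfin.fintype
  have hspan : affineSpan ℝ (range ((↑) : K.extremePoints ℝ → EuclideanSpace ℝ (Fin n))) = ⊤ := by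
    rw [Subtype.range_coe, ← affineSpan_convexHull, ← hKh]
    exact affineSpan_eq_top_of_nonempty_interior (by rw [hK.2.1.convexHull_eq]; exact hK.2.2)
  have hcard := hind.affineSpan_eq_top_iff_card_eq_finrank_add_one.1 hspan
  rw [finrank_euclideanSpace_fin] at hcard
  let φ := (Fintype.equivFinOfCardEq hcard).symm
  refine ⟨fun i => (φ i : EuclideanSpace ℝ (Fin n)), hind.comp_embedding φ.toEmbedding, ?_⟩
  have : range (fun i => (φ i : EuclideanSpace ℝ (Fin n))) = K.extremePoints ℝ := by
    have := φ.surjective.range_comp ((↑) : K.extremePoints ℝ → EuclideanSpace ℝ (Fin n))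
    rw [Subtype.range_coe] at this
    exact this
  rw [this]; exact hKh

theorem lcb_eq_case (hn : 0 < n) (hK : IsConvexBody K) (hL : IsConvexBody L)
    (hM : Mmax K L = covar K L 0) {C : Set (EuclideanSpace ℝ (Fin n))} (hC : IsConvexBody C)
    (hlim : Filter.Tendsto (fun t : ℝ => Metric.hausdorffEDist ((1 - t)⁻¹ • thetaConv K L t) C)
      (nhdsWithin 1 (Iio 1)) (nhds 0))
    (hE : ENNReal.ofReal (Mmax K L / (Nat.choose (2 * n) n : ℝ)) * volume ((n : ℝ) • C) ≤
      volume K * volume L) : K = -L ∧ IsSimplexBody K := by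
  have hKL := lcb_eq_neg hn hK hL hM hC hlim hE
  refine ⟨hKL, ?_⟩
  have hmem : ∀ x, x ∈ L ↔ -x ∈ K := by intro x; rw [hKL]; simp
  have H1 := lcb_H1 hn hK hL hM hC hlim hE
  rw [← hKL] at H1
  have HP : ∀ x ∈ K, ∀ y ∈ K, ∀ s : ℝ, 0 < s → s < 1 → ¬ (covar K L (s • (x - y)) = 0) := by
    intro x hx y hy s hs0 hs1 h0
    have hsub : (fun w => w + s • x) '' ((1 - s) • lcbS K L 0) ⊆ lcbS K L (s • (x - y)) := by
      rintro _ ⟨_, ⟨d, hd, rfl⟩, rfl⟩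
      have h1 : x ∈ lcbS K L (x - y) := ⟨hx, by rw [hmem]; simpa using hy⟩
      have := lcbS_combo hK.2.1 hL.2.1 hs0.le hs1.le hd h1
      rwa [smul_zero, zero_add] at this
    have := measure_mono (μ := volume) hsub
    have h1s : 0 < 1 - s := by linarith
    rw [Set.image_add_right, measure_preimage_add_right, lcb_vol_smul, lcb_vol_S hK.1 hL.1,
      lcb_vol_S hK.1 hL.1, h0, ← hM, abs_of_pos h1s, ← ENNReal.ofReal_mul (by positivity),
      ENNReal.ofReal_zero, nonpos_iff_eq_zero, ENNReal.ofReal_eq_zero] at this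
    have hM0 := lcb_Mmax_pos hK hL
    have : 0 < (1 - s) ^ n * Mmax K L := by positivity
    linarith
  apply lcb_simplex hK
  intro e he
  apply lcb_G_convex hK (Z := fun z => covar K L z = 0)
    (fun p hp q hq hz ε h0 h1 x hx hx' => (H1 p hp q hq hz ε h0 h1 x hx hx').1) HP he.1
  intro g hg
  apply lcb_G_zero hK (Z := fun z => covar K L z = 0) _ _ _ he hg
  · intro p hp q hq hz l hl0 hl1 x hx hx'
    obtain ⟨d, hd, -, h⟩ := lcb_star hn hK hL hM hC hlim hE hp (y := -q) (by rw [hmem]; simpa using hq)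
      (by rwa [← sub_eq_add_neg]) hl0 hl1 hx (by
        rw [hmem, ← sub_eq_add_neg]; simpa using hx')
    exact ⟨d, hd, h⟩
  · exact isClosed_eq (lcb_covar_continuous hK.1 hL.1 hL.2.1) continuous_const
  · intro z hz
    obtain ⟨x, hx, hx'⟩ := lcb_mem_add_of_pos (lt_of_le_of_ne (lcb_covar_nonneg _) (Ne.symm hz))
    exact ⟨x, hx, x - z, by rw [hmem] at hx'; simpa using hx', by simp⟩

end LcbPart6

section LcbPart7

variable {K L : Set (EuclideanSpace ℝ (Fin n))}

theorem lcb_rho (hn : 0 < n) (hK : IsConvexBody K) (hL : IsConvexBody L)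
    (hM : Mmax K L = covar K L 0) (hKL : K = -L) (hS : IsSimplexBody K) :
    ∃ ρ : EuclideanSpace ℝ (Fin n) → ℝ, Continuous ρ ∧
      (∀ r : ℝ, 0 ≤ r → ∀ z, ρ (r • z) = r * ρ z) ∧ (∀ z, 0 ≤ ρ z) ∧
      (∀ z, ρ z ≤ 1 → covar K L z = (1 - ρ z) ^ n * Mmax K L) ∧
      (∀ z, 1 < ρ z → covar K L z = 0) := by
  obtain ⟨v, hv, hKv⟩ := hS
  have hmem : ∀ x, x ∈ L ↔ -x ∈ K := by intro x; rw [hKL]; simp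
  have htop : affineSpan ℝ (range v) = ⊤ :=
    hv.affineSpan_eq_top_iff_card_eq_finrank_add_one.2 (by simp)
  let b : AffineBasis (Fin (n + 1)) ℝ (EuclideanSpace ℝ (Fin n)) := ⟨v, hv, htop⟩
  have hKc : ∀ x, x ∈ K ↔ ∀ i, 0 ≤ b.coord i x := by
    intro x
    have := b.convexHull_eq_nonneg_coord
    change convexHull ℝ (range v) = _ at this
    rw [hKv, this]; rfl
  set d : Fin (n + 1) → EuclideanSpace ℝ (Fin n) →ₗ[ℝ] ℝ := fun i => (b.coord i).linear with hd
  have hcd : ∀ i x, b.coord i x = d i x + b.coord i 0 := by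
    intro i x
    have := (b.coord i).map_vadd 0 x
    rw [vadd_eq_add, add_zero, vadd_eq_add] at this
    exact this
  let m : EuclideanSpace ℝ (Fin n) → Fin (n + 1) → ℝ := fun z i => max 0 (d i z)
  have hm0 : ∀ z i, 0 ≤ m z i := fun z i => le_max_left _ _
  have hmd : ∀ z i, d i z ≤ m z i := fun z i => le_max_right _ _
  let ρ : EuclideanSpace ℝ (Fin n) → ℝ := fun z => ∑ i, m z i
  have hSm : ∀ z x, x ∈ lcbS K L z ↔ ∀ i, m z i ≤ b.coord i x := by
    intro z x
    have : x ∈ lcbS K L z ↔ x ∈ K ∧ x - z ∈ K := by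
      change x ∈ K ∧ z - x ∈ L ↔ _
      rw [hmem, neg_sub]
    rw [this, hKc, hKc, ← forall_and]
    refine forall_congr' fun i => ?_
    rw [hcd i (x - z), map_sub]
    have := hcd i x
    constructor
    · rintro ⟨h1, h2⟩; exact max_le h1 (by linarith)
    · intro h; exact ⟨(hm0 z i).trans h, by linarith [hmd z i]⟩
  have hS0 : lcbS K L 0 = K := by
    ext x; rw [hSm, hKc]; simp [m]
  have hvK : volume K = ENNReal.ofReal (Mmax K L) := by
    rw [hM, ← lcb_vol_S hK.1 hL.1, hS0]
  have hM0 := lcb_Mmax_pos hK hL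
  refine ⟨ρ, ?_, ?_, fun z => Finset.sum_nonneg fun i _ => hm0 z i, ?_, ?_⟩
  · refine continuous_finsetSum _ fun i _ => ?_
    exact continuous_const.max (d i).continuous_of_finiteDimensional
  · intro r hr z
    change ∑ i, m (r • z) i = r * ∑ i, m z i
    rw [Finset.mul_sum]
    refine Finset.sum_congr rfl fun i _ => ?_
    change max 0 (d i (r • z)) = r * max 0 (d i z)
    rw [mul_max_of_nonneg _ _ hr, mul_zero, map_smul, smul_eq_mul]
  · intro z hz
    set r := 1 - ρ z with hr
    have hr0 : 0 ≤ r := by linarith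
    set u := ∑ i, m z i • b i with hu
    have hcu : ∀ i w, b.coord i (r • w + u) = r * b.coord i w + m z i := by
      intro i w
      have h1 : d i u = m z i - ρ z * b.coord i 0 := by
        rw [hu, map_sum]
        have : ∀ j, d i (m z j • b j) = (if i = j then m z j else 0) - m z j * b.coord i 0 := by
          intro j
          have h := hcd i (b j)
          rw [b.coord_apply] at h
          rw [map_smul, smul_eq_mul]
          have h' : d i (b j) = (if i = j then 1 else 0) - b.coord i 0 := by linarith
          rw [h']; split_ifs <;> ring
        simp only [this, Finset.sum_sub_distrib, ← Finset.sum_mul, Finset.sum_ite_eq,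
          Finset.mem_univ, if_true]
        rfl
      rw [hcd, map_add, map_smul, h1, smul_eq_mul, hcd i w, hr]; ring
    have hSe : lcbS K L z = (fun w => w + u) '' (r • K) := by
      ext x
      rw [hSm]
      constructor
      · intro h
        rcases hr0.eq_or_lt with h0 | h0
        · obtain ⟨w, hw⟩ := hK.2.2
          refine ⟨r • w, ⟨w, interior_subset hw, rfl⟩, ?_⟩
          apply b.ext_elem
          intro i
          change b.coord i (r • w + u) = _
          rw [hcu, ← h0, zero_mul, zero_add]
          have hsum : ∑ i, m z i = ∑ i, b.coord i x := by
            rw [b.sum_coord_apply_eq_one]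
            change ρ z = 1; linarith
          exact (Finset.sum_eq_sum_iff_of_le fun i _ => h i).1 hsum i (Finset.mem_univ i)
        · refine ⟨x - u, ⟨r⁻¹ • (x - u), ?_, ?_⟩, by simp⟩
          · rw [hKc]
            intro i
            have := hcu i (r⁻¹ • (x - u))
            rw [smul_smul, mul_inv_cancel₀ h0.ne', one_smul, sub_add_cancel] at this
            have h2 := h i
            have : 0 ≤ r * b.coord i (r⁻¹ • (x - u)) := by linarith
            exact nonneg_of_mul_nonneg_right this h0
          · simp only [smul_smul]; rw [mul_inv_cancel₀ h0.ne', one_smul]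
      · rintro ⟨_, ⟨w, hw, rfl⟩, rfl⟩ i
        change _ ≤ b.coord i (r • w + u)
        rw [hcu]
        have := mul_nonneg hr0 ((hKc w).1 hw i)
        linarith
    have : volume (lcbS K L z) = ENNReal.ofReal (r ^ n * Mmax K L) := by
      rw [hSe, Set.image_add_right, measure_preimage_add_right, lcb_vol_smul, hvK, abs_of_nonneg hr0,
        ENNReal.ofReal_mul (by positivity)]
    rw [lcb_vol_S hK.1 hL.1] at this
    exact (ENNReal.ofReal_eq_ofReal_iff (lcb_covar_nonneg _) (by positivity)).1 this
  · intro z hz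
    by_contra hne
    obtain ⟨x, hx⟩ := lcb_mem_add_of_pos (lt_of_le_of_ne (lcb_covar_nonneg z) (Ne.symm hne))
    have h1 := (hSm z x).1 hx
    have h2 := Finset.sum_le_sum (s := Finset.univ) fun i _ => h1 i
    rw [b.sum_coord_apply_eq_one] at h2
    change ρ z ≤ 1 at h2
    linarith

theorem lcb_simplex_eq (hn : 0 < n) (hK : IsConvexBody K) (hL : IsConvexBody L)
    (hM : Mmax K L = covar K L 0) {C : Set (EuclideanSpace ℝ (Fin n))}
    (hlim : Filter.Tendsto (fun t : ℝ => Metric.hausdorffEDist ((1 - t)⁻¹ • thetaConv K L t) C)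
      (nhdsWithin 1 (Iio 1)) (nhds 0)) (hKL : K = -L) (hS : IsSimplexBody K) :
    ENNReal.ofReal (Mmax K L / (Nat.choose (2 * n) n : ℝ)) * volume ((n : ℝ) • C) ≤
      volume K * volume L := by
  obtain ⟨ρ, hρc, hρh, hρ0, hρ1, hρ2⟩ := lcb_rho hn hK hL hM hKL hS
  have hM0 := lcb_Mmax_pos hK hL
  have hn1 : (0:ℝ) < (1:ℝ) / n := by positivity
  have hnn : (n : ℝ) ≠ 0 := by positivity
  have rt : ∀ s : ℝ, 0 ≤ s → (s ^ n) ^ ((1:ℝ)/n) = s := fun s hs => by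
    rw [one_div]; exact Real.pow_rpow_inv_natCast hs hn.ne'
  have rt' : ∀ s : ℝ, 0 ≤ s → (s ^ ((1:ℝ)/n)) ^ n = s := fun s hs => by
    rw [one_div]; exact Real.rpow_inv_natCast_pow hs hn.ne'
  have hCρ : ∀ c ∈ C, ρ c ≤ 1 / n := by
    intro c hc
    by_contra hcon
    push Not at hcon
    obtain ⟨η, h1, h2⟩ := exists_between hcon
    have hU : {x | η < ρ x} ∈ nhds c := (isOpen_lt continuous_const hρc).mem_nhds h2
    have e1 := lcb_haus_b hlim hc hU
    have e2 := (lcb_tendsto_ratio hn).eventually (gt_mem_nhds h1)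
    have e3 : ∀ᶠ t : ℝ in nhdsWithin 1 (Iio 1), 0 < t :=
      (lt_mem_nhds one_pos).filter_mono nhdsWithin_le_nhds
    have e4 : ∀ᶠ t : ℝ in nhdsWithin 1 (Iio 1), t < 1 := self_mem_nhdsWithin
    obtain ⟨t, ⟨_, ⟨z, hz, rfl⟩, hx⟩, hr, ht0, ht1⟩ := (e1.and (e2.and (e3.and e4))).exists
    have h1t : 0 < 1 - t := by linarith
    have hcov : t * Mmax K L ≤ covar K L z := hz.2
    have hpos : 0 < t * Mmax K L := by positivity
    have hz1 : ρ z ≤ 1 := by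
      by_contra hgt
      rw [hρ2 z (not_le.1 hgt)] at hcov
      linarith
    rw [hρ1 z hz1] at hcov
    have h3 : t ≤ (1 - ρ z) ^ n := le_of_mul_le_mul_right hcov hM0
    have h4 : t ^ ((1:ℝ)/n) ≤ 1 - ρ z := by
      rw [← rt (1 - ρ z) (by linarith)]
      exact Real.rpow_le_rpow ht0.le h3 hn1.le
    change η < ρ ((1 - t)⁻¹ • z) at hx
    rw [hρh _ (by positivity)] at hx
    have h5 : (1 - t)⁻¹ * ρ z ≤ (1 - t ^ ((1:ℝ)/n)) / (1 - t) := by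
      rw [div_eq_inv_mul]
      exact mul_le_mul_of_nonneg_left (by linarith) (by positivity)
    linarith
  rw [← lcb_layer' hK.1 hL.1 hL.2.1 hM0, ← lcb_beta hn hM0, ← lintegral_mul_const]
  · refine setLIntegral_mono' measurableSet_Ioo fun t ht => ?_
    have hq0 : 0 < t / Mmax K L := div_pos ht.1 hM0
    have hq1 : t / Mmax K L < 1 := (div_lt_one hM0).2 ht.2
    set s := (t / Mmax K L) ^ ((1:ℝ)/n) with hs
    have hs0 : 0 < s := by positivity
    have hs1 : s < 1 := Real.rpow_lt_one hq0.le hq1 hn1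
    have hr0 : 0 ≤ 1 - s := by linarith
    have := lcb_vol_smul (1 - s) ((n : ℝ) • C)
    rw [abs_of_nonneg hr0] at this
    rw [← this]
    apply measure_mono
    rintro _ ⟨_, ⟨c, hc, rfl⟩, rfl⟩
    change t ≤ covar K L ((1 - s) • (n : ℝ) • c)
    have hle : ρ ((1 - s) • (n : ℝ) • c) ≤ 1 - s := by
      rw [hρh _ hr0, hρh _ (by positivity)]
      have := hCρ c hc
      rw [le_div_iff₀ (by positivity)] at this
      nlinarith
    rw [hρ1 _ (by linarith)]
    have h1 : s ^ n ≤ (1 - ρ ((1 - s) • (n : ℝ) • c)) ^ n := pow_le_pow_left₀ hs0.le (by linarith) n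
    rw [hs, rt' _ hq0.le] at h1
    calc t = t / Mmax K L * Mmax K L := by field_simp
      _ ≤ _ := mul_le_mul_of_nonneg_right h1 hM0.le
  · fun_prop

theorem lcb_final (hn : 0 < n) {c k l M B : ℝ} (hc : 0 ≤ c) (hk : 0 ≤ k) (hl : 0 ≤ l) (hM : 0 < M)
    (hB : 0 < B) :
    ((1/n) * B ^ ((1:ℝ)/n) * (k ^ ((1:ℝ)/n) * l ^ ((1:ℝ)/n) / M ^ ((1:ℝ)/n)) ≤ c ^ ((1:ℝ)/n) ↔
      k * l ≤ M / B * ((n:ℝ) ^ n * c)) ∧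
    (c ^ ((1:ℝ)/n) ≤ (1/n) * B ^ ((1:ℝ)/n) * (k ^ ((1:ℝ)/n) * l ^ ((1:ℝ)/n) / M ^ ((1:ℝ)/n)) ↔
      M / B * ((n:ℝ) ^ n * c) ≤ k * l) := by
  have hn0 : (0:ℝ) < n := by exact_mod_cast hn
  have hn1 : (0:ℝ) < (1:ℝ) / n := by positivity
  have e : (1/n) * B ^ ((1:ℝ)/n) * (k ^ ((1:ℝ)/n) * l ^ ((1:ℝ)/n) / M ^ ((1:ℝ)/n)) =
      (B * (k * l / M) / (n:ℝ) ^ n) ^ ((1:ℝ)/n) := by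
    rw [Real.div_rpow (by positivity) (by positivity), Real.mul_rpow hB.le (by positivity),
      Real.div_rpow (by positivity) hM.le, Real.mul_rpow hk hl]
    have : ((n:ℝ) ^ n) ^ ((1:ℝ)/n) = n := by
      rw [one_div]; exact Real.pow_rpow_inv_natCast hn0.le hn.ne'
    rw [this]; ring
  have e2 : B * (k * l / M) / (n:ℝ) ^ n = (k * l) * (B / (M * (n:ℝ) ^ n)) := by field_simp
  have e3 : c = M / B * ((n:ℝ) ^ n * c) * (B / (M * (n:ℝ) ^ n)) := by field_simp
  have hp : 0 < B / (M * (n:ℝ) ^ n) := by positivity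
  rw [e, Real.rpow_le_rpow_iff (by positivity) hc hn1, Real.rpow_le_rpow_iff hc (by positivity) hn1, e2]
  constructor
  · conv_lhs => rw [e3]
    exact mul_le_mul_iff_left₀ hp
  · conv_lhs => rw [e3]
    exact mul_le_mul_iff_left₀ hp

end LcbPart7

theorem limiting_convolution_body_zhang (hn : 0 < n)
    (K L : Set (EuclideanSpace ℝ (Fin n)))
    (hK : IsConvexBody K) (hL : IsConvexBody L)
    (hM : Mmax K L = covar K L 0)
    (C : Set (EuclideanSpace ℝ (Fin n))) (hC : IsConvexBody C)
    (hlim : Filter.Tendsto (fun θ : ℝ =>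
        EMetric.hausdorffEdist ((1 - θ)⁻¹ • thetaConv K L θ) C)
      (nhdsWithin 1 (Iio 1)) (nhds 0)) :
    (volume C).toReal ^ ((1:ℝ)/n) ≥
        (1/n) * ((Nat.choose (2*n) n : ℝ)) ^ ((1:ℝ)/n) *
          ((volume K).toReal ^ ((1:ℝ)/n) * (volume L).toReal ^ ((1:ℝ)/n) /
            (Mmax K L) ^ ((1:ℝ)/n)) ∧
      ((volume C).toReal ^ ((1:ℝ)/n) =
          (1/n) * ((Nat.choose (2*n) n : ℝ)) ^ ((1:ℝ)/n) *
            ((volume K).toReal ^ ((1:ℝ)/n) * (volume L).toReal ^ ((1:ℝ)/n) /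
              (Mmax K L) ^ ((1:ℝ)/n)) ↔
        (K = -L ∧ IsSimplexBody K)) := by
  have hlim' : Filter.Tendsto (fun t : ℝ => Metric.hausdorffEDist ((1 - t)⁻¹ • thetaConv K L t) C)
      (nhdsWithin 1 (Iio 1)) (nhds 0) := hlim
  have hM0 := lcb_Mmax_pos hK hL
  have hB : (0:ℝ) < (Nat.choose (2*n) n : ℝ) := by
    exact_mod_cast Nat.choose_pos (by omega)
  obtain ⟨f1, f2⟩ := lcb_final hn (c := (volume C).toReal) (k := (volume K).toReal)
    (l := (volume L).toReal) ENNReal.toReal_nonneg ENNReal.toReal_nonneg ENNReal.toReal_nonneg hM0 hB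
  have hCt := hC.1.measure_lt_top (μ := volume) |>.ne
  have hKt := hK.1.measure_lt_top (μ := volume) |>.ne
  have hLt := hL.1.measure_lt_top (μ := volume) |>.ne
  have a1 : ENNReal.ofReal (Mmax K L / (Nat.choose (2 * n) n : ℝ)) * volume ((n : ℝ) • C) =
      ENNReal.ofReal (Mmax K L / (Nat.choose (2 * n) n : ℝ) * ((n:ℝ) ^ n * (volume C).toReal)) := by
    rw [lcb_vol_smul, ENNReal.ofReal_mul (by positivity), ENNReal.ofReal_mul (by positivity),
      ENNReal.ofReal_toReal hCt]
    simp
  have a2 : volume K * volume L = ENNReal.ofReal ((volume K).toReal * (volume L).toReal) := by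
    rw [ENNReal.ofReal_mul (by positivity), ENNReal.ofReal_toReal hKt, ENNReal.ofReal_toReal hLt]
  have hge := lcb_ineq hn hK hL hM hC.1.isClosed hlim'
  rw [a1, a2, ENNReal.ofReal_le_ofReal_iff (by positivity)] at hge
  have hge' := f1.2 hge
  refine ⟨hge', ⟨fun h => ?_, fun h => ?_⟩⟩
  · apply lcb_eq_case hn hK hL hM hC hlim'
    rw [a1, a2, ENNReal.ofReal_le_ofReal_iff (by positivity)]
    exact f2.1 h.le
  · have := lcb_simplex_eq hn hK hL hM hlim' h.1 h.2
    rw [a1, a2, ENNReal.ofReal_le_ofReal_iff (by positivity)] at this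
    exact le_antisymm (f2.2 this) hge'
end

section
/- Let K, L ⊆ ℝ^n be convex bodies with M(K,L) = |K ∩ (−L)|, and let g_{K,L}(z) = |K ∩ (z − L)|. Then for every θ with (3/4)^n ≤ θ < 1, the inclusion binom(2n,n)^(1/n)·K_n(g_{K,L}) ⊆ (K +_θ L)/(1 − θ^{1/n}) holds. -/
open MeasureTheory Set Pointwise

variable {n : ℕ}

/-- Ball's body `K_p(g)`. -/
noncomputable def ballBody (g : EuclideanSpace ℝ (Fin n) → ℝ) (p : ℝ) :
    Set (EuclideanSpace ℝ (Fin n)) :=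
  {x | g 0 ≤ p * ∫ r in Set.Ioi (0:ℝ), r ^ (p - 1) * g (r • x)}


/-- One-dimensional Brunn-Minkowski for compact sets. -/
lemma bm1_compact {A B C : Set ℝ} (hA : IsCompact A) (hB : IsCompact B)
    (hAn : A.Nonempty) (hBn : B.Nonempty) (hC : ∀ x ∈ A, ∀ y ∈ B, x + y ∈ C) :
    volume A + volume B ≤ volume C := by
  obtain ⟨p, hpA, hp⟩ := hA.exists_isGreatest hAn
  obtain ⟨q, hqB, hq⟩ := hB.exists_isLeast hBn
  have h1 : (fun x => x + q) '' A ∪ (fun y => p + y) '' B ⊆ C := by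
    rintro _ (⟨x, hx, rfl⟩ | ⟨y, hy, rfl⟩)
    · exact hC _ hx _ hqB
    · exact hC _ hpA _ hy
  have hm : MeasurableSet ((fun y => p + y) '' B) :=
    (hB.image (by fun_prop)).measurableSet
  have hd : AEDisjoint volume ((fun x => x + q) '' A) ((fun y => p + y) '' B) := by
    have : ((fun x => x + q) '' A) ∩ ((fun y => p + y) '' B) ⊆ {p + q} := by
      rintro _ ⟨⟨x, hx, rfl⟩, ⟨y, hy, hxy⟩⟩
      have := hp hx
      have := hq hy
      simp only [mem_singleton_iff] at *
      linarith
    exact measure_mono_null this (by simp)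
  calc volume A + volume B
      = volume ((fun x => x + q) '' A) + volume ((fun y => p + y) '' B) := by
        simp
    _ = volume ((fun x => x + q) '' A ∪ (fun y => p + y) '' B) :=
        (measure_union₀ hm.nullMeasurableSet hd).symm
    _ ≤ _ := measure_mono h1

lemma bm1 {A B C : Set ℝ} (hA : MeasurableSet A) (hB : MeasurableSet B)
    (hAn : A.Nonempty) (hBn : B.Nonempty) (hC : ∀ x ∈ A, ∀ y ∈ B, x + y ∈ C) :
    volume A + volume B ≤ volume C := by
  obtain ⟨a0, ha0⟩ := hAn
  obtain ⟨b0, hb0⟩ := hBn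
  rw [hA.measure_eq_iSup_isCompact, hB.measure_eq_iSup_isCompact]
  simp only [iSup_and']
  rw [iSup_subtype', iSup_subtype']
  have : Nonempty {s // s ⊆ A ∧ IsCompact s} := ⟨⟨∅, by simp⟩⟩
  have : Nonempty {s // s ⊆ B ∧ IsCompact s} := ⟨⟨∅, by simp⟩⟩
  refine ENNReal.iSup_add_iSup_le ?_
  rintro ⟨s, hs, hs'⟩ ⟨t, ht, ht'⟩
  simp only
  calc volume s + volume t ≤ volume (insert a0 s) + volume (insert b0 t) := by
        gcongr <;> exact subset_insert _ _
    _ ≤ _ := by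
      refine bm1_compact (hs'.insert _) (ht'.insert _) (insert_nonempty _ _)
        (insert_nonempty _ _) ?_
      intro x hx y hy
      refine hC x ?_ y ?_
      · rcases hx with rfl | hx
        · exact ha0
        · exact hs hx
      · rcases hy with rfl | hy
        · exact hb0
        · exact ht hy

lemma bm1_conv {A B C : Set ℝ} (hA : MeasurableSet A) (hB : MeasurableSet B)
    (hAn : A.Nonempty) (hBn : B.Nonempty) {a b : ℝ} (ha : 0 < a) (hb : 0 < b)
    (hC : ∀ x ∈ A, ∀ y ∈ B, a * x + b * y ∈ C) :
    ENNReal.ofReal a * volume A + ENNReal.ofReal b * volume B ≤ volume C := by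
  have h := bm1 (A := a • A) (B := b • B) (C := C) (hA.const_smul₀ a) (hB.const_smul₀ b)
    hAn.smul_set hBn.smul_set (by
      rintro _ ⟨x, hx, rfl⟩ _ ⟨y, hy, rfl⟩
      simpa using hC x hx y hy)
  simpa [Measure.addHaar_smul, abs_of_pos ha, abs_of_pos hb] using h

lemma pl1_norm {f g h : ℝ → ℝ} (hf : Measurable f) (hg : Measurable g) (hh : Measurable h)
    (f0 : ∀ x, 0 ≤ f x) (g0 : ∀ x, 0 ≤ g x) (h0 : ∀ x, 0 ≤ h x)
    (f1 : ∀ x, f x ≤ 1) (g1 : ∀ x, g x ≤ 1)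
    (fs : ∀ t < 1, ∃ x, t < f x) (gs : ∀ t < 1, ∃ x, t < g x)
    {a b : ℝ} (ha : 0 < a) (hb : 0 < b) (hab : a + b = 1)
    (H : ∀ x y, f x ^ a * g y ^ b ≤ h (a * x + b * y)) :
    ENNReal.ofReal a * (∫⁻ x, ENNReal.ofReal (f x)) +
      ENNReal.ofReal b * (∫⁻ x, ENNReal.ofReal (g x)) ≤ ∫⁻ x, ENNReal.ofReal (h x) := by
  rw [lintegral_eq_lintegral_meas_lt _ (.of_forall f0) hf.aemeasurable,
    lintegral_eq_lintegral_meas_lt _ (.of_forall g0) hg.aemeasurable,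
    lintegral_eq_lintegral_meas_lt _ (.of_forall h0) hh.aemeasurable]
  have mf : Measurable fun t => volume {x | t < f x} :=
    Antitone.measurable fun s t hst => measure_mono fun x hx => lt_of_le_of_lt hst hx
  have mg : Measurable fun t => volume {x | t < g x} :=
    Antitone.measurable fun s t hst => measure_mono fun x hx => lt_of_le_of_lt hst hx
  rw [← lintegral_const_mul _ mf, ← lintegral_const_mul _ mg,
    ← lintegral_add_left (mf.const_mul _)]
  refine setLIntegral_mono_ae' measurableSet_Ioi (.of_forall fun t ht => ?_)
  have ht : 0 < t := ht
  rcases lt_or_ge t 1 with h1 | h1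
  · refine bm1_conv (measurableSet_lt measurable_const hf) (measurableSet_lt measurable_const hg)
      (fs t h1) (gs t h1) ha hb ?_
    intro x hx y hy
    refine lt_of_lt_of_le ?_ (H x y)
    calc t = t ^ a * t ^ b := by rw [← Real.rpow_add ht, hab, Real.rpow_one]
      _ < f x ^ a * g y ^ b := by
        have hx : t < f x := hx
        have hy : t < g y := hy
        gcongr
  · have e1 : {x | t < f x} = ∅ := by
      ext x; simpa using (f1 x).trans h1
    have e2 : {x | t < g x} = ∅ := by
      ext x; simpa using (g1 x).trans h1
    simp [e1, e2]

open scoped ENNReal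

lemma amgm_ennreal (u v : ℝ≥0∞) {a b : ℝ} (ha : 0 < a) (hb : 0 < b) (hab : a + b = 1) :
    u ^ a * v ^ b ≤ ENNReal.ofReal a * u + ENNReal.ofReal b * v := by
  have hap : ENNReal.ofReal a ≠ 0 := by simpa using ha
  have hbp : ENNReal.ofReal b ≠ 0 := by simpa using hb
  rcases eq_or_ne u ∞ with rfl | hu
  · rw [ENNReal.mul_top hap]; simp
  rcases eq_or_ne v ∞ with rfl | hv
  · rw [ENNReal.mul_top hbp]; simp
  lift u to NNReal using hu
  lift v to NNReal using hv
  have := Real.geom_mean_le_arith_mean2_weighted ha.le hb.le u.2 v.2 hab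
  rw [← ENNReal.ofReal_coe_nnreal, ← ENNReal.ofReal_coe_nnreal,
    ENNReal.ofReal_rpow_of_nonneg u.coe_nonneg ha.le, ENNReal.ofReal_rpow_of_nonneg v.coe_nonneg hb.le,
    ← ENNReal.ofReal_mul (by positivity), ← ENNReal.ofReal_mul (by positivity),
    ← ENNReal.ofReal_mul (by positivity), ← ENNReal.ofReal_add (by positivity) (by positivity)]
  exact ENNReal.ofReal_le_ofReal this

lemma pl1_bdd {f g h : ℝ → ℝ≥0∞} (hf : Measurable f) (hg : Measurable g) (hh : Measurable h)
    {N : ℝ≥0∞} (hN : N ≠ ∞) (fN : ∀ x, f x ≤ N) (gN : ∀ x, g x ≤ N)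
    {a b : ℝ} (ha : 0 < a) (hb : 0 < b) (hab : a + b = 1)
    (H : ∀ x y, f x ^ a * g y ^ b ≤ h (a * x + b * y)) :
    (∫⁻ x, f x) ^ a * (∫⁻ x, g x) ^ b ≤ ∫⁻ x, h x := by
  have key : ∀ (f : ℝ → ℝ≥0∞), Measurable f → (∀ x, f x ≤ N) → (∫⁻ x, f x) ≠ 0 →
      ∃ α : ℝ≥0∞, α ≠ 0 ∧ α ≠ ∞ ∧ ∃ F : ℝ → ℝ, Measurable F ∧ (∀ x, 0 ≤ F x) ∧ (∀ x, F x ≤ 1) ∧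
        (∀ t < 1, ∃ x, t < F x) ∧ ∀ x, f x = α * ENNReal.ofReal (F x) := by
    intro f hf fN hi
    have hαN : (⨆ x, f x) ≤ N := iSup_le fN
    have hαt : (⨆ x, f x) ≠ ∞ := ne_top_of_le_ne_top hN hαN
    have hα0 : (⨆ x, f x) ≠ 0 := by
      intro h0
      apply hi
      have : ∀ x, f x = 0 := by simpa using h0
      simp [this]
    have hle : ∀ x, f x / (⨆ x, f x) ≤ 1 := fun x => by
      apply ENNReal.div_le_of_le_mul; rw [one_mul]; exact le_iSup f x
    have hnt : ∀ x, f x / (⨆ x, f x) ≠ ∞ := fun x => ne_top_of_le_ne_top (by simp) (hle x)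
    refine ⟨⨆ x, f x, hα0, hαt, fun x => (f x / (⨆ x, f x)).toReal, ?_, fun x => by positivity,
      ?_, ?_, ?_⟩
    · exact (hf.div_const _).ennreal_toReal
    · intro x
      exact ENNReal.toReal_le_of_le_ofReal (by simp) (by simpa using hle x)
    · intro t ht
      rcases lt_or_ge t 0 with ht0 | ht0
      · exact ⟨0, lt_of_lt_of_le ht0 (by positivity)⟩
      have : ENNReal.ofReal t * (⨆ x, f x) < ⨆ x, f x := by
        conv_rhs => rw [← one_mul (⨆ x, f x)]
        rw [ENNReal.mul_lt_mul_iff_left hα0 hαt]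
        simpa using ht
      obtain ⟨x, hx⟩ := lt_iSup_iff.1 this
      refine ⟨x, ?_⟩
      rw [← ENNReal.ofReal_lt_iff_lt_toReal ht0 (hnt x)]
      rwa [ENNReal.lt_div_iff_mul_lt (.inl hα0) (.inl hαt)]
    · intro x
      rw [ENNReal.ofReal_toReal (hnt x), ENNReal.mul_div_cancel hα0 hαt]
  by_cases hf0 : (∫⁻ x, f x) = 0
  · simp [hf0, ENNReal.zero_rpow_of_pos ha]
  by_cases hg0 : (∫⁻ x, g x) = 0
  · simp [hg0, ENNReal.zero_rpow_of_pos hb]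
  obtain ⟨α, α0, αt, F, mF, F0, F1, Fs, eF⟩ := key f hf fN hf0
  obtain ⟨β, β0, βt, G, mG, G0, G1, Gs, eG⟩ := key g hg gN hg0
  set γ := α ^ a * β ^ b with hγ
  have γ0 : γ ≠ 0 := by
    simp [hγ, α0, β0, αt, βt]
  have γt : γ ≠ ∞ := ENNReal.mul_ne_top (ENNReal.rpow_ne_top_of_nonneg ha.le αt)
    (ENNReal.rpow_ne_top_of_nonneg hb.le βt)
  have hmt : ∀ x, min (h x / γ) 1 ≠ ∞ := fun x => ne_top_of_le_ne_top (by simp) (min_le_right _ _)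
  have main := pl1_norm (h := fun x => (min (h x / γ) 1).toReal) mF mG
    (((hh.div_const _).min measurable_const).ennreal_toReal) F0 G0 (fun x => by positivity)
    F1 G1 Fs Gs ha hb hab (by
      intro x y
      have h1 : ENNReal.ofReal (F x ^ a * G y ^ b) ≤ min (h (a * x + b * y) / γ) 1 := by
        refine le_min ?_ ?_
        · rw [ENNReal.le_div_iff_mul_le (.inl γ0) (.inl γt)]
          refine le_trans (le_of_eq ?_) (H x y)
          rw [eF, eG, ENNReal.mul_rpow_of_nonneg _ _ ha.le, ENNReal.mul_rpow_of_nonneg _ _ hb.le,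
            ENNReal.ofReal_rpow_of_nonneg (F0 x) ha.le, ENNReal.ofReal_rpow_of_nonneg (G0 y) hb.le,
            ENNReal.ofReal_mul (Real.rpow_nonneg (F0 x) _), hγ]
          ring
        · rw [ENNReal.ofReal_le_one]
          exact mul_le_one₀ (Real.rpow_le_one (F0 x) (F1 x) ha.le) (Real.rpow_nonneg (G0 y) _)
            (Real.rpow_le_one (G0 y) (G1 y) hb.le)
      exact (ENNReal.ofReal_le_iff_le_toReal (hmt _)).1 h1)
  have main2 := (amgm_ennreal _ _ ha hb hab).trans main
  have e1 : (∫⁻ x, f x) = α * ∫⁻ x, ENNReal.ofReal (F x) := by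
    rw [← lintegral_const_mul _ mF.ennreal_ofReal]; simp only [eF]
  have e2 : (∫⁻ x, g x) = β * ∫⁻ x, ENNReal.ofReal (G x) := by
    rw [← lintegral_const_mul _ mG.ennreal_ofReal]; simp only [eG]
  calc (∫⁻ x, f x) ^ a * (∫⁻ x, g x) ^ b
      = γ * ((∫⁻ x, ENNReal.ofReal (F x)) ^ a * (∫⁻ x, ENNReal.ofReal (G x)) ^ b) := by
        rw [e1, e2, ENNReal.mul_rpow_of_nonneg _ _ ha.le, ENNReal.mul_rpow_of_nonneg _ _ hb.le, hγ]
        ring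
    _ ≤ γ * ∫⁻ x, ENNReal.ofReal (min (h x / γ) 1).toReal := by gcongr
    _ ≤ γ * ∫⁻ x, h x / γ := by
        gcongr with x
        rw [ENNReal.ofReal_toReal (hmt x)]
        exact min_le_left _ _
    _ = ∫⁻ x, h x := by
        rw [← lintegral_const_mul _ (hh.div_const _)]
        congr 1; ext x
        exact ENNReal.mul_div_cancel γ0 γt

open Filter Topology in
lemma pl1 {f g h : ℝ → ℝ≥0∞} (hf : Measurable f) (hg : Measurable g) (hh : Measurable h)
    {a b : ℝ} (ha : 0 < a) (hb : 0 < b) (hab : a + b = 1)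
    (H : ∀ x y, f x ^ a * g y ^ b ≤ h (a * x + b * y)) :
    (∫⁻ x, f x) ^ a * (∫⁻ x, g x) ^ b ≤ ∫⁻ x, h x := by
  by_cases hf0 : (∫⁻ x, f x) = 0
  · simp [hf0, ENNReal.zero_rpow_of_pos ha]
  by_cases hg0 : (∫⁻ x, g x) = 0
  · simp [hg0, ENNReal.zero_rpow_of_pos hb]
  have key : ∀ (f : ℝ → ℝ≥0∞), Measurable f →
      Tendsto (fun N : ℕ => ∫⁻ x, min (f x) N) atTop (𝓝 (∫⁻ x, f x)) := by
    intro f hf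
    refine lintegral_tendsto_of_tendsto_of_monotone
      (fun N => (hf.min measurable_const).aemeasurable)
      (.of_forall fun x m n hmn => by dsimp only; gcongr) (.of_forall fun x => ?_)
    have : Tendsto (fun N : ℕ => min (f x) (N : ℝ≥0∞)) atTop (𝓝 (min (f x) ∞)) :=
      tendsto_const_nhds.min ENNReal.tendsto_nat_nhds_top
    simpa using this
  have T : Tendsto (fun N : ℕ => (∫⁻ x, min (f x) N) ^ a * (∫⁻ x, min (g x) N) ^ b) atTop
      (𝓝 ((∫⁻ x, f x) ^ a * (∫⁻ x, g x) ^ b)) := by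
    refine ENNReal.Tendsto.mul ((key f hf).ennrpow_const a) (.inl ?_)
      ((key g hg).ennrpow_const b) (.inl ?_)
    · simp [ENNReal.rpow_eq_zero_iff, hf0, ha.not_gt]
    · simp [ENNReal.rpow_eq_zero_iff, hg0, hb.not_gt]
  refine le_of_tendsto' T fun N => ?_
  refine pl1_bdd (N := N) (hf.min measurable_const) (hg.min measurable_const) hh (by simp)
    (fun x => min_le_right _ _) (fun x => min_le_right _ _) ha hb hab fun x y => ?_
  refine le_trans ?_ (H x y)
  gcongr <;> exact min_le_left _ _

lemma pl_pi {a b : ℝ} (ha : 0 < a) (hb : 0 < b) (hab : a + b = 1) : ∀ (n : ℕ)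
    {f g h : (Fin n → ℝ) → ℝ≥0∞}, Measurable f → Measurable g → Measurable h →
    (∀ x y, f x ^ a * g y ^ b ≤ h (a • x + b • y)) →
    (∫⁻ x, f x) ^ a * (∫⁻ x, g x) ^ b ≤ ∫⁻ x, h x := by
  intro n
  induction n with
  | zero =>
    intro f g h hf hg hh H
    rw [lintegral_unique, lintegral_unique, lintegral_unique]
    have e : (volume : Measure (Fin 0 → ℝ)) univ = 1 := by simp [volume_pi]
    rw [e, mul_one, mul_one, mul_one]
    have h2 := H (@default _ Unique.instInhabited) (@default _ Unique.instInhabited)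
    rw [Subsingleton.elim (a • (@default (Fin 0 → ℝ) Unique.instInhabited) +
      b • (@default (Fin 0 → ℝ) Unique.instInhabited)) (@default _ Unique.instInhabited)] at h2
    exact h2
  | succ n ih =>
    intro f g h hf hg hh H
    let e := MeasurableEquiv.piFinSuccAbove (fun _ : Fin (n + 1) => ℝ) 0
    have he := (volume_preserving_piFinSuccAbove (fun _ : Fin (n + 1) => ℝ) 0).symm
    have conv : ∀ f : (Fin (n + 1) → ℝ) → ℝ≥0∞, Measurable f →
        ∫⁻ x, f x = ∫⁻ s : ℝ, ∫⁻ y : Fin n → ℝ, f (e.symm (s, y)) := by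
      intro f hf
      rw [← he.lintegral_comp hf]
      exact lintegral_prod _ (hf.comp e.symm.measurable).aemeasurable
    rw [conv f hf, conv g hg, conv h hh]
    have mm : ∀ f : (Fin (n + 1) → ℝ) → ℝ≥0∞, Measurable f →
        Measurable fun p : ℝ × (Fin n → ℝ) => f (e.symm p) :=
      fun f hf => hf.comp e.symm.measurable
    refine pl1 (mm f hf).lintegral_prod_right' (mm g hg).lintegral_prod_right'
      (mm h hh).lintegral_prod_right' ha hb hab fun s u => ?_
    refine ih ((mm f hf).comp measurable_prodMk_left) ((mm g hg).comp measurable_prodMk_left)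
      ((mm h hh).comp measurable_prodMk_left) fun y z => ?_
    have : e.symm (a * s + b * u, a • y + b • z) = a • e.symm (s, y) + b • e.symm (u, z) := by
      ext i
      refine Fin.cases ?_ (fun j => ?_) i <;> simp [e, MeasurableEquiv.piFinSuccAbove]
    have h2 := H (e.symm (s, y)) (e.symm (u, z))
    rw [← this] at h2
    exact h2


lemma bm_mul {A B C : Set (EuclideanSpace ℝ (Fin n))} (hA : MeasurableSet A)
    (hB : MeasurableSet B) (hC : MeasurableSet C)
    {a b : ℝ} (ha : 0 < a) (hb : 0 < b) (hab : a + b = 1)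
    (H : ∀ x ∈ A, ∀ y ∈ B, a • x + b • y ∈ C) :
    volume A ^ a * volume B ^ b ≤ volume C := by
  have e := PiLp.volume_preserving_toLp (Fin n)
  have hv : ∀ S : Set (EuclideanSpace ℝ (Fin n)), MeasurableSet S →
      volume S = ∫⁻ x : Fin n → ℝ, S.indicator (1 : EuclideanSpace ℝ (Fin n) → ℝ≥0∞) (WithLp.toLp 2 x) := by
    intro S hS
    rw [e.lintegral_comp (f := S.indicator 1) (measurable_one.indicator hS), lintegral_indicator_one hS]
  have hm : ∀ S : Set (EuclideanSpace ℝ (Fin n)), MeasurableSet S →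
      Measurable fun x : Fin n → ℝ => S.indicator (1 : EuclideanSpace ℝ (Fin n) → ℝ≥0∞) (WithLp.toLp 2 x) := by
    intro S hS
    exact (measurable_one.indicator hS).comp e.measurable
  rw [hv A hA, hv B hB, hv C hC]
  refine pl_pi ha hb hab n (hm A hA) (hm B hB) (hm C hC) fun x y => ?_
  by_cases hx : WithLp.toLp 2 x ∈ A
  · by_cases hy : WithLp.toLp 2 y ∈ B
    · have := H _ hx _ hy
      rw [WithLp.toLp_add, WithLp.toLp_smul, WithLp.toLp_smul]
      simp [hx, hy, this]
    · simp [hy, ENNReal.zero_rpow_of_pos hb]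
  · simp [hx, ENNReal.zero_rpow_of_pos ha]

lemma beta_int (p q : ℕ) : ∫ u in (0:ℝ)..1, u ^ p * (1 - u) ^ q =
    (p.factorial * q.factorial : ℝ) / (p + q + 1).factorial := by
  induction q generalizing p with
  | zero =>
    simp [integral_pow, Nat.factorial_succ]
    field_simp
  | succ q ih =>
    have h := intervalIntegral.integral_eq_sub_of_hasDerivAt (a := (0:ℝ)) (b := 1)
      (f := fun u : ℝ => u ^ (p + 1) * (1 - u) ^ (q + 1))
      (f' := fun u : ℝ => (p + 1) * (u ^ p * (1 - u) ^ (q + 1)) -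
        (q + 1) * (u ^ (p + 1) * (1 - u) ^ q)) (by
        intro u _
        have h1 : HasDerivAt (fun u : ℝ => u ^ (p + 1)) ((p + 1 : ℕ) * u ^ p) u := by
          simpa using hasDerivAt_pow (p + 1) u
        have h2 : HasDerivAt (fun u : ℝ => (1 - u) ^ (q + 1))
            ((q + 1 : ℕ) * (1 - u) ^ q * (-1)) u := by
          simpa using ((hasDerivAt_id u).const_sub 1).fun_pow (q + 1)
        refine (h1.mul h2).congr_deriv ?_
        push_cast; ring) (Continuous.intervalIntegrable (by fun_prop) _ _)
    rw [intervalIntegral.integral_sub (Continuous.intervalIntegrable (by fun_prop) _ _)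
      (Continuous.intervalIntegrable (by fun_prop) _ _),
      intervalIntegral.integral_const_mul, intervalIntegral.integral_const_mul, ih (p + 1)] at h
    simp at h
    have e : p + 1 + q + 1 = p + (q + 1) + 1 := by ring
    rw [e] at h
    have : (0:ℝ) < (p + (q+1) + 1).factorial := by positivity
    rw [eq_div_iff this.ne']
    have hp : (0:ℝ) < p + 1 := by positivity
    apply mul_left_cancel₀ hp.ne'
    rw [Nat.factorial_succ p, Nat.factorial_succ q] at *
    push_cast at *
    field_simp at h
    linarith

lemma beta_int_choose {n : ℕ} (hn : 0 < n) :
    n * ∫ u in (0:ℝ)..1, u ^ n * (1 - u) ^ (n - 1) = 1 / (Nat.choose (2 * n) n : ℝ) := by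
  rw [beta_int, Nat.cast_choose ℝ (by omega : n ≤ 2 * n)]
  obtain ⟨m, rfl⟩ : ∃ m, n = m + 1 := ⟨n - 1, by omega⟩
  have e1 : m + 1 + (m + 1 - 1) + 1 = 2 * (m + 1) := by omega
  have e2 : 2 * (m + 1) - (m + 1) = m + 1 := by omega
  rw [e1, e2]
  simp only [Nat.add_sub_cancel, Nat.factorial_succ m]
  push_cast
  field_simp

/-- integral of the profile: `1` on `[0,a]`, affine decreasing to `0` on `[a,a+b]`. -/
lemma profile_tail {n : ℕ} (hn : 0 < n) {a b : ℝ} (hb : 0 < b) :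
    a ^ n + n * ∫ r in a..(a + b), r ^ (n - 1) * (1 - (r - a) / b) ^ n =
      n * ∫ u in (0:ℝ)..1, (a + b * u) ^ n * (1 - u) ^ (n - 1) := by
  have hb0 := hb.ne'
  have h := intervalIntegral.integral_eq_sub_of_hasDerivAt (a := (0:ℝ)) (b := 1)
      (f := fun u : ℝ => (a + b * u) ^ n * (1 - u) ^ n)
      (f' := fun u : ℝ => n * (b * ((a + b * u) ^ (n - 1) * (1 - u) ^ n)) -
        n * ((a + b * u) ^ n * (1 - u) ^ (n - 1))) (by
        intro u _
        have h1 : HasDerivAt (fun u : ℝ => (a + b * u) ^ n) (n * (a + b * u) ^ (n - 1) * b) u := by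
          simpa using (((hasDerivAt_id u).const_mul b).const_add a).fun_pow n
        have h2 : HasDerivAt (fun u : ℝ => (1 - u) ^ n)
            (n * (1 - u) ^ (n - 1) * (-1)) u := by
          simpa using ((hasDerivAt_id u).const_sub 1).fun_pow n
        refine (h1.mul h2).congr_deriv ?_
        ring) (Continuous.intervalIntegrable (by fun_prop) _ _)
  rw [intervalIntegral.integral_sub (Continuous.intervalIntegrable (by fun_prop) _ _)
      (Continuous.intervalIntegrable (by fun_prop) _ _),
      intervalIntegral.integral_const_mul, intervalIntegral.integral_const_mul] at h
  have hs := intervalIntegral.mul_integral_comp_add_mul (a := 0) (b := 1)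
    (f := fun r => r ^ (n - 1) * (1 - (r - a) / b) ^ n) b a
  simp only [mul_zero, add_zero, mul_one] at hs
  rw [← hs, ← intervalIntegral.integral_const_mul]
  have : ∀ u : ℝ, (a + b * u - a) / b = u := fun u => by field_simp; ring
  simp only [this]
  simp [hn.ne'] at h
  rw [intervalIntegral.integral_const_mul]
  linarith

lemma profile_bound {n : ℕ} (hn : 0 < n) {a b s t : ℝ} (ha : 0 ≤ a) (hb : 0 < b)
    (ht : 0 < t) (hs : a + b * t = s) (hs1 : s ^ n < 1)
    (hst : (s / t) ^ n < Nat.choose (2 * n) n) :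
    n * ∫ u in (0:ℝ)..1, (a + b * u) ^ n * (1 - u) ^ (n - 1) < 1 := by
  have hspos : 0 < s := by rw [← hs]; positivity
  have hC : (0:ℝ) < Nat.choose (2 * n) n := by exact_mod_cast Nat.choose_pos (by omega)
  have hn' : (0:ℝ) < n := by exact_mod_cast hn
  set m := b * t / s with hm
  have hm0 : 0 < m := by positivity
  have hm1 : m ≤ 1 := by rw [hm, div_le_one hspos]; linarith
  have le : ∫ u in (0:ℝ)..1, (a + b * u) ^ n * (1 - u) ^ (n - 1) ≤
      ∫ u in (0:ℝ)..1, ((1 - m) * s ^ n * (u ^ 0 * (1 - u) ^ (n - 1)) +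
        m * (s / t) ^ n * (u ^ n * (1 - u) ^ (n - 1))) := by
    refine intervalIntegral.integral_mono_on zero_le_one
      (Continuous.intervalIntegrable (by fun_prop) _ _)
      (Continuous.intervalIntegrable (by fun_prop) _ _) fun u hu => ?_
    have hc := (convexOn_pow (𝕜 := ℝ) n).2 (x := s) hspos.le (y := s / t * u)
      (mul_nonneg (by positivity) hu.1) (sub_nonneg.2 hm1) hm0.le (by ring)
    simp only [smul_eq_mul] at hc
    have e : (1 - m) * s + m * (s / t * u) = a + b * u := by
      rw [hm]; field_simp; rw [← hs]; ring
    rw [e, mul_pow] at hc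
    have : 0 ≤ (1 - u) ^ (n - 1) := pow_nonneg (by linarith [hu.2]) _
    calc _ ≤ ((1 - m) * s ^ n + m * ((s / t) ^ n * u ^ n)) * (1 - u) ^ (n - 1) := by gcongr
      _ = _ := by ring
  rw [intervalIntegral.integral_add (Continuous.intervalIntegrable (by fun_prop) _ _)
      (Continuous.intervalIntegrable (by fun_prop) _ _),
      intervalIntegral.integral_const_mul, intervalIntegral.integral_const_mul] at le
  have b1 : (n:ℝ) * ∫ u in (0:ℝ)..1, u ^ 0 * (1 - u) ^ (n - 1) = 1 := by
    rw [beta_int]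
    obtain ⟨k, rfl⟩ : ∃ m, n = m + 1 := ⟨n - 1, by omega⟩
    simp [Nat.factorial_succ]
    field_simp
  have b2 := beta_int_choose hn
  have hst' : (s / t) ^ n * (1 / (Nat.choose (2 * n) n : ℝ)) < 1 := by
    rw [mul_one_div, div_lt_one hC]; exact hst
  calc _ ≤ (n:ℝ) * _ := mul_le_mul_of_nonneg_left le hn'.le
    _ = (1 - m) * s ^ n * (n * ∫ u in (0:ℝ)..1, u ^ 0 * (1 - u) ^ (n - 1)) +
        m * ((s / t) ^ n * (n * ∫ u in (0:ℝ)..1, u ^ n * (1 - u) ^ (n - 1))) := by ring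
    _ = (1 - m) * s ^ n + m * ((s / t) ^ n * (1 / (Nat.choose (2 * n) n : ℝ))) := by
      rw [b1, b2]; ring
    _ < 1 := by nlinarith

lemma ray_bound {n : ℕ} (hn : 0 < n) {φ : ℝ → ℝ} {s t : ℝ} (hs : 0 < s) (ht : 0 < t)
    (φ0 : ∀ r, 0 ≤ φ r) (φ1 : ∀ r, φ r ≤ 1) (hφ0 : φ 0 = 1)
    (hc : ∀ u v p q, 0 ≤ u → 0 ≤ v → 0 < p → 0 < q → p + q = 1 → 0 < φ u → 0 < φ v →
      p * φ u + q * φ v ≤ φ (p * u + q * v))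
    (hφs : φ s = 1 - t) (hs1 : s ^ n < 1)
    (hst : (s / t) ^ n < Nat.choose (2 * n) n) :
    n * ∫ r in Ioi (0:ℝ), r ^ (n - 1) * φ r ^ n < 1 := by
  have hn' : (0:ℝ) < n := by exact_mod_cast hn
  have powint : ∀ a : ℝ, n * ∫ r in (0:ℝ)..a, r ^ (n - 1) = a ^ n := by
    intro a
    rw [integral_pow]
    have : n - 1 + 1 = n := by omega
    rw [this]
    have h2 : ((n - 1 : ℕ) : ℝ) + 1 = n := by exact_mod_cast this
    rw [h2, zero_pow hn.ne']
    field_simp; ring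
  by_cases hz : ∀ r > s, φ r = 0
  · have le : ∫ r in Ioi (0:ℝ), r ^ (n - 1) * φ r ^ n ≤
        ∫ r in Ioi (0:ℝ), (Ioc 0 s).indicator (fun r => r ^ (n - 1)) r := by
      refine integral_mono_of_nonneg ?_ ?_ ?_
      · refine (ae_restrict_iff' measurableSet_Ioi).2 (.of_forall fun r hr => ?_)
        exact mul_nonneg (pow_nonneg (le_of_lt hr) _) (pow_nonneg (φ0 r) _)
      · refine Integrable.restrict ?_
        rw [integrable_indicator_iff measurableSet_Ioc]
        exact (Continuous.intervalIntegrable (by fun_prop) 0 s).1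
      · refine (ae_restrict_iff' measurableSet_Ioi).2 (.of_forall fun r hr => ?_)
        have hr : 0 < r := hr
        rcases le_or_gt r s with h | h
        · simp only [indicator_of_mem (show r ∈ Ioc 0 s from ⟨hr, h⟩)]
          exact mul_le_of_le_one_right (by positivity) (pow_le_one₀ (φ0 r) (φ1 r))
        · simp [hz r h, hn.ne', h.not_ge]
    rw [setIntegral_indicator measurableSet_Ioc, inter_eq_self_of_subset_right Ioc_subset_Ioi_self,
      ← intervalIntegral.integral_of_le hs.le] at le
    calc _ ≤ (n:ℝ) * _ := mul_le_mul_of_nonneg_left le hn'.le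
      _ = s ^ n := powint s
      _ < 1 := hs1
  push Not at hz
  obtain ⟨r1, hr1, hφr1⟩ := hz
  have hφr1 : 0 < φ r1 := lt_of_le_of_ne (φ0 _) (Ne.symm hφr1)
  have hpos : ∀ u v, 0 ≤ u → u < s → s < v → 0 < φ u → 0 < φ v →
      0 < φ s ∧ (φ s - φ v) / (v - s) ≥ (φ u - φ s) / (s - u) := by
    intro u v hu hus hsv h1 h2
    have h := hc u v ((v - s) / (v - u)) ((s - u) / (v - u)) hu (by linarith)
      (div_pos (by linarith) (by linarith)) (div_pos (by linarith) (by linarith))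
      (by rw [← add_div]; rw [div_eq_one_iff_eq (by linarith)]; ring) h1 h2
    have e : (v - s) / (v - u) * u + (s - u) / (v - u) * v = s := by
      have : v - u ≠ 0 := by linarith
      field_simp; ring
    rw [e] at h
    refine ⟨lt_of_lt_of_le (by
      have := div_pos (show 0 < v - s by linarith) (show 0 < v - u by linarith)
      have := div_pos (show 0 < s - u by linarith) (show 0 < v - u by linarith)
      positivity) h, ?_⟩
    rw [ge_iff_le, div_le_div_iff₀ (by linarith) (by linarith)]
    have hvu : 0 < v - u := by linarith
    have : (v - s) * φ u + (s - u) * φ v ≤ φ s * (v - u) := by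
      rw [← div_le_iff₀ hvu]
      exact le_trans (le_of_eq (by ring)) h
    nlinarith
  obtain ⟨c, hc1, hc2⟩ := exists_between_of_forall_le
    (s := (fun u => (φ u - φ s) / (s - u)) '' {u | 0 ≤ u ∧ u < s ∧ 0 < φ u})
    (t := (fun v => (φ s - φ v) / (v - s)) '' {v | s < v ∧ 0 < φ v})
    ⟨_, 0, ⟨le_refl _, hs, by rw [hφ0]; norm_num⟩, rfl⟩ ⟨_, r1, ⟨hr1, hφr1⟩, rfl⟩ (by
      rintro _ ⟨u, ⟨hu, hus, h1⟩, rfl⟩ _ ⟨v, ⟨hsv, h2⟩, rfl⟩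
      exact (hpos u v hu hus hsv h1 h2).2)
  have hφs0 := (hpos 0 r1 le_rfl hs hr1 (by rw [hφ0]; norm_num) hφr1).1
  have hcs : t / s ≤ c := by
    have := hc1 ⟨0, ⟨le_refl _, hs, by rw [hφ0]; norm_num⟩, rfl⟩
    simpa [hφ0, hφs] using this
  have hcpos : 0 < c := lt_of_lt_of_le (by positivity) hcs
  -- the bound by the affine function
  have hline : ∀ r, 0 ≤ r → 0 < φ r → φ r ≤ 1 - t - c * (r - s) := by
    intro r hr h
    rw [← hφs]
    rcases lt_trichotomy r s with h1 | h1 | h1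
    · have := hc1 ⟨r, ⟨hr, h1, h⟩, rfl⟩
      simp only at this
      rw [div_le_iff₀ (by linarith)] at this
      linarith
    · simp [h1]
    · have := hc2 ⟨r, ⟨h1, h⟩, rfl⟩
      simp only at this
      rw [le_div_iff₀ (by linarith)] at this
      linarith
  set b := 1 / c with hb
  set a := s - t / c with ha
  have hbpos : 0 < b := by positivity
  have ha0 : 0 ≤ a := by
    rw [ha, sub_nonneg, div_le_iff₀ hcpos]
    rwa [div_le_iff₀ hs, mul_comm] at hcs
  have hab : a + b * t = s := by rw [ha, hb]; ring
  have hline' : ∀ r, 0 ≤ r → 0 < φ r → φ r ≤ 1 - (r - a) / b := by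
    intro r hr h
    refine (hline r hr h).trans (le_of_eq ?_)
    rw [hb, ha]; field_simp; ring
  have main := profile_bound hn ha0 hbpos ht hab hs1 hst
  rw [← profile_tail hn hbpos, ← powint a, ← mul_add] at main
  refine lt_of_le_of_lt ?_ main
  have i1 : IntegrableOn (fun r : ℝ => r ^ (n - 1)) (Ioc 0 a) :=
    (Continuous.intervalIntegrable (by fun_prop) 0 a).1
  have i2 : IntegrableOn (fun r : ℝ => r ^ (n - 1) * (1 - (r - a) / b) ^ n) (Ioc a (a + b)) :=
    (Continuous.intervalIntegrable (by fun_prop) a (a + b)).1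
  have j1 := (integrable_indicator_iff measurableSet_Ioc).2 i1
  have j2 := (integrable_indicator_iff measurableSet_Ioc).2 i2
  gcongr
  have le : ∫ r in Ioi (0:ℝ), r ^ (n - 1) * φ r ^ n ≤
      ∫ r in Ioi (0:ℝ), ((Ioc 0 a).indicator (fun r => r ^ (n - 1)) r +
        (Ioc a (a + b)).indicator (fun r : ℝ => r ^ (n - 1) * (1 - (r - a) / b) ^ n) r) := by
    refine integral_mono_of_nonneg ?_ (j1.add j2).restrict ?_
    · refine (ae_restrict_iff' measurableSet_Ioi).2 (.of_forall fun r hr => ?_)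
      exact mul_nonneg (pow_nonneg (le_of_lt hr) _) (pow_nonneg (φ0 r) _)
    · refine (ae_restrict_iff' measurableSet_Ioi).2 (.of_forall fun r hr => ?_)
      have hr : 0 < r := hr
      rcases le_or_gt r a with h | h
      · have h1 : r ∈ Ioc 0 a := ⟨hr, h⟩
        have h2 : r ∉ Ioc a (a + b) := fun h' => absurd h'.1 h.not_gt
        simp only [indicator_of_mem h1, indicator_of_notMem h2, add_zero]
        exact mul_le_of_le_one_right (by positivity) (pow_le_one₀ (φ0 r) (φ1 r))
      · have h1 : r ∉ Ioc 0 a := fun h' => absurd h'.2 h.not_ge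
        simp only [indicator_of_notMem h1, zero_add]
        rcases (φ0 r).eq_or_lt with hφ | hφ
        · rw [← hφ, zero_pow hn.ne', mul_zero]
          refine indicator_nonneg (fun x hx => ?_) _
          refine mul_nonneg (pow_nonneg (ha0.trans hx.1.le) _) (pow_nonneg ?_ _)
          rw [sub_nonneg, div_le_one hbpos]; linarith [hx.2]
        · have hl := hline' r hr.le hφ
          have h2 : r ∈ Ioc a (a + b) := by
            refine ⟨h, ?_⟩
            have : (r - a) / b < 1 := by linarith
            rw [div_lt_one hbpos] at this
            linarith
          simp only [indicator_of_mem h2]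
          gcongr
  rw [integral_add j1.restrict j2.restrict, setIntegral_indicator measurableSet_Ioc,
    setIntegral_indicator measurableSet_Ioc, inter_eq_self_of_subset_right Ioc_subset_Ioi_self,
    inter_eq_self_of_subset_right (Ioc_subset_Ioi_self.trans (Ioi_subset_Ioi ha0)),
    ← intervalIntegral.integral_of_le ha0, ← intervalIntegral.integral_of_le (by linarith)] at le
  exact le

lemma fiber_compact {K L : Set (EuclideanSpace ℝ (Fin n))} (hK : IsCompact K) (hL : IsCompact L)
    (z : EuclideanSpace ℝ (Fin n)) : IsCompact {x | x ∈ K ∧ z - x ∈ L} := by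
  have : IsClosed ((fun x => z - x) ⁻¹' L) := hL.isClosed.preimage (by fun_prop)
  exact hK.inter_right this

lemma covar_nonneg (K L : Set (EuclideanSpace ℝ (Fin n))) (z : EuclideanSpace ℝ (Fin n)) :
    0 ≤ covar K L z := ENNReal.toReal_nonneg

lemma covar_concave {K L : Set (EuclideanSpace ℝ (Fin n))} (hK : IsConvexBody K)
    (hL : IsConvexBody L) {u v : EuclideanSpace ℝ (Fin n)} {p q α β : ℝ} (hp : 0 < p) (hq : 0 < q)
    (hpq : p + q = 1) (hα : 0 < α) (hβ : 0 < β)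
    (hu : covar K L u = α ^ n) (hv : covar K L v = β ^ n) :
    (p * α + q * β) ^ n ≤ covar K L (p • u + q • v) := by
  have cA := fiber_compact hK.1 hL.1 u
  have cB := fiber_compact hK.1 hL.1 v
  have cC := fiber_compact hK.1 hL.1 (p • u + q • v)
  have vA : volume {x | x ∈ K ∧ u - x ∈ L} = ENNReal.ofReal (α ^ n) := by
    rw [← hu]; exact (ENNReal.ofReal_toReal cA.measure_ne_top).symm
  have vB : volume {x | x ∈ K ∧ v - x ∈ L} = ENNReal.ofReal (β ^ n) := by
    rw [← hv]; exact (ENNReal.ofReal_toReal cB.measure_ne_top).symm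
  have vC : volume {x | x ∈ K ∧ (p • u + q • v) - x ∈ L} =
      ENNReal.ofReal (covar K L (p • u + q • v)) :=
    (ENNReal.ofReal_toReal cC.measure_ne_top).symm
  set D := p * α + q * β with hD
  have hD0 : 0 < D := by positivity
  have hm := bm_mul (A := α⁻¹ • {x | x ∈ K ∧ u - x ∈ L}) (B := β⁻¹ • {x | x ∈ K ∧ v - x ∈ L})
    (C := D⁻¹ • {x | x ∈ K ∧ (p • u + q • v) - x ∈ L}) (a := p * α / D) (b := q * β / D)
    (cA.measurableSet.const_smul₀ _) (cB.measurableSet.const_smul₀ _)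
    (cC.measurableSet.const_smul₀ _) (by positivity) (by positivity)
    (by rw [← add_div]; exact div_self hD0.ne') (by
      rintro _ ⟨x, ⟨hx, hx'⟩, rfl⟩ _ ⟨y, ⟨hy, hy'⟩, rfl⟩
      refine ⟨p • x + q • y, ⟨hK.2.1 hx hy hp.le hq.le hpq, ?_⟩, ?_⟩
      · have := hL.2.1 hx' hy' hp.le hq.le hpq
        convert this using 1
        module
      · simp only [smul_add, smul_smul]
        congr 2 <;> field_simp)
  simp only [Measure.addHaar_smul, finrank_euclideanSpace, Fintype.card_fin, vA, vB, vC] at hm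
  have one : ∀ x : ℝ, 0 < x → ENNReal.ofReal |x⁻¹ ^ n| * ENNReal.ofReal (x ^ n) = 1 := by
    intro x hx
    rw [← ENNReal.ofReal_mul (abs_nonneg _), abs_of_pos (by positivity), ← mul_pow,
      inv_mul_cancel₀ hx.ne']
    simp
  rw [one α hα, one β hβ, ENNReal.one_rpow, ENNReal.one_rpow, one_mul,
    ← ENNReal.ofReal_mul (abs_nonneg _), ENNReal.one_le_ofReal, abs_of_pos (by positivity),
    inv_pow, ← div_eq_inv_mul, one_le_div (by positivity)] at hm
  exact hm

theorem ballBody_covar_subset (hn : 0 < n)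
    (K L : Set (EuclideanSpace ℝ (Fin n)))
    (hK : IsConvexBody K) (hL : IsConvexBody L)
    (hM : Mmax K L = covar K L 0)
    (θ : ℝ) (hθ : ((3:ℝ)/4) ^ n ≤ θ) (hθ1 : θ < 1) :
    ((Nat.choose (2*n) n : ℝ)) ^ ((1:ℝ)/n) • ballBody (covar K L) n ⊆
      (1 - θ ^ ((1:ℝ)/n))⁻¹ • thetaConv K L θ := by
  have hnR : (0:ℝ) < n := by exact_mod_cast hn
  have hθ0 : 0 < θ := lt_of_lt_of_le (by positivity) hθ
  have rpn : ∀ x : ℝ, 0 ≤ x → (x ^ ((1:ℝ)/n)) ^ n = x := by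
    intro x hx
    rw [one_div]; exact Real.rpow_inv_natCast_pow hx hn.ne'
  set C : ℝ := (Nat.choose (2*n) n : ℝ) with hC
  have hC0 : 0 < C := by rw [hC]; exact_mod_cast Nat.choose_pos (by omega)
  have hC4 : C < 4 ^ n := by
    rw [hC, ← Nat.centralBinom_eq_two_mul_choose]
    exact_mod_cast Nat.centralBinom_lt_four_pow hn.ne'
  set c : ℝ := C ^ ((1:ℝ)/n) with hc
  have hc0 : 0 < c := Real.rpow_pos_of_pos hC0 _
  have hcn : c ^ n = C := rpn C hC0.le
  set w : ℝ := θ ^ ((1:ℝ)/n) with hw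
  have hwn : w ^ n = θ := rpn θ hθ0.le
  have hw0 : 0 < w := Real.rpow_pos_of_pos hθ0 _
  have hw1 : w < 1 := by
    by_contra h
    have := one_le_pow₀ (n := n) (not_lt.1 h)
    linarith
  have hw34 : 3 / 4 ≤ w := by
    by_contra h
    have := pow_lt_pow_left₀ (not_le.1 h) hw0.le hn.ne'
    linarith
  -- boundedness and positivity of the maximum
  have hbdd : BddAbove (range (covar K L)) := by
    refine ⟨(volume K).toReal, ?_⟩
    rintro _ ⟨z, rfl⟩
    exact ENNReal.toReal_mono hK.1.measure_ne_top (measure_mono fun x hx => hx.1)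
  have hmax : ∀ z, covar K L z ≤ covar K L 0 := fun z => hM ▸ le_ciSup hbdd z
  have hpos : 0 < covar K L 0 := by
    obtain ⟨k, hk⟩ := hK.2.2
    obtain ⟨l, hl⟩ := hL.2.2
    refine lt_of_lt_of_le ?_ (hmax (k + l))
    refine ENNReal.toReal_pos ?_ (fiber_compact hK.1 hL.1 _).measure_ne_top
    have ho : IsOpen (interior K ∩ (fun x => k + l - x) ⁻¹' interior L) :=
      isOpen_interior.inter (isOpen_interior.preimage (by fun_prop))
    have hp := ho.measure_pos volume ⟨k, hk, by simpa using hl⟩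
    have hsub : interior K ∩ (fun x => k + l - x) ⁻¹' interior L ⊆
        {x | x ∈ K ∧ k + l - x ∈ L} :=
      fun x hx => ⟨interior_subset hx.1, interior_subset hx.2⟩
    exact (lt_of_lt_of_le hp (measure_mono hsub)).ne'
  rintro _ ⟨x, hx, rfl⟩
  rw [mem_inv_smul_set_iff₀ (by linarith)]
  simp only [smul_smul]
  have hmain : θ * covar K L 0 ≤ covar K L (((1 - w) * c) • x) := by
    by_contra hlt
    push Not at hlt
    set M := covar K L 0 with hMdef
    set φ : ℝ → ℝ := fun r => (covar K L (r • x) / M) ^ ((1:ℝ)/n) with hφ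
    have φn : ∀ r, φ r ^ n = covar K L (r • x) / M := fun r =>
      rpn _ (div_nonneg (covar_nonneg _ _ _) hpos.le)
    have φ0 : ∀ r, 0 ≤ φ r := fun r =>
      Real.rpow_nonneg (div_nonneg (covar_nonneg _ _ _) hpos.le) _
    have φ1 : ∀ r, φ r ≤ 1 := fun r =>
      Real.rpow_le_one (div_nonneg (covar_nonneg _ _ _) hpos.le)
        ((div_le_one hpos).2 (hmax _)) (by positivity)
    have hφ0 : φ 0 = 1 := by
      simp only [hφ, zero_smul]
      rw [← hMdef, div_self hpos.ne', Real.one_rpow]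
    set m := M ^ ((1:ℝ)/n) with hm
    have hm0 : 0 < m := Real.rpow_pos_of_pos hpos _
    have hmn : m ^ n = M := rpn M hpos.le
    set s := (1 - w) * c with hs
    have hφs : φ s < w := by
      by_contra h
      have h2 := pow_le_pow_left₀ hw0.le (not_lt.1 h) n
      rw [hwn, φn, le_div_iff₀ hpos] at h2
      linarith
    have hs0 : 0 < s := mul_pos (by linarith) hc0
    have hR := ray_bound hn (φ := φ) (s := s) (t := 1 - φ s) hs0 (by linarith) φ0 φ1 hφ0 (by
        intro u v p q _ _ hp hq hpq h1 h2
        have h := covar_concave hK hL (u := u • x) (v := v • x) (α := m * φ u) (β := m * φ v)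
          hp hq hpq (mul_pos hm0 h1) (mul_pos hm0 h2)
          (by rw [mul_pow, hmn, φn]; field_simp) (by rw [mul_pow, hmn, φn]; field_simp)
        rw [smul_smul, smul_smul, ← add_smul] at h
        have h3 : (p * φ u + q * φ v) ^ n ≤ φ (p * u + q * v) ^ n := by
          rw [φn, le_div_iff₀ hpos]
          refine le_trans (le_of_eq ?_) h
          rw [← hmn, ← mul_pow]; ring
        exact le_of_pow_le_pow_left₀ hn.ne' (φ0 _) h3) (by ring) (by
        have : s ^ n ≤ (1 / 4) ^ n * C := by
          rw [hs, mul_pow, hcn]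
          gcongr
          linarith
        have h4 : (1 / 4 : ℝ) ^ n * C < (1 / 4) ^ n * 4 ^ n := by gcongr
        rw [← mul_pow] at h4
        norm_num at h4 this ⊢
        linarith) (by
        rw [← hC, ← hcn]
        have : s / (1 - φ s) < c := by
          rw [div_lt_iff₀ (by linarith)]
          calc s = c * (1 - w) := by rw [hs, mul_comm]
            _ < c * (1 - φ s) := by gcongr
        exact pow_lt_pow_left₀ this (div_nonneg hs0.le (by linarith)) hn.ne')
    have hx' : M ≤ n * ∫ r in Ioi (0:ℝ), r ^ ((n:ℝ) - 1) * covar K L (r • x) := hx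
    have e : ∫ r in Ioi (0:ℝ), r ^ ((n:ℝ) - 1) * covar K L (r • x) =
        M * ∫ r in Ioi (0:ℝ), r ^ (n - 1) * φ r ^ n := by
      rw [← integral_const_mul]
      refine setIntegral_congr_fun measurableSet_Ioi fun r hr => ?_
      rw [φn, ← Real.rpow_natCast r (n - 1), Nat.cast_sub (by omega), Nat.cast_one]
      field_simp
    rw [e] at hx'
    nlinarith
  refine ⟨?_, by rw [hM]; exact hmain⟩
  have hp2 : 0 < covar K L (((1 - w) * c) • x) := lt_of_lt_of_le (by positivity) hmain
  have hne : {y | y ∈ K ∧ ((1 - w) * c) • x - y ∈ L}.Nonempty := by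
    by_contra h
    rw [not_nonempty_iff_eq_empty] at h
    simp [covar, h] at hp2
  obtain ⟨y, hy1, hy2⟩ := hne
  exact ⟨y, hy1, _, hy2, by simp⟩
end

section
/- Let K, L ⊆ ℝ^n be convex bodies. If K +_θ L = (1 − θ^{1/n})(K + L) for every θ ∈ [0,1], then K = −L is an n-dimensional simplex, and conversely. -/
open MeasureTheory Set Pointwise

variable {n : ℕ}

section Helpers

/-- The slice `K ∩ (z - L)`. -/
def slc (K L : Set (EuclideanSpace ℝ (Fin n))) (z : EuclideanSpace ℝ (Fin n)) :
    Set (EuclideanSpace ℝ (Fin n)) := {x | x ∈ K ∧ z - x ∈ L}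

lemma slc_compact {K L : Set (EuclideanSpace ℝ (Fin n))} (hK : IsCompact K) (hL : IsCompact L)
    (z : EuclideanSpace ℝ (Fin n)) : IsCompact (slc K L z) := by
  have : slc K L z = K ∩ (fun x => z - x) ⁻¹' L := rfl
  rw [this]
  exact hK.inter_right (hL.isClosed.preimage (by fun_prop))

lemma slc_convex {K L : Set (EuclideanSpace ℝ (Fin n))} (hK : Convex ℝ K) (hL : Convex ℝ L)
    (z : EuclideanSpace ℝ (Fin n)) : Convex ℝ (slc K L z) := by
  intro x hx y hy a b ha hb hab
  refine ⟨hK hx.1 hy.1 ha hb hab, ?_⟩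
  have h := hL hx.2 hy.2 ha hb hab
  have e : z - (a • x + b • y) = a • (z - x) + b • (z - y) := by
    have : z = (a + b) • z := by rw [hab, one_smul]
    calc z - (a • x + b • y) = (a + b) • z - (a • x + b • y) := by rw [← this]
      _ = _ := by module
  rw [e]; exact h

lemma covar_eq (K L : Set (EuclideanSpace ℝ (Fin n))) (z : EuclideanSpace ℝ (Fin n)) :
    covar K L z = (volume (slc K L z)).toReal := rfl

lemma covar_bdd {K L : Set (EuclideanSpace ℝ (Fin n))} (hK : IsCompact K) :
    BddAbove (range (covar K L)) := by
  refine ⟨(volume K).toReal, ?_⟩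
  rintro _ ⟨z, rfl⟩
  exact ENNReal.toReal_mono hK.measure_lt_top.ne (measure_mono fun x hx => hx.1)

lemma covar_le_Mmax {K L : Set (EuclideanSpace ℝ (Fin n))} (hK : IsCompact K)
    (z : EuclideanSpace ℝ (Fin n)) : covar K L z ≤ Mmax K L :=
  le_ciSup (covar_bdd hK) z

lemma covar_pos {K L : Set (EuclideanSpace ℝ (Fin n))} (hK : IsConvexBody K)
    {x y : EuclideanSpace ℝ (Fin n)} (hx : x ∈ K) (hy : y ∈ interior L) :
    0 < covar K L (x + y) := by
  rw [covar_eq]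
  have hfin : volume (slc K L (x + y)) < ⊤ :=
    lt_of_le_of_lt (measure_mono fun x hx => hx.1) hK.1.measure_lt_top
  refine ENNReal.toReal_pos ?_ hfin.ne
  have hcl : x ∈ closure (interior K) := by
    rw [hK.2.1.closure_interior_eq_closure_of_nonempty_interior hK.2.2]
    exact subset_closure hx
  have hU : IsOpen ((fun w => x + y - w) ⁻¹' interior L) :=
    isOpen_interior.preimage (by fun_prop)
  have hne := mem_closure_iff.1 hcl _ hU (by simpa using hy)
  have hpos := (hU.inter isOpen_interior).measure_pos (volume) hne
  refine (lt_of_lt_of_le hpos (measure_mono ?_)).ne'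
  rintro w ⟨hw1, hw2⟩
  exact ⟨interior_subset hw2, interior_subset (s := L) hw1⟩

lemma Mmax_pos {K L : Set (EuclideanSpace ℝ (Fin n))} (hK : IsConvexBody K)
    (hL : IsConvexBody L) : 0 < Mmax K L := by
  obtain ⟨x, hx⟩ := hK.2.2
  obtain ⟨y, hy⟩ := hL.2.2
  exact (covar_pos hK (interior_subset hx) hy).trans_le (covar_le_Mmax hK.1 _)

lemma covar_comm (K L : Set (EuclideanSpace ℝ (Fin n))) (z : EuclideanSpace ℝ (Fin n)) :
    covar K L z = covar L K z := by
  unfold covar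
  congr 1
  have h := (Measure.measurePreserving_sub_left (volume : Measure (EuclideanSpace ℝ (Fin n))) z)
  have := h.measure_preimage_equiv (f := MeasurableEquiv.subLeft z) {x | x ∈ K ∧ z - x ∈ L}
  rw [← this]
  congr 1
  ext x
  change (z - x ∈ K ∧ z - (z - x) ∈ L) ↔ (x ∈ L ∧ z - x ∈ K)
  rw [sub_sub_cancel, and_comm]

lemma Mmax_comm (K L : Set (EuclideanSpace ℝ (Fin n))) : Mmax K L = Mmax L K := by
  unfold Mmax
  simp_rw [covar_comm K L]

/-- Nested convex compact sets with the same positive volume coincide. -/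
lemma eq_of_volume {S T : Set (EuclideanSpace ℝ (Fin n))} (hS : Convex ℝ S) (hSc : IsCompact S)
    (hT : IsCompact T) (hTS : T ⊆ S) (hv : volume S = volume T) (hpos : volume S ≠ 0) :
    S = T := by
  have hint : (interior S).Nonempty := by
    by_contra hne
    rw [not_nonempty_iff_eq_empty] at hne
    apply hpos
    have h1 : S ⊆ frontier S := by
      rw [hSc.isClosed.frontier_eq, hne, sdiff_empty]
    exact measure_mono_null h1 (hS.addHaar_frontier volume)
  refine Subset.antisymm ?_ hTS
  intro p hp
  by_contra hpT
  have hcl : p ∈ closure (interior S) := by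
    rw [hS.closure_interior_eq_closure_of_nonempty_interior hint]
    exact subset_closure hp
  have hne := mem_closure_iff.1 hcl _ hT.isClosed.isOpen_compl hpT
  have hp2 := (hT.isClosed.isOpen_compl.inter isOpen_interior).measure_pos (volume) hne
  have h2 : volume (S \ T) = 0 := by
    rw [measure_sdiff hTS hT.measurableSet.nullMeasurableSet hT.measure_lt_top.ne, hv, tsub_self]
  have h3 := measure_mono_null (t := S \ T) (s := Tᶜ ∩ interior S) (μ := volume)
    (fun w hw => ⟨interior_subset hw.2, hw.1⟩) h2
  exact hp2.ne' h3

/-- Reformulated hypothesis. -/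
structure Hyp (K L : Set (EuclideanSpace ℝ (Fin n))) : Prop where
  npos : 0 < n
  hK : IsConvexBody K
  hL : IsConvexBody L
  iff : ∀ s ∈ Icc (0:ℝ) 1, ∀ z,
    z ∈ s • (K + L) ↔ z ∈ K + L ∧ (1 - s) ^ n * Mmax K L ≤ covar K L z

lemma Hyp.of {K L : Set (EuclideanSpace ℝ (Fin n))} (hn : 0 < n)
    (hK : IsConvexBody K) (hL : IsConvexBody L)
    (H : ∀ θ ∈ Icc (0:ℝ) 1, thetaConv K L θ = (1 - θ ^ ((1:ℝ)/n)) • (K + L)) : Hyp K L := by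
  refine ⟨hn, hK, hL, fun s hs z => ?_⟩
  have h0 : 0 ≤ 1 - s := by linarith [hs.2]
  have h := H ((1 - s) ^ n) ⟨by positivity, pow_le_one₀ h0 (by linarith [hs.1])⟩
  rw [one_div, Real.pow_rpow_inv_natCast h0 hn.ne', sub_sub_cancel] at h
  rw [← h]
  rfl

lemma Hyp.symm {K L : Set (EuclideanSpace ℝ (Fin n))} (H : Hyp K L) : Hyp L K := by
  refine ⟨H.npos, H.hL, H.hK, fun s hs z => ?_⟩
  rw [add_comm L K, Mmax_comm L K, covar_comm L K]
  exact H.iff s hs z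

/-- Extremal points of the sum. -/
def Extr (K L : Set (EuclideanSpace ℝ (Fin n))) (z : EuclideanSpace ℝ (Fin n)) : Prop :=
  z ∈ K + L ∧ ∀ s : ℝ, 0 ≤ s → s < 1 → z ∉ s • (K + L)

lemma Hyp.zero_mem {K L : Set (EuclideanSpace ℝ (Fin n))} (H : Hyp K L) :
    (0 : EuclideanSpace ℝ (Fin n)) ∈ K + L ∧ covar K L 0 = Mmax K L := by
  have h := (H.iff 0 ⟨le_rfl, zero_le_one⟩ 0).1 (by
    obtain ⟨x, hx⟩ := H.hK.2.2
    obtain ⟨y, hy⟩ := H.hL.2.2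
    exact ⟨x + y, add_mem_add (interior_subset hx) (interior_subset hy), by simp⟩)
  refine ⟨h.1, le_antisymm (covar_le_Mmax H.hK.1 _) ?_⟩
  simpa using h.2

/-- Every nonzero point of the sum is a multiple of an extremal point. -/
lemma Hyp.exists_extr {K L : Set (EuclideanSpace ℝ (Fin n))} (H : Hyp K L)
    {z : EuclideanSpace ℝ (Fin n)} (hz : z ∈ K + L) (hz0 : z ≠ 0) :
    ∃ s : ℝ, ∃ z₀, 0 < s ∧ s ≤ 1 ∧ z = s • z₀ ∧ Extr K L z₀ ∧
      covar K L z = (1 - s) ^ n * Mmax K L := by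
  have hM := Mmax_pos H.hK H.hL
  have hc0 : 0 ≤ covar K L z := ENNReal.toReal_nonneg
  have hc1 : covar K L z / Mmax K L ≤ 1 := (div_le_one hM).2 (covar_le_Mmax H.hK.1 z)
  obtain ⟨r, hr⟩ : ∃ r : ℝ, r = (covar K L z / Mmax K L) ^ ((n:ℝ)⁻¹) := ⟨_, rfl⟩
  have hd0 : 0 ≤ covar K L z / Mmax K L := by positivity
  have hr0 : 0 ≤ r := by rw [hr]; positivity
  have hr1 : r ≤ 1 := by rw [hr]; exact Real.rpow_le_one hd0 hc1 (by positivity)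
  have hrn : covar K L z = r ^ n * Mmax K L := by
    rw [hr, Real.rpow_inv_natCast_pow hd0 H.npos.ne']
    field_simp
  have key : ∀ s ∈ Icc (0:ℝ) 1, z ∈ s • (K + L) ↔ 1 - r ≤ s := by
    intro s hs
    rw [H.iff s hs z, hrn, mul_le_mul_iff_left₀ hM,
      pow_le_pow_iff_left₀ (by linarith [hs.2]) hr0 H.npos.ne']
    constructor
    · intro h; linarith [h.2]
    · intro h; exact ⟨hz, by linarith⟩
  have hs0 : 0 < 1 - r := by
    rcases (sub_nonneg.2 hr1).lt_or_eq with h | h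
    · exact h
    · exfalso
      have h2 := (key 0 ⟨le_rfl, zero_le_one⟩).2 h.symm.le
      obtain ⟨w, -, hw⟩ := h2
      exact hz0 (by simpa using hw.symm)
  obtain ⟨z₀, hz₀, hzz⟩ := (key (1 - r) ⟨hs0.le, by linarith⟩).2 le_rfl
  refine ⟨1 - r, z₀, hs0, by linarith, hzz.symm, ⟨hz₀, ?_⟩, by rw [sub_sub_cancel]; exact hrn⟩
  rintro s hs hs1 ⟨w, hw, hwz⟩
  have h3 : z ∈ ((1 - r) * s) • (K + L) := by
    refine ⟨w, hw, ?_⟩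
    have : (1 - r) • z₀ = z := hzz
    rw [← this, ← hwz]
    simp only [mul_smul]
  have h4 := (key ((1 - r) * s) ⟨by positivity, by nlinarith⟩).1 h3
  nlinarith

/-- The volume along rays. -/
lemma Hyp.covar_ray {K L : Set (EuclideanSpace ℝ (Fin n))} (H : Hyp K L)
    {z : EuclideanSpace ℝ (Fin n)} (hz : Extr K L z) {t : ℝ} (ht0 : 0 ≤ t) (ht1 : t ≤ 1) :
    covar K L (t • z) = (1 - t) ^ n * Mmax K L := by
  rcases ht0.eq_or_lt with h | ht
  · subst h; simp [H.zero_mem.2]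
  have hz0 : z ≠ 0 := by
    rintro rfl
    exact hz.2 0 le_rfl zero_lt_one ⟨0, H.zero_mem.1, by simp⟩
  have hm := (H.iff t ⟨ht0, ht1⟩ (t • z)).1 (smul_mem_smul_set hz.1)
  obtain ⟨s, z₁, hs0, hs1, he, hz₁, hc⟩ := H.exists_extr hm.1 (smul_ne_zero ht.ne' hz0)
  have hst : s = t := by
    rcases lt_trichotomy s t with h | h | h
    · exfalso
      refine hz.2 (s / t) (by positivity) ((div_lt_one ht).2 h) ⟨z₁, hz₁.1, ?_⟩
      have : z = t⁻¹ • (t • z) := by rw [smul_smul, inv_mul_cancel₀ ht.ne', one_smul]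
      rw [this, he, smul_smul]
      field_simp
    · exact h
    · exfalso
      refine hz₁.2 (t / s) (by positivity) ((div_lt_one hs0).2 h) ⟨z, hz.1, ?_⟩
      have : z₁ = s⁻¹ • (s • z₁) := by rw [smul_smul, inv_mul_cancel₀ hs0.ne', one_smul]
      rw [this, ← he, smul_smul]
      field_simp
  rw [hc, hst]

/-- Homothety of slices. -/
lemma Hyp.slc_ray {K L : Set (EuclideanSpace ℝ (Fin n))} (H : Hyp K L)
    {z x : EuclideanSpace ℝ (Fin n)} (hz : Extr K L z) (hx : x ∈ slc K L z)
    {t : ℝ} (ht0 : 0 ≤ t) (ht1 : t < 1) :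
    slc K L (t • z) = (fun a => t • x + (1 - t) • a) '' slc K L 0 := by
  have hM := Mmax_pos H.hK H.hL
  have hA := slc_compact H.hK.1 H.hL.1 (0 : EuclideanSpace ℝ (Fin n))
  have hS := slc_compact H.hK.1 H.hL.1 (t • z)
  have h1t : 0 < 1 - t := by linarith
  have hr := H.covar_ray hz ht0 ht1.le
  apply eq_of_volume (slc_convex H.hK.2.1 H.hL.2.1 _) hS
  · exact hA.image (by fun_prop)
  · rintro _ ⟨a, ha, rfl⟩
    refine ⟨H.hK.2.1 hx.1 ha.1 ht0 h1t.le (by ring), ?_⟩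
    have h := H.hL.2.1 hx.2 ha.2 ht0 h1t.le (by ring)
    have e : t • z - (t • x + (1 - t) • a) = t • (z - x) + (1 - t) • (0 - a) := by module
    simp only [e]; exact h
  · have e : (fun a => t • x + (1 - t) • a) '' slc K L 0
        = (fun a => t • x + a) '' ((1 - t) • slc K L 0) := by
      rw [← image_smul, image_image]
    rw [e, image_add_left, measure_preimage_add, Measure.addHaar_smul]
    rw [← ENNReal.toReal_eq_toReal_iff' hS.measure_lt_top.ne
      (ENNReal.mul_ne_top ENNReal.ofReal_ne_top hA.measure_lt_top.ne)]
    rw [ENNReal.toReal_mul, ← covar_eq, ← covar_eq, hr, H.zero_mem.2, finrank_euclideanSpace_fin,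
      abs_of_nonneg (by positivity), ENNReal.toReal_ofReal (by positivity)]
  · intro h0
    rw [covar_eq, h0] at hr
    have : 0 < (1 - t) ^ n * Mmax K L := by positivity
    rw [← hr] at this
    simp at this

lemma Hyp.slc_unique {K L : Set (EuclideanSpace ℝ (Fin n))} (H : Hyp K L)
    {z x y : EuclideanSpace ℝ (Fin n)} (hz : Extr K L z) (hx : x ∈ slc K L z)
    (hy : y ∈ slc K L z) : x = y := by
  have hM := Mmax_pos H.hK H.hL
  have hA := slc_compact H.hK.1 H.hL.1 (0 : EuclideanSpace ℝ (Fin n))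
  have hne : (slc K L (0 : EuclideanSpace ℝ (Fin n))).Nonempty := by
    obtain ⟨x, hx, y, hy, hxy⟩ := H.zero_mem.1
    refine ⟨x, hx, ?_⟩
    have : (0 : EuclideanSpace ℝ (Fin n)) - x = y := by
      rw [← hxy]; simp
    rw [this]; exact hy
  obtain ⟨a, ha, hmax⟩ := hA.exists_isMaxOn hne
    (f := fun a => inner ℝ (x - y) a) (by fun_prop)
  have e := (H.slc_ray hz hx (t := 1 / 2) (by norm_num) (by norm_num)).symm.trans
    (H.slc_ray hz hy (t := 1 / 2) (by norm_num) (by norm_num))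
  have hm : (1 / 2 : ℝ) • x + (1 - 1 / 2 : ℝ) • a ∈
    (fun a => (1 / 2 : ℝ) • y + (1 - 1 / 2 : ℝ) • a) '' slc K L 0 := by
    rw [← e]; exact ⟨a, ha, rfl⟩
  obtain ⟨b, hb, hbe⟩ := hm
  have hb2 : b = a + (x - y) := by
    have h2 : (2:ℝ) • ((1 / 2 : ℝ) • y + (1 - 1 / 2 : ℝ) • b)
      = (2:ℝ) • ((1 / 2 : ℝ) • x + (1 - 1 / 2 : ℝ) • a) := by
      simp only at hbe
      rw [hbe]
    have h3 : y + b = x + a := by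
      convert h2 using 1 <;> module
    rw [eq_sub_of_add_eq' h3]; abel
  have := hmax hb
  simp only [mem_ofPred_eq, hb2, inner_add_right, real_inner_self_eq_norm_sq] at this
  have h4 : ‖x - y‖ = 0 := by nlinarith [norm_nonneg (x - y)]
  exact sub_eq_zero.1 (norm_eq_zero.1 h4)

lemma Extr.exists_slc {K L : Set (EuclideanSpace ℝ (Fin n))}
    {z : EuclideanSpace ℝ (Fin n)} (hz : z ∈ K + L) : ∃ x, x ∈ slc K L z := by
  obtain ⟨x, hx, y, hy, rfl⟩ := hz
  exact ⟨x, hx, by simpa using hy⟩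

lemma extreme_comb {K : Set (EuclideanSpace ℝ (Fin n))} {x a b : EuclideanSpace ℝ (Fin n)}
    (hx : x ∈ K.extremePoints ℝ) (ha : a ∈ K) (hb : b ∈ K) {s : ℝ} (hs0 : 0 < s) (hs1 : s < 1)
    (h : s • a + (1 - s) • b = x) : a = x ∧ b = x :=
  (mem_extremePoints.1 hx).2 a ha b hb ⟨s, 1 - s, hs0, by linarith, by ring, h⟩

lemma Hyp.subset {K L : Set (EuclideanSpace ℝ (Fin n))} (H : Hyp K L) : K ⊆ -L := by
  have hext : K.extremePoints ℝ ⊆ -L := by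
    intro x hx
    by_contra hxL
    have hxK := (mem_extremePoints.1 hx).1
    obtain ⟨y, hy⟩ := H.hL.2.2
    have hz : x + y ∈ K + L := add_mem_add hxK (interior_subset hy)
    have hz0 : x + y ≠ 0 := by
      intro h
      apply hxL
      rw [mem_neg, ← eq_neg_of_add_eq_zero_right h]
      exact interior_subset hy
    obtain ⟨s, z₀, hs0, hs1, he, hz₀, hc⟩ := H.exists_extr hz hz0
    have hpos := covar_pos H.hK hxK hy
    have hs1' : s < 1 := by
      rcases hs1.lt_or_eq with h | h
      · exact h
      · rw [hc, h, sub_self, zero_pow H.npos.ne'] at hpos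
        simp at hpos
    obtain ⟨x₀, hx₀⟩ := Extr.exists_slc hz₀.1
    have hm : x ∈ slc K L (s • z₀) := by
      rw [← he]
      exact ⟨hxK, by simpa using interior_subset hy⟩
    rw [H.slc_ray hz₀ hx₀ hs0.le hs1'] at hm
    obtain ⟨a, ha, hax⟩ := hm
    have := extreme_comb hx hx₀.1 ha.1 hs0 hs1' hax
    apply hxL
    have h2 := ha.2
    rw [this.2, zero_sub] at h2
    exact h2
  rw [← closure_convexHull_extremePoints H.hK.1 H.hK.2.1]
  refine closure_minimal (convexHull_min hext H.hL.2.1.neg) H.hL.1.isClosed.neg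

lemma Hyp.eq_neg {K L : Set (EuclideanSpace ℝ (Fin n))} (H : Hyp K L) : K = -L := by
  refine Subset.antisymm H.subset ?_
  have := H.symm.subset
  intro x hx
  have h := this hx
  simpa using h

lemma Hyp.extr_sub {K L : Set (EuclideanSpace ℝ (Fin n))} (H : Hyp K L)
    {x y : EuclideanSpace ℝ (Fin n)} (hx : x ∈ K.extremePoints ℝ) (hy : y ∈ K.extremePoints ℝ)
    (hxy : x ≠ y) : Extr K L (x - y) := by
  have hxK := (mem_extremePoints.1 hx).1
  have hyK := (mem_extremePoints.1 hy).1
  have hyL : -y ∈ L := by rw [H.eq_neg] at hyK; exact hyK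
  have hz : x - y ∈ K + L := by
    rw [sub_eq_add_neg]; exact add_mem_add hxK hyL
  obtain ⟨s, z₀, hs0, hs1, he, hz₀, hc⟩ := H.exists_extr hz (sub_ne_zero.2 hxy)
  rcases hs1.lt_or_eq with h | h
  · exfalso
    obtain ⟨x₀, hx₀⟩ := Extr.exists_slc hz₀.1
    have hm : x ∈ slc K L (s • z₀) := by
      rw [← he]
      exact ⟨hxK, by simpa using hyL⟩
    rw [H.slc_ray hz₀ hx₀ hs0.le h] at hm
    obtain ⟨a, ha, hax⟩ := hm
    have h1 := extreme_comb hx hx₀.1 ha.1 hs0 h hax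
    have hy₀ : x₀ - z₀ ∈ K := by
      rw [H.eq_neg, mem_neg, neg_sub]; exact hx₀.2
    have h2 := extreme_comb hy hy₀ ha.1 hs0 h (by
      have : y = x - s • z₀ := by rw [← he]; abel
      rw [this, ← hax]
      module)
    exact hxy (h1.2.symm.trans h2.2)
  · rw [h, one_smul] at he
    rwa [he]

/-- The cone over `K`. -/
def cn (K : Set (EuclideanSpace ℝ (Fin n))) : Set (EuclideanSpace ℝ (Fin n) × ℝ) :=
  {v | 0 ≤ v.2 ∧ v.1 ∈ v.2 • K}

lemma cn_add {K : Set (EuclideanSpace ℝ (Fin n))} (hK : Convex ℝ K)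
    {v w : EuclideanSpace ℝ (Fin n) × ℝ} (hv : v ∈ cn K) (hw : w ∈ cn K) : v + w ∈ cn K := by
  refine ⟨add_nonneg hv.1 hw.1, ?_⟩
  show v.1 + w.1 ∈ (v.2 + w.2) • K
  rw [hK.add_smul hv.1 hw.1]
  exact add_mem_add hv.2 hw.2

lemma cn_smul {K : Set (EuclideanSpace ℝ (Fin n))}
    {v : EuclideanSpace ℝ (Fin n) × ℝ} (hv : v ∈ cn K) {r : ℝ} (hr : 0 ≤ r) : r • v ∈ cn K := by
  refine ⟨mul_nonneg hr hv.1, ?_⟩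
  obtain ⟨k, hk, hkv⟩ := hv.2
  refine ⟨k, hk, ?_⟩
  show (r * v.2) • k = r • v.1
  rw [← hkv]; simp [mul_smul]

/-- Disjointness in the cone order. -/
def Dsj (K : Set (EuclideanSpace ℝ (Fin n))) (a b : EuclideanSpace ℝ (Fin n) × ℝ) : Prop :=
  ∀ v, v + a ∈ cn K → v + b ∈ cn K → v ∈ cn K

lemma Dsj.symm {K : Set (EuclideanSpace ℝ (Fin n))} {a b : EuclideanSpace ℝ (Fin n) × ℝ}
    (h : Dsj K a b) : Dsj K b a := fun v h1 h2 => h v h2 h1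

lemma Dsj.convex {K : Set (EuclideanSpace ℝ (Fin n))} (hK : Convex ℝ K)
    {a : EuclideanSpace ℝ (Fin n) × ℝ} (ha : a ∈ cn K) :
    Convex ℝ {b : EuclideanSpace ℝ (Fin n) | (b, (1:ℝ)) ∈ cn K ∧ Dsj K a (b, 1)} := by
  intro b hb c hc r s hr hs hrs
  have e : (r • b + s • c, (1:ℝ)) = r • (b, (1:ℝ)) + s • (c, (1:ℝ)) := by
    ext1
    · simp
    · simp [hrs]
  refine ⟨by rw [e]; exact cn_add hK (cn_smul hb.1 hr) (cn_smul hc.1 hs), ?_⟩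
  rw [e]
  intro v h1 h2
  have key : ∀ (d : EuclideanSpace ℝ (Fin n)) (q : ℝ), 0 ≤ q → q ≤ 1 →
      (d, (1:ℝ)) ∈ cn K → Dsj K a (d, 1) → Dsj K a (q • (d, (1:ℝ))) := by
    intro d q hq hq1 hd hD v h1 h2
    refine hD v h1 ?_
    have : v + (d, (1:ℝ)) = (v + q • (d, (1:ℝ))) + (1 - q) • (d, (1:ℝ)) := by module
    rw [this]
    exact cn_add hK h2 (cn_smul hd (by linarith))
  refine key c s hs (by linarith) hc.1 hc.2 v h1 ?_
  refine key b r hr (by linarith) hb.1 hb.2 _ ?_ ?_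
  · have : v + s • (c, (1:ℝ)) + a = (v + a) + s • (c, (1:ℝ)) := by abel
    rw [this]
    exact cn_add hK h1 (cn_smul hc.1 hs)
  · have : v + s • (c, (1:ℝ)) + r • (b, (1:ℝ)) = v + (r • (b, (1:ℝ)) + s • (c, (1:ℝ))) := by abel
    rw [this]
    exact h2

lemma Hyp.dsj {K L : Set (EuclideanSpace ℝ (Fin n))} (H : Hyp K L)
    {x y : EuclideanSpace ℝ (Fin n)} (hx : x ∈ K.extremePoints ℝ) (hy : y ∈ K.extremePoints ℝ)
    (hxy : x ≠ y) : Dsj K (x, 1) (y, 1) := by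
  have hE := H.extr_sub hx hy hxy
  have hxK := (mem_extremePoints.1 hx).1
  have hyK := (mem_extremePoints.1 hy).1
  have neg_mem : ∀ w, w ∈ K → -w ∈ L := fun w hw => by rw [H.eq_neg] at hw; exact hw
  have hxs : x ∈ slc K L (x - y) := ⟨hxK, by simpa using neg_mem y hyK⟩
  rintro ⟨w, l⟩ ⟨h0, k, hk, hkw⟩ ⟨-, k', hk', hkw'⟩
  replace h0 : 0 ≤ l + 1 := h0
  replace hkw : (l + 1) • k = w + x := hkw
  replace hkw' : (l + 1) • k' = w + y := hkw'
  have hsub : (l + 1) • (k - k') = x - y := by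
    rw [smul_sub, hkw, hkw']; abel
  have hkk : k - k' ∈ K + L := by
    rw [sub_eq_add_neg]; exact add_mem_add hk (neg_mem _ hk')
  have hl : 0 ≤ l := by
    by_contra hl
    exact hE.2 (l + 1) h0 (by linarith) ⟨_, hkk, hsub⟩
  refine ⟨hl, ?_⟩
  show w ∈ l • K
  rcases hl.eq_or_lt with h | h
  · subst h
    have hks : k ∈ slc K L (x - y) := by
      refine ⟨hk, ?_⟩
      rw [← hsub]
      simpa using neg_mem _ hk'
    have hkx := H.slc_unique hE hks hxs
    refine ⟨x, hxK, ?_⟩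
    rw [hkx] at hkw
    simp only [zero_add, one_smul] at hkw
    have hw : w = 0 := by simpa using hkw.symm
    simp [hw]
  · have hl1 : 0 < l + 1 := by linarith
    have hks : k ∈ slc K L ((1 / (l + 1)) • (x - y)) := by
      refine ⟨hk, ?_⟩
      rw [← hsub, smul_smul, one_div, inv_mul_cancel₀ hl1.ne', one_smul]
      simpa using neg_mem _ hk'
    rw [H.slc_ray hE hxs (by positivity) (by rw [div_lt_one hl1]; linarith)] at hks
    obtain ⟨a, ha, hak⟩ := hks
    refine ⟨a, ha.1, ?_⟩
    have : w = (l + 1) • k - x := by rw [hkw]; abel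
    rw [this, ← hak]
    simp only [smul_add, smul_smul]
    rw [mul_one_div_cancel hl1.ne', one_smul]
    have : (l + 1) * (1 - 1 / (l + 1)) = l := by field_simp; ring
    rw [this]; abel

lemma mem_cn_one {K : Set (EuclideanSpace ℝ (Fin n))} {x : EuclideanSpace ℝ (Fin n)}
    (hx : x ∈ K) : (x, (1:ℝ)) ∈ cn K := ⟨zero_le_one, x, hx, by simp⟩

lemma Hyp.affineIndependent {K L : Set (EuclideanSpace ℝ (Fin n))} (H : Hyp K L) :
    AffineIndependent ℝ ((↑) : K.extremePoints ℝ → EuclideanSpace ℝ (Fin n)) := by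
  by_contra hna
  obtain ⟨I, p, hpI, hpJ⟩ := Convex.radon_partition hna
  have hKc := H.hK.2.1
  have step1 : ∀ i ∈ I, Dsj K ((i : EuclideanSpace ℝ (Fin n)), 1) (p, 1) := by
    intro i hi
    have hiK := (mem_extremePoints.1 i.2).1
    refine (convexHull_min ?_ (Dsj.convex hKc (mem_cn_one hiK)) hpJ).2
    rintro _ ⟨j, hj, rfl⟩
    refine ⟨mem_cn_one (mem_extremePoints.1 j.2).1, H.dsj i.2 j.2 ?_⟩
    intro hij
    exact hj (Subtype.ext hij ▸ hi)
  have hpK : p ∈ K := by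
    refine convexHull_min ?_ hKc hpI
    rintro _ ⟨j, hj, rfl⟩
    exact (mem_extremePoints.1 j.2).1
  have step2 : Dsj K (p, 1) (p, 1) := by
    refine (convexHull_min ?_ (Dsj.convex hKc (mem_cn_one hpK)) hpI).2
    rintro _ ⟨j, hj, rfl⟩
    exact ⟨mem_cn_one (mem_extremePoints.1 j.2).1, (step1 j hj).symm⟩
  have h0 : -(p, (1:ℝ)) + (p, (1:ℝ)) ∈ cn K := by
    rw [neg_add_cancel]
    exact ⟨le_rfl, p, hpK, by simp⟩
  have := (step2 _ h0 h0).1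
  simp at this
  linarith

lemma Hyp.simplex {K L : Set (EuclideanSpace ℝ (Fin n))} (H : Hyp K L) : IsSimplexBody K := by
  have hai := H.affineIndependent
  have hfin : (K.extremePoints ℝ).Finite := finite_set_of_fin_dim_affineIndependent ℝ hai
  have hKe : convexHull ℝ (K.extremePoints ℝ) = K := by
    have := closure_convexHull_extremePoints H.hK.1 H.hK.2.1
    rwa [(hfin.isCompact_convexHull ℝ).isClosed.closure_eq] at this
  have hspan : affineSpan ℝ (K.extremePoints ℝ) = ⊤ := by
    rw [← interior_convexHull_nonempty_iff_affineSpan_eq_top, hKe]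
    exact H.hK.2.2
  have := hfin.fintype
  have hcard := (hai.affineSpan_eq_top_iff_card_eq_finrank_add_one).1 (by
    rw [Subtype.range_coe]; exact hspan)
  rw [finrank_euclideanSpace_fin] at hcard
  let e := (Fintype.equivFinOfCardEq hcard).symm
  refine ⟨fun i => (e i : EuclideanSpace ℝ (Fin n)), hai.comp_embedding e.toEmbedding, ?_⟩
  have : range (fun i => (e i : EuclideanSpace ℝ (Fin n))) = K.extremePoints ℝ := by
    rw [show (fun i => (e i : EuclideanSpace ℝ (Fin n))) = Subtype.val ∘ e from rfl,
      e.surjective.range_comp, Subtype.range_coe]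
  rw [this, hKe]

/-- Linear part of a barycentric coordinate. -/
noncomputable def ell (b : AffineBasis (Fin (n + 1)) ℝ (EuclideanSpace ℝ (Fin n)))
    (i : Fin (n + 1)) : EuclideanSpace ℝ (Fin n) →ₗ[ℝ] ℝ := (b.coord i).linear

lemma coord_add (b : AffineBasis (Fin (n + 1)) ℝ (EuclideanSpace ℝ (Fin n)))
    (i : Fin (n + 1)) (x w : EuclideanSpace ℝ (Fin n)) :
    b.coord i (x + w) = b.coord i x + ell b i w := by
  have := (b.coord i).map_vadd x w
  simp only [vadd_eq_add] at this
  rw [add_comm x w, this, add_comm]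
  rfl

lemma sum_ell (b : AffineBasis (Fin (n + 1)) ℝ (EuclideanSpace ℝ (Fin n)))
    (w : EuclideanSpace ℝ (Fin n)) : ∑ i, ell b i w = 0 := by
  have h1 := b.sum_coord_apply_eq_one (0 + w)
  simp_rw [coord_add, Finset.sum_add_distrib, b.sum_coord_apply_eq_one] at h1
  linarith

/-- The gauge of the difference body of the simplex. -/
noncomputable def gg (b : AffineBasis (Fin (n + 1)) ℝ (EuclideanSpace ℝ (Fin n)))
    (z : EuclideanSpace ℝ (Fin n)) : ℝ := ∑ i, max 0 (ell b i z)

lemma gg_nonneg (b : AffineBasis (Fin (n + 1)) ℝ (EuclideanSpace ℝ (Fin n)))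
    (z : EuclideanSpace ℝ (Fin n)) : 0 ≤ gg b z :=
  Finset.sum_nonneg fun i _ => le_max_left _ _

lemma gg_smul (b : AffineBasis (Fin (n + 1)) ℝ (EuclideanSpace ℝ (Fin n)))
    (z : EuclideanSpace ℝ (Fin n)) {s : ℝ} (hs : 0 ≤ s) : gg b (s • z) = s * gg b z := by
  unfold gg
  rw [Finset.mul_sum]
  refine Finset.sum_congr rfl fun i _ => ?_
  rw [map_smul, smul_eq_mul, mul_max_of_nonneg _ _ hs, mul_zero]

lemma eq_of_coord (b : AffineBasis (Fin (n + 1)) ℝ (EuclideanSpace ℝ (Fin n)))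
    {x y : EuclideanSpace ℝ (Fin n)} (h : ∀ i, b.coord i x = b.coord i y) : x = y :=
  b.ext_elem h

lemma exists_coord (b : AffineBasis (Fin (n + 1)) ℝ (EuclideanSpace ℝ (Fin n)))
    (c : Fin (n + 1) → ℝ) (hc : ∑ i, c i = 1) : ∃ x, ∀ i, b.coord i x = c i :=
  ⟨Finset.univ.affineCombination ℝ b c, fun i =>
    b.coord_apply_combination_of_mem (Finset.mem_univ i) hc⟩

lemma eq_zero_of_gg (b : AffineBasis (Fin (n + 1)) ℝ (EuclideanSpace ℝ (Fin n)))
    {z : EuclideanSpace ℝ (Fin n)} (h : gg b z = 0) : z = 0 := by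
  have h1 : ∀ i, ell b i z ≤ 0 := by
    intro i
    have := (Finset.sum_eq_zero_iff_of_nonneg (fun i _ => le_max_left (0:ℝ) (ell b i z))).1 h i
      (Finset.mem_univ i)
    rw [← this]; exact le_max_right _ _
  have h2 : ∀ i, ell b i z = 0 := fun i =>
    (Finset.sum_eq_zero_iff_of_nonpos (fun i _ => h1 i)).1 (sum_ell b z) i (Finset.mem_univ i)
  apply eq_of_coord b
  intro i
  have := coord_add b i 0 z
  rw [zero_add, h2, add_zero] at this
  exact this

lemma slc_simplex (b : AffineBasis (Fin (n + 1)) ℝ (EuclideanSpace ℝ (Fin n)))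
    {K L : Set (EuclideanSpace ℝ (Fin n))} (hKb : K = convexHull ℝ (range b)) (hKL : K = -L)
    (z x : EuclideanSpace ℝ (Fin n)) :
    x ∈ slc K L z ↔ ∀ i, max 0 (ell b i z) ≤ b.coord i x := by
  have hmem : ∀ w, w ∈ K ↔ ∀ i, 0 ≤ b.coord i w := by
    intro w
    rw [hKb, b.convexHull_eq_nonneg_coord]; rfl
  have h2 : z - x ∈ L ↔ x + -z ∈ K := by
    rw [hKL, mem_neg]; simp [sub_eq_add_neg, add_comm]
  show (x ∈ K ∧ z - x ∈ L) ↔ _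
  rw [h2, hmem, hmem, ← forall_and]
  refine forall_congr' fun i => ?_
  rw [coord_add, map_neg, max_le_iff]
  constructor
  · rintro ⟨h1, h2⟩; exact ⟨h1, by linarith⟩
  · rintro ⟨h1, h2⟩; exact ⟨h1, by linarith⟩

lemma slc_simplex_image (b : AffineBasis (Fin (n + 1)) ℝ (EuclideanSpace ℝ (Fin n)))
    {K L : Set (EuclideanSpace ℝ (Fin n))} (hKb : K = convexHull ℝ (range b)) (hKL : K = -L)
    {z : EuclideanSpace ℝ (Fin n)} (hz : gg b z ≤ 1) :
    ∃ q, slc K L z = (fun a => q + (1 - gg b z) • a) '' K := by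
  have hmem : ∀ w, w ∈ K ↔ ∀ i, 0 ≤ b.coord i w := by
    intro w
    rw [hKb, b.convexHull_eq_nonneg_coord]; rfl
  obtain ⟨x₀, hx₀⟩ := exists_coord b
    (fun i => max 0 (ell b i z) + (1 - gg b z) * b.coord i (b 0)) (by
      rw [Finset.sum_add_distrib, ← Finset.mul_sum, b.sum_coord_apply_eq_one]
      show gg b z + _ = 1
      ring)
  have hc : ∀ a i, b.coord i (x₀ + (1 - gg b z) • (a - b 0)) =
      max 0 (ell b i z) + (1 - gg b z) * b.coord i a := by
    intro a i
    have : b.coord i a = b.coord i (b 0) + ell b i (a - b 0) := by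
      rw [← coord_add]; simp
    rw [coord_add, hx₀, map_smul, smul_eq_mul, this]
    ring
  have e : ∀ a, x₀ - (1 - gg b z) • b 0 + (1 - gg b z) • a = x₀ + (1 - gg b z) • (a - b 0) := by
    intro a; module
  refine ⟨x₀ - (1 - gg b z) • b 0, ?_⟩
  simp_rw [e]
  have h1g : 0 ≤ 1 - gg b z := by linarith
  ext x
  rw [slc_simplex b hKb hKL]
  constructor
  · intro h
    rcases h1g.eq_or_lt with h0 | h0
    · refine ⟨b 0, ?_, ?_⟩
      · rw [hKb]; exact subset_convexHull ℝ _ (mem_range_self 0)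
      · apply eq_of_coord b
        intro i
        simp only [hc]
        rw [← h0, zero_mul, add_zero]
        have hs : ∑ i, max 0 (ell b i z) = ∑ i, b.coord i x := by
          rw [b.sum_coord_apply_eq_one]
          show gg b z = 1
          linarith
        exact (Finset.sum_eq_sum_iff_of_le (fun i _ => h i)).1 hs i (Finset.mem_univ i)
    · have hx : x = x₀ + (1 - gg b z) • ((b 0 + (1 - gg b z)⁻¹ • (x - x₀)) - b 0) := by
        rw [add_sub_cancel_left, smul_smul, mul_inv_cancel₀ h0.ne', one_smul]; abel
      refine ⟨b 0 + (1 - gg b z)⁻¹ • (x - x₀), ?_, hx.symm⟩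
      rw [hmem]
      intro i
      have h3 := h i
      rw [hx, hc] at h3
      have h4 : 0 ≤ (1 - gg b z) * b.coord i (b 0 + (1 - gg b z)⁻¹ • (x - x₀)) := by linarith
      exact nonneg_of_mul_nonneg_right h4 h0
  · rintro ⟨a, ha, rfl⟩ i
    simp only [hc]
    have := mul_nonneg h1g ((hmem a).1 ha i)
    linarith

lemma simplex_thetaConv (hn : 0 < n) {K L : Set (EuclideanSpace ℝ (Fin n))}
    (hK : IsConvexBody K) (hs : IsSimplexBody K) (hKL : K = -L) (θ : ℝ) (hθ : θ ∈ Icc (0:ℝ) 1) :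
    thetaConv K L θ = (1 - θ ^ ((1:ℝ)/n)) • (K + L) := by
  obtain ⟨v, hv, hKv⟩ := hs
  have hspan : affineSpan ℝ (range v) = ⊤ := by
    rw [hv.affineSpan_eq_top_iff_card_eq_finrank_add_one]
    simp
  obtain ⟨b, rfl⟩ : ∃ b : AffineBasis (Fin (n + 1)) ℝ (EuclideanSpace ℝ (Fin n)), ⇑b = v :=
    ⟨⟨v, hv, hspan⟩, rfl⟩
  have hKne : K.Nonempty := hK.2.2.mono interior_subset
  have hV : 0 < (volume K).toReal := by
    refine ENNReal.toReal_pos ?_ hK.1.measure_lt_top.ne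
    exact ((isOpen_interior.measure_pos volume hK.2.2).trans_le
      (measure_mono interior_subset)).ne'
  have hD : ∀ z, z ∈ K + L ↔ gg b z ≤ 1 := by
    intro z
    constructor
    · intro hz
      obtain ⟨x, hx⟩ := Extr.exists_slc hz
      rw [slc_simplex b hKv hKL] at hx
      rw [← b.sum_coord_apply_eq_one x]
      exact Finset.sum_le_sum fun i _ => hx i
    · intro hz
      obtain ⟨q, hq⟩ := slc_simplex_image b hKv hKL hz
      have : (slc K L z).Nonempty := by rw [hq]; exact hKne.image _
      obtain ⟨x, hx⟩ := this
      exact ⟨x, hx.1, z - x, hx.2, by simp⟩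
  have hcov : ∀ z, gg b z ≤ 1 → covar K L z = (1 - gg b z) ^ n * (volume K).toReal := by
    intro z hz
    obtain ⟨q, hq⟩ := slc_simplex_image b hKv hKL hz
    have h0 : 0 ≤ 1 - gg b z := by linarith
    have e : (fun a => q + (1 - gg b z) • a) '' K
        = (fun a => q + a) '' ((1 - gg b z) • K) := by
      rw [← image_smul, image_image]
    rw [covar_eq, hq, e, image_add_left, measure_preimage_add, Measure.addHaar_smul,
      ENNReal.toReal_mul, finrank_euclideanSpace_fin,
      abs_of_nonneg (by positivity), ENNReal.toReal_ofReal (by positivity)]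
  have hg0 : gg b 0 = 0 := by simp [gg]
  have hM : Mmax K L = (volume K).toReal := by
    apply le_antisymm
    · refine ciSup_le fun z => ?_
      exact ENNReal.toReal_mono hK.1.measure_lt_top.ne (measure_mono fun x hx => hx.1)
    · have := covar_le_Mmax (L := L) hK.1 0
      rw [hcov 0 (by rw [hg0]; exact zero_le_one), hg0] at this
      simpa using this
  obtain ⟨r, hr⟩ : ∃ r : ℝ, r = θ ^ ((1:ℝ)/n) := ⟨_, rfl⟩
  have hr0 : 0 ≤ r := by rw [hr]; exact Real.rpow_nonneg hθ.1 _
  have hr1 : r ≤ 1 := by rw [hr]; exact Real.rpow_le_one hθ.1 hθ.2 (by positivity)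
  have hrn : θ = r ^ n := by
    rw [hr, one_div, Real.rpow_inv_natCast_pow hθ.1 hn.ne']
  rw [← hr]
  ext z
  have hL : z ∈ thetaConv K L θ ↔ gg b z ≤ 1 - r := by
    show (z ∈ K + L ∧ θ * Mmax K L ≤ covar K L z) ↔ _
    rw [hD, hM, hrn]
    constructor
    · rintro ⟨h1, h2⟩
      rw [hcov z h1, mul_le_mul_iff_left₀ hV,
        pow_le_pow_iff_left₀ hr0 (by linarith) hn.ne'] at h2
      linarith
    · intro h
      have h1 : gg b z ≤ 1 := by linarith
      refine ⟨h1, ?_⟩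
      rw [hcov z h1, mul_le_mul_iff_left₀ hV,
        pow_le_pow_iff_left₀ hr0 (by linarith) hn.ne']
      linarith
  rw [hL]
  have hs0 : 0 ≤ 1 - r := by linarith
  constructor
  · intro h
    rcases hs0.eq_or_lt with h0 | h0
    · rw [← h0] at h ⊢
      have hz := eq_zero_of_gg b (le_antisymm h (gg_nonneg b z))
      exact ⟨0, (hD 0).2 (by rw [hg0]; exact zero_le_one), by simp [hz]⟩
    · refine ⟨(1 - r)⁻¹ • z, (hD _).2 ?_, ?_⟩
      · rw [gg_smul b z (by positivity), inv_mul_le_iff₀ h0]; linarith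
      · simp only [smul_smul, mul_inv_cancel₀ h0.ne', one_smul]
  · rintro ⟨w, hw, rfl⟩
    show gg b ((1 - r) • w) ≤ _
    rw [gg_smul b w hs0]
    have := (hD w).1 hw
    nlinarith

end Helpers

theorem thetaConv_eq_dilate_iff_simplex (hn : 0 < n)
    (K L : Set (EuclideanSpace ℝ (Fin n)))
    (hK : IsConvexBody K) (hL : IsConvexBody L) :
    (∀ θ ∈ Icc (0:ℝ) 1, thetaConv K L θ = (1 - θ ^ ((1:ℝ)/n)) • (K + L)) ↔
      (K = -L ∧ IsSimplexBody K) := by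
  constructor
  · intro H
    have h := Hyp.of hn hK hL H
    exact ⟨h.eq_neg, h.simplex⟩
  · rintro ⟨hKL, hs⟩ θ hθ
    exact simplex_thetaConv hn hK hs hKL θ hθ
end
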